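/- For every dimension d ≥ 1, every integer m with 0 ≤ m ≤ d−1, and every ε > 0 there exists N₀ such that: for any finite point sets P₀, …, P_m in ℝ^d, where each P_i has cardinality (d−m+1)·n_i with n_i ≥ N₀ and is partitioned into d−m+1 color classes of size n_i each, there exists an m-dimensional affine subspace L of ℝ^d such that for every i = 0, …, m, the number of rainbow (d−m+1)-tuples of points of P_i (one point from each color class of P_i) whose convex hull intersects L is at least (2(d−m)/((d−m+1)!·(d−m+1)) − ε) · n_i^{d−m+1}. -/

import Mathlib

/-! ### Chains of lists with coefficients in `ZMod 2` -/

namespace HeavyFlat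

open Finsupp

/-- Augmented ordered chains on a vertex type, modulo two: formal sums of lists of vertices. -/
abbrev Chain (α : Type*) := List α →₀ ZMod 2

section Chains

variable {α β : Type*}

/-- Join with a vertex, put in front. -/
noncomputable def cone (a : α) : Chain α →ₗ[ZMod 2] Chain α :=
  Finsupp.lmapDomain (ZMod 2) (ZMod 2) (List.cons a)

/-- The boundary of a list of vertices. -/
noncomputable def bdList : List α → Chain α
  | [] => 0
  | x :: xs => single xs 1 + cone x (bdList xs)

/-- The boundary operator. -/
noncomputable def bd : Chain α →ₗ[ZMod 2] Chain α :=
  Finsupp.linearCombination (ZMod 2) bdList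

/-- The chain map induced by a map of vertices. -/
noncomputable def chainMap (f : α → β) : Chain α →ₗ[ZMod 2] Chain β :=
  Finsupp.lmapDomain (ZMod 2) (ZMod 2) (List.map f)

/-- Evaluation of a cochain on chains. -/
noncomputable def ev (φ : List α → ZMod 2) : Chain α →ₗ[ZMod 2] ZMod 2 :=
  Finsupp.linearCombination (ZMod 2) φ

/-- The coboundary of a cochain. -/
noncomputable def cobd (φ : List α → ZMod 2) (l : List α) : ZMod 2 := ev φ (bdList l)

@[simp] lemma cone_single (a : α) (l : List α) (c : ZMod 2) :
    cone a (single l c) = single (a :: l) c := by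
  simp [cone]

@[simp] lemma bd_single (l : List α) : bd (single l 1) = bdList l := by
  simp [bd]

@[simp] lemma ev_single (φ : List α → ZMod 2) (l : List α) : ev φ (single l 1) = φ l := by
  simp [ev]

@[simp] lemma chainMap_single (f : α → β) (l : List α) (c : ZMod 2) :
    chainMap f (single l c) = single (l.map f) c := by
  simp [chainMap]

@[simp] lemma bdList_nil : bdList ([] : List α) = 0 := rfl

@[simp] lemma bdList_cons (x : α) (xs : List α) :
    bdList (x :: xs) = single xs 1 + cone x (bdList xs) := rfl

lemma add_self_chain (c : Chain α) : c + c = 0 := by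
  ext l; simp [CharTwo.add_self_eq_zero]

/-- Two linear maps on chains agree if they agree on lists. -/
lemma chain_hom_ext {M : Type*} [AddCommMonoid M] [Module (ZMod 2) M]
    {f g : Chain α →ₗ[ZMod 2] M} (h : ∀ l, f (single l 1) = g (single l 1)) : f = g := by
  ext l; simpa using h l

lemma bd_cone (x : α) (c : Chain α) : bd (cone x c) = c + cone x (bd c) := by
  have : bd ∘ₗ cone x = LinearMap.id + cone x ∘ₗ bd := by
    apply chain_hom_ext; intro l; simp
  simpa using LinearMap.congr_fun this c

lemma bd_bdList (l : List α) : bd (bdList l) = 0 := by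
  induction l with
  | nil => simp
  | cons x xs ih => simp [bd_cone, ih, add_self_chain]

lemma chainMap_cone (f : α → β) (a : α) (c : Chain α) :
    chainMap f (cone a c) = cone (f a) (chainMap f c) := by
  have : chainMap f ∘ₗ cone a = cone (f a) ∘ₗ chainMap f := by
    apply chain_hom_ext; intro l; simp
  simpa using LinearMap.congr_fun this c

lemma bdList_map (f : α → β) (l : List α) : bdList (l.map f) = chainMap f (bdList l) := by
  induction l with
  | nil => simp
  | cons x xs ih => simp [chainMap_cone, ih]

lemma chainMap_bd (f : α → β) (c : Chain α) : chainMap f (bd c) = bd (chainMap f c) := by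
  have : chainMap f ∘ₗ bd = bd ∘ₗ chainMap f := by
    apply chain_hom_ext; intro l; simp [bdList_map]
  simpa using LinearMap.congr_fun this c

lemma chainMap_chainMap {γ : Type*} (f : α → β) (g : β → γ) (c : Chain α) :
    chainMap g (chainMap f c) = chainMap (g ∘ f) c := by
  have : chainMap g ∘ₗ chainMap f = chainMap (g ∘ f) := by
    apply chain_hom_ext; intro l; simp
  simpa using LinearMap.congr_fun this c

lemma ev_chainMap (f : α → β) (φ : List β → ZMod 2) (c : Chain α) :
    ev φ (chainMap f c) = ev (fun l => φ (l.map f)) c := by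
  have : ev φ ∘ₗ chainMap f = ev (fun l => φ (l.map f)) := by
    apply chain_hom_ext; intro l; simp
  simpa using LinearMap.congr_fun this c

lemma ev_cone (φ : List α → ZMod 2) (a : α) (c : Chain α) :
    ev φ (cone a c) = ev (fun l => φ (a :: l)) c := by
  have : ev φ ∘ₗ cone a = ev (fun l => φ (a :: l)) := by
    apply chain_hom_ext; intro l; simp
  simpa using LinearMap.congr_fun this c

lemma ev_bd (φ : List α → ZMod 2) (c : Chain α) : ev φ (bd c) = ev (cobd φ) c := by
  have : ev φ ∘ₗ bd = ev (cobd φ) := by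
    apply chain_hom_ext; intro l; simp [cobd]
  simpa using LinearMap.congr_fun this c

lemma ev_add (φ ψ : List α → ZMod 2) (c : Chain α) :
    ev (fun l => φ l + ψ l) c = ev φ c + ev ψ c := by
  have : ev (fun l => φ l + ψ l) = ev φ + ev ψ := by
    apply chain_hom_ext; intro l; simp
  simpa using LinearMap.congr_fun this c

lemma ev_mul_left (r : ZMod 2) (φ : List α → ZMod 2) (c : Chain α) :
    ev (fun l => r * φ l) c = r * ev φ c := by
  have : ev (fun l => r * φ l) = r • ev φ := by
    apply chain_hom_ext; intro l; simp
  simpa using LinearMap.congr_fun this c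

lemma ev_congr {φ ψ : List α → ZMod 2} {c : Chain α} (h : ∀ l ∈ c.support, φ l = ψ l) :
    ev φ c = ev ψ c := by
  simp only [ev, Finsupp.linearCombination_apply, Finsupp.sum]
  exact Finset.sum_congr rfl fun l hl => by rw [h l hl]

lemma ev_eq_zero {φ : List α → ZMod 2} {c : Chain α} (h : ∀ l ∈ c.support, φ l = 0) :
    ev φ c = 0 := by
  rw [ev_congr (ψ := fun _ => 0) h]
  simp [ev, Finsupp.linearCombination_apply, Finsupp.sum]

lemma cobd_cons (φ : List α → ZMod 2) (x : α) (l : List α) :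
    cobd φ (x :: l) = φ l + cobd (fun l' => φ (x :: l')) l := by
  simp [cobd, ev_cone]

@[simp] lemma cobd_nil (φ : List α → ZMod 2) : cobd φ [] = 0 := by simp [cobd]

/-- A property of lists which a cone map produces holds on the support of the cone. -/
lemma support_cone {a : α} {c : Chain α} {l : List α} (h : l ∈ (cone a c).support) :
    ∃ l' ∈ c.support, l = a :: l' := by
  classical
  have := Finsupp.mapDomain_support h
  obtain ⟨l', h', rfl⟩ := Finset.mem_image.1 this
  exact ⟨l', h', rfl⟩

lemma support_chainMap {f : α → β} {c : Chain α} {l : List β}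
    (h : l ∈ (chainMap f c).support) : ∃ l' ∈ c.support, l = l'.map f := by
  classical
  have := Finsupp.mapDomain_support h
  obtain ⟨l', h', rfl⟩ := Finset.mem_image.1 this
  exact ⟨l', h', rfl⟩

lemma support_add {c e : Chain α} {l : List α} (h : l ∈ (c + e).support) :
    l ∈ c.support ∨ l ∈ e.support := by
  classical
  exact Finset.mem_union.1 (Finsupp.support_add h)

lemma support_bdList {l l' : List α} (h : l' ∈ (bdList l).support) :
    l'.Sublist l ∧ l'.length + 1 = l.length := by
  induction l generalizing l' with
  | nil => simp at h
  | cons x xs ih =>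
    rcases support_add h with h | h
    · have : l' = xs := by simpa using h
      subst this
      exact ⟨List.sublist_cons_self _ _, by simp⟩
    · obtain ⟨l'', h'', rfl⟩ := support_cone h
      obtain ⟨h1, h2⟩ := ih h''
      exact ⟨h1.cons_cons x, by simp [h2]⟩

lemma support_sum {ι : Type*} {s : Finset ι} {c : ι → Chain α} {l : List α}
    (h : l ∈ (∑ i ∈ s, c i).support) : ∃ i ∈ s, l ∈ (c i).support := by
  classical
  have := Finsupp.support_finsetSum h
  simpa using this

lemma cobd_congr {φ ψ : List α → ZMod 2} {l : List α}
    (h : ∀ l', l'.Sublist l → l'.length + 1 = l.length → φ l' = ψ l') :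
    cobd φ l = cobd ψ l :=
  ev_congr fun l' hl' => h l' (support_bdList hl').1 (support_bdList hl').2

lemma cobd_add (φ ψ : List α → ZMod 2) (l : List α) :
    cobd (fun l' => φ l' + ψ l') l = cobd φ l + cobd ψ l := ev_add φ ψ _

lemma cobd_cobd (φ : List α → ZMod 2) (l : List α) : cobd (cobd φ) l = 0 := by
  rw [cobd, ← ev_bd, bd_bdList, map_zero]

lemma cobd_map (f : α → β) (φ : List β → ZMod 2) (l : List α) :
    cobd φ (l.map f) = cobd (fun l' => φ (l'.map f)) l := by
  rw [cobd, bdList_map, ev_chainMap, cobd]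

lemma cobd_eq_sum (φ : List α → ZMod 2) (l : List α) :
    cobd φ l = ∑ i : Fin l.length, φ (l.eraseIdx i) := by
  induction l generalizing φ with
  | nil => simp
  | cons x xs ih =>
    rw [cobd_cons, ih]
    simp [Fin.sum_univ_succ]

end Chains

/-! ### Cup products -/

section Cup

variable {α β : Type*}

/-- The cup product of a cochain of degree `p` with another cochain. -/
def cup (p : ℕ) (φ ψ : List α → ZMod 2) (l : List α) : ZMod 2 :=
  φ (l.take (p + 1)) * ψ (l.drop p)

lemma cup_succ_cons (p : ℕ) (φ ψ : List α → ZMod 2) (x : α) (l : List α) :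
    cup (p + 1) φ ψ (x :: l) = cup p (fun l' => φ (x :: l')) ψ l := by
  simp [cup]

/-- The Leibniz rule. -/
lemma cobd_cup (p : ℕ) (φ ψ : List α → ZMod 2) (l : List α) (hl : p + 2 ≤ l.length) :
    cobd (cup p φ ψ) l = cup (p + 1) (cobd φ) ψ l + cup p φ (cobd ψ) l := by
  induction p generalizing φ l with
  | zero =>
    obtain ⟨v, w, r, rfl⟩ : ∃ v w r, l = v :: w :: r := by
      match l, hl with
      | v :: w :: r, _ => exact ⟨v, w, r, rfl⟩
    simp only [cobd_cons, cup, List.take, List.drop, cobd_nil]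
    have : cobd (fun l' => φ [v] * ψ (v :: w :: l')) r
        = φ [v] * cobd (fun l' => ψ (v :: w :: l')) r := ev_mul_left _ _ _
    rw [this]
    have h2 : φ [v] * ψ (w :: r) + φ [v] * ψ (w :: r) = 0 := CharTwo.add_self_eq_zero _
    linear_combination (-1 : ZMod 2) * h2
  | succ p ih =>
    obtain ⟨v, r, rfl⟩ : ∃ v r, l = v :: r := by
      match l, hl with
      | v :: r, _ => exact ⟨v, r, rfl⟩
    have hr : p + 2 ≤ r.length := by simp at hl; omega
    rw [cobd_cons, cup_succ_cons, cup_succ_cons]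
    simp only [cup_succ_cons]
    rw [show (fun l' => cup p (fun l'' => φ (v :: l'')) ψ l') = cup p (fun l'' => φ (v :: l'')) ψ
      from rfl, ih _ _ hr]
    have : cup (p + 1) (fun l' => cobd φ (v :: l')) ψ r
        = cup (p + 1) φ ψ r + cup (p + 1) (cobd fun l'' => φ (v :: l'')) ψ r := by
      simp only [cup, cobd_cons]; ring
    rw [this]; ring

end Cup

/-! ### Evaluating cup products on a system of chains with commuting involutions -/

section System

/-- Lower the `j`-th entry of a multi-index by one. -/
def lower {k : ℕ} (I : Fin k → ℕ) (j : Fin k) : Fin k → ℕ := Function.update I j (I j - 1)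

lemma lower_le {k : ℕ} (I : Fin k → ℕ) (j : Fin k) : lower I j ≤ I := by
  intro a
  by_cases h : a = j
  · subst h; simp [lower]
  · simp [lower, h]

lemma sum_lower {k : ℕ} (I : Fin k → ℕ) (j : Fin k) (hj : 0 < I j) :
    ∑ a, lower I j a + 1 = ∑ a, I a := by
  rw [lower, Finset.sum_update_of_mem (Finset.mem_univ j),
    ← Finset.add_sum_erase _ I (Finset.mem_univ j), Finset.sdiff_singleton_eq_erase]
  omega

/-- A complex of lists with vertex maps `g j`, together with chains `C I` of dimension `|I|` such
that the boundary of `C I` is the sum of the chains `C (I - e_j)` and their images under `g j`. -/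
structure System (α : Type*) (k : ℕ) where
  /-- the vertex maps -/
  g : Fin k → α → α
  /-- the simplices of the complex -/
  K : Set (List α)
  /-- the chains -/
  C : (Fin k → ℕ) → Chain α
  /-- the largest multi-index for which a chain is given -/
  top : Fin k → ℕ
  sublist_mem : ∀ l ∈ K, ∀ l' : List α, l'.Sublist l → l' ∈ K
  map_mem : ∀ j, ∀ l ∈ K, l.map (g j) ∈ K
  supp : ∀ I ≤ top, ∀ l ∈ (C I).support, l ∈ K ∧ l.length = ∑ a, I a + 1
  bd_C : ∀ I ≤ top, I ≠ 0 → bd (C I) =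
    ∑ j, if 0 < I j then C (lower I j) + chainMap (g j) (C (lower I j)) else 0
  C_zero : ∃ v, C 0 = single [v] 1

variable {α : Type*} {k : ℕ} (S : System α k)

/-- Cocycles of degree `p` on the complex. -/
def System.Cocycle (p : ℕ) (φ : List α → ZMod 2) : Prop :=
  ∀ l ∈ S.K, l.length = p + 2 → cobd φ l = 0

/-- Cochains of degree `p` invariant under the vertex map `g j`. -/
def System.InvAt (j : Fin k) (p : ℕ) (φ : List α → ZMod 2) : Prop :=
  ∀ l ∈ S.K, l.length = p + 1 → φ (l.map (S.g j)) = φ l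

variable {S}

lemma System.take_mem {l : List α} (h : l ∈ S.K) (n : ℕ) : l.take n ∈ S.K :=
  S.sublist_mem l h _ (List.take_sublist _ _)

lemma System.drop_mem {l : List α} (h : l ∈ S.K) (n : ℕ) : l.drop n ∈ S.K :=
  S.sublist_mem l h _ (List.drop_sublist _ _)

lemma System.Cocycle.cup {p r : ℕ} {φ ψ : List α → ZMod 2} (hφ : S.Cocycle p φ)
    (hψ : S.Cocycle r ψ) : S.Cocycle (p + r) (cup p φ ψ) := by
  intro l hl hlen
  rw [cobd_cup _ _ _ _ (by omega)]
  simp only [HeavyFlat.cup]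
  rw [hφ _ (S.take_mem hl _) (by simp; omega), hψ _ (S.drop_mem hl _) (by simp; omega)]
  simp

lemma System.InvAt.cup {j : Fin k} {p r : ℕ} {φ ψ : List α → ZMod 2} (hφ : S.InvAt j p φ)
    (hψ : S.InvAt j r ψ) : S.InvAt j (p + r) (cup p φ ψ) := by
  intro l hl hlen
  simp only [HeavyFlat.cup, ← List.map_take, ← List.map_drop]
  rw [hφ _ (S.take_mem hl _) (by simp; omega), hψ _ (S.drop_mem hl _) (by simp; omega)]

lemma System.ev_cup_congr {p r : ℕ} {φ φ' ψ : List α → ZMod 2}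
    (h : ∀ l ∈ S.K, l.length = p + 1 → φ l = φ' l) {I : Fin k → ℕ} (hI : I ≤ S.top)
    (hsum : ∑ a, I a = p + r) :
    ev (HeavyFlat.cup p φ ψ) (S.C I) = ev (HeavyFlat.cup p φ' ψ) (S.C I) := by
  refine ev_congr fun l hl => ?_
  obtain ⟨hK, hlen⟩ := S.supp I hI l hl
  simp only [HeavyFlat.cup]
  rw [h _ (S.take_mem hK _) (by simp; omega)]

/-- Integration by parts for the system of chains. -/
lemma System.ev_cup_cobd {p r : ℕ} {h ψ : List α → ZMod 2} (hψ : S.Cocycle r ψ)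
    (hinv : ∀ j, S.InvAt j r ψ) {I : Fin k → ℕ} (hI : I ≤ S.top)
    (hsum : ∑ a, I a = p + 1 + r) :
    ev (HeavyFlat.cup (p + 1) (cobd h) ψ) (S.C I) =
      ∑ j, if 0 < I j then
        ev (HeavyFlat.cup p (fun l => h l + h (l.map (S.g j))) ψ) (S.C (lower I j)) else 0 := by
  have h1 : ev (HeavyFlat.cup (p + 1) (cobd h) ψ) (S.C I)
      = ev (cobd (HeavyFlat.cup p h ψ)) (S.C I) := by
    refine ev_congr fun l hl => ?_
    obtain ⟨hK, hlen⟩ := S.supp I hI l hl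
    rw [cobd_cup _ _ _ _ (by omega)]
    have : HeavyFlat.cup p h (cobd ψ) l = 0 := by
      simp only [HeavyFlat.cup]
      rw [hψ _ (S.drop_mem hK _) (by simp; omega), mul_zero]
    rw [this, add_zero]
  have hne : I ≠ 0 := by
    rintro rfl
    simp at hsum
    omega
  rw [h1, ← ev_bd, S.bd_C I hI hne, map_sum]
  refine Finset.sum_congr rfl fun j _ => ?_
  split_ifs with hj
  · rw [map_add, ev_chainMap, ← ev_add]
    refine ev_congr fun l hl => ?_
    obtain ⟨hK, hlen⟩ := S.supp _ ((lower_le I j).trans hI) l hl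
    have := sum_lower I j hj
    simp only [HeavyFlat.cup, ← List.map_take, ← List.map_drop]
    rw [hinv j _ (S.drop_mem hK _) (by simp; omega)]
    ring
  · simp

/-- Adding the coboundary of an invariant cochain does not change the value. -/
lemma System.ev_cup_cobd_inv {p r : ℕ} {h ψ : List α → ZMod 2} (hψ : S.Cocycle r ψ)
    (hinv : ∀ j, S.InvAt j r ψ) (hh : ∀ j, S.InvAt j p h) {I : Fin k → ℕ} (hI : I ≤ S.top)
    (hsum : ∑ a, I a = p + 1 + r) :
    ev (HeavyFlat.cup (p + 1) (cobd h) ψ) (S.C I) = 0 := by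
  rw [S.ev_cup_cobd hψ hinv hI hsum]
  refine Finset.sum_eq_zero fun j _ => ?_
  split_ifs with hj
  · have := sum_lower I j hj
    rw [S.ev_cup_congr (φ' := fun _ => 0) (r := r) _ ((lower_le I j).trans hI) (by omega)]
    · exact ev_eq_zero fun l _ => by simp [HeavyFlat.cup]
    · intro l hl hlen
      rw [hh j l hl hlen, CharTwo.add_self_eq_zero]
  · rfl

/-- If `h` is invariant under all vertex maps but one, under which it changes by `φ`, then cupping
with the coboundary of `h` amounts to cupping with `φ` one step lower. -/
lemma System.ev_cup_cobd_anti {p r : ℕ} {h φ ψ : List α → ZMod 2} (hψ : S.Cocycle r ψ)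
    (hinv : ∀ j, S.InvAt j r ψ) (j : Fin k) (hh : ∀ j', j' ≠ j → S.InvAt j' p h)
    (hj : ∀ l ∈ S.K, l.length = p + 1 → h l + h (l.map (S.g j)) = φ l)
    {I : Fin k → ℕ} (hI : I ≤ S.top) (hIj : 0 < I j)
    (hsum : ∑ a, I a = p + 1 + r) :
    ev (HeavyFlat.cup (p + 1) (cobd h) ψ) (S.C I)
      = ev (HeavyFlat.cup p φ ψ) (S.C (lower I j)) := by
  rw [S.ev_cup_cobd hψ hinv hI hsum, Finset.sum_eq_single j]
  · have := sum_lower I j hIj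
    rw [if_pos hIj]
    exact S.ev_cup_congr (r := r) hj ((lower_le I j).trans hI) (by omega)
  · intro j' _ hne
    split_ifs with hj'
    · have := sum_lower I j' hj'
      rw [S.ev_cup_congr (φ' := fun _ => 0) (r := r) _ ((lower_le I j').trans hI) (by omega)]
      · exact ev_eq_zero fun l _ => by simp [HeavyFlat.cup]
      · intro l hl hlen
        rw [hh j' hne l hl hlen, CharTwo.add_self_eq_zero]
    · rfl
  · simp

/-- Cup product of a list of cochains with degrees. -/
def cupList : List (ℕ × (List α → ZMod 2)) → List α → ZMod 2
  | [] => fun _ => 1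
  | (p, φ) :: L => cup p φ (cupList L)

/-- Total degree of a list of cochains. -/
def degList (L : List (ℕ × (List α → ZMod 2))) : ℕ := (L.map Prod.fst).sum

lemma cobd_one_of_two {l : List α} (h : l.length = 2) : cobd (fun _ => (1 : ZMod 2)) l = 0 := by
  rw [cobd_eq_sum, Finset.sum_const, Finset.card_univ, Fintype.card_fin, h]
  decide

lemma System.cupList_cocycle (L : List (ℕ × (List α → ZMod 2)))
    (h : ∀ φ ∈ L, S.Cocycle φ.1 φ.2) : S.Cocycle (degList L) (cupList L) := by
  induction L with
  | nil => intro l _ hlen; exact cobd_one_of_two (by simpa [degList] using hlen)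
  | cons a L ih =>
    have := (h a (by simp)).cup (ih fun φ hφ => h φ (by simp [hφ]))
    simpa [degList, cupList] using this

lemma System.cupList_inv (L : List (ℕ × (List α → ZMod 2))) (j : Fin k)
    (h : ∀ φ ∈ L, S.InvAt j φ.1 φ.2) : S.InvAt j (degList L) (cupList L) := by
  induction L with
  | nil => intro l _ _; simp [cupList]
  | cons a L ih =>
    have := (h a (by simp)).cup (ih fun φ hφ => h φ (by simp [hφ]))
    simpa [degList, cupList] using this

/-- A cup product vanishes on a list if one factor vanishes on all its sublists. -/
lemma cupList_eq_zero {L : List (ℕ × (List α → ZMod 2))} {p : ℕ} {φ : List α → ZMod 2}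
    (hmem : (p, φ) ∈ L) {l : List α} (hlen : l.length = degList L + 1)
    (h : ∀ l', l'.Sublist l → l'.length = p + 1 → φ l' = 0) : cupList L l = 0 := by
  induction L generalizing l with
  | nil => simp at hmem
  | cons a L ih =>
    obtain ⟨q, ψ⟩ := a
    have hd : degList ((q, ψ) :: L) = q + degList L := by simp [degList]
    rcases List.mem_cons.1 hmem with h' | h'
    · obtain ⟨rfl, rfl⟩ := Prod.mk.inj h'
      simp only [cupList, cup]
      rw [h _ (List.take_sublist _ _) (by simp; omega), zero_mul]
    · simp only [cupList, cup]
      rw [ih h' (by simp; omega) fun l' hl' => h l' (hl'.trans (List.drop_sublist _ _)), mul_zero]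

lemma System.ev_cupList_eq_zero {L : List (ℕ × (List α → ZMod 2))} {I : Fin k → ℕ}
    (hI : I ≤ S.top) (hsum : ∑ a, I a = degList L)
    (h : ∀ l ∈ S.K, l ≠ [] → ∃ φ ∈ L, ∀ l', l'.Sublist l → l'.length = φ.1 + 1 → φ.2 l' = 0) :
    ev (cupList L) (S.C I) = 0 := by
  refine ev_eq_zero fun l hl => ?_
  obtain ⟨hK, hlen⟩ := S.supp I hI l hl
  obtain ⟨φ, hφ, h'⟩ := h l hK (by rintro rfl; simp at hlen)
  exact cupList_eq_zero (p := φ.1) (φ := φ.2) hφ (by omega) h'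

end System

/-! ### Euler cochains -/

section Euler

variable {α : Type*} {k : ℕ} (S : System α k)

/-- A cochain `e` of degree `k` which is, up to the coboundary of an invariant cochain, the top of a
tower of cochains `t q` of degree `q`, each of which is the coboundary of a cochain `h q` whose
variation under the `q`-th vertex map is the next lower cochain of the tower. -/
structure System.Euler (e : List α → ZMod 2) where
  /-- the tower -/
  t : ℕ → List α → ZMod 2
  /-- primitives of the cochains of the tower -/
  h : ℕ → List α → ZMod 2
  /-- the invariant correction -/
  b : List α → ZMod 2
  cocycle : S.Cocycle k e
  inv : ∀ j, S.InvAt j k e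
  b_inv : ∀ j, S.InvAt j (k - 1) b
  eq : ∀ l ∈ S.K, l.length = k + 1 → e l = t k l + cobd b l
  t_zero : ∀ l ∈ S.K, l.length = 1 → t 0 l = 1
  t_succ : ∀ q < k, ∀ l ∈ S.K, l.length = q + 2 → t (q + 1) l = cobd (h q) l
  h_inv : ∀ q < k, ∀ j : Fin k, (j : ℕ) ≠ q → S.InvAt j q (h q)
  h_anti : ∀ j : Fin k, ∀ l ∈ S.K, l.length = (j : ℕ) + 1 →
    h j l + h j (l.map (S.g j)) = t j l

/-- A cochain of degree zero which changes sign exactly under the vertex maps `a` and `b`. -/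
structure System.SignPair (a b : Fin k) (s : List α → ZMod 2) : Prop where
  inv : ∀ j, j ≠ a → j ≠ b → S.InvAt j 0 s
  anti_left : ∀ l ∈ S.K, l.length = 1 → s l + s (l.map (S.g a)) = 1
  anti_right : ∀ l ∈ S.K, l.length = 1 → s l + s (l.map (S.g b)) = 1

/-- Lower all entries with index less than `q` by one. -/
def lowerBelow (I : Fin k → ℕ) (q : ℕ) : Fin k → ℕ := fun j => if (j : ℕ) < q then I j - 1 else I j

variable {S}

lemma lowerBelow_lower (I : Fin k → ℕ) (q : Fin k) :
    lowerBelow (lower I q) q = lowerBelow I (q + 1) := by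
  funext j
  by_cases h : j = q
  · subst h; simp [lowerBelow, lower]
  · have : (j : ℕ) ≠ q := fun h' => h (Fin.ext h')
    simp only [lowerBelow, lower, Function.update_of_ne h]
    congr 1
    simp only [eq_iff_iff]; omega

lemma cup_zero_one {φ ψ : List α → ZMod 2} {l : List α} (h : φ (l.take 1) = 1) :
    cup 0 φ ψ l = ψ l := by
  simp [cup, h]

lemma System.Euler.ev_tower {e : List α → ZMod 2} (E : S.Euler e) {r : ℕ} {ψ : List α → ZMod 2}
    (hψ : S.Cocycle r ψ) (hinv : ∀ j, S.InvAt j r ψ) (q : ℕ) (hq : q ≤ k) {I : Fin k → ℕ}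
    (hI : I ≤ S.top) (hpos : ∀ j : Fin k, (j : ℕ) < q → 0 < I j) (hsum : ∑ a, I a = q + r) :
    ev (cup q (E.t q) ψ) (S.C I) = ev ψ (S.C (lowerBelow I q)) := by
  induction q generalizing I with
  | zero =>
    have : lowerBelow I 0 = I := by funext j; simp [lowerBelow]
    rw [this]
    refine ev_congr fun l hl => ?_
    obtain ⟨hK, hlen⟩ := S.supp I hI l hl
    exact cup_zero_one (E.t_zero _ (S.take_mem hK _) (by simp; omega))
  | succ q ih =>
    have hq' : q < k := hq
    rw [S.ev_cup_congr (E.t_succ q hq') hI hsum,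
      S.ev_cup_cobd_anti (φ := E.t q) hψ hinv ⟨q, hq'⟩ _ _ hI (hpos ⟨q, hq'⟩ (by simp)) hsum,
      ih (by omega), lowerBelow_lower I ⟨q, hq'⟩]
    · exact (lower_le _ _).trans hI
    · intro j hj
      have : j ≠ ⟨q, hq'⟩ := by rintro rfl; simp at hj
      simpa [lower, this] using hpos j (by omega)
    · have := sum_lower I ⟨q, hq'⟩ (hpos ⟨q, hq'⟩ (by simp)); omega
    · intro j hj
      exact E.h_inv q hq' j fun h => hj (Fin.ext h)
    · intro l hl hlen
      exact E.h_anti ⟨q, hq'⟩ l hl hlen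

lemma System.Euler.ev_cup {e : List α → ZMod 2} (E : S.Euler e) (hk : 1 ≤ k) {r : ℕ}
    {ψ : List α → ZMod 2}
    (hψ : S.Cocycle r ψ) (hinv : ∀ j, S.InvAt j r ψ) {I : Fin k → ℕ}
    (hI : I ≤ S.top) (hpos : ∀ j, 0 < I j) (hsum : ∑ a, I a = k + r) :
    ev (cup k e ψ) (S.C I) = ev ψ (S.C fun j => I j - 1) := by
  rw [S.ev_cup_congr E.eq hI hsum]
  have h1 : ev (HeavyFlat.cup k (fun l => E.t k l + cobd E.b l) ψ) (S.C I)
      = ev (HeavyFlat.cup k (E.t k) ψ) (S.C I) + ev (HeavyFlat.cup k (cobd E.b) ψ) (S.C I) := by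
    rw [← ev_add]; congr 2; funext l; simp only [HeavyFlat.cup]; ring
  have h2 : ev (HeavyFlat.cup k (cobd E.b) ψ) (S.C I) = 0 := by
    obtain ⟨k', hk'⟩ : ∃ k', k = k' + 1 := ⟨k - 1, by omega⟩
    have hb := E.b_inv
    rw [show k - 1 = k' by omega] at hb
    have := S.ev_cup_cobd_inv (p := k') hψ hinv hb hI (by omega)
    rwa [← hk'] at this
  rw [h1, h2, add_zero, E.ev_tower hψ hinv k le_rfl hI (fun j _ => hpos j) hsum]
  congr 2
  funext j
  simp [lowerBelow]

lemma System.SignPair.ev_cup {a b : Fin k} (hab : a ≠ b) {s : List α → ZMod 2}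
    (hs : S.SignPair a b s) {r : ℕ} {ψ : List α → ZMod 2}
    (hψ : S.Cocycle r ψ) (hinv : ∀ j, S.InvAt j r ψ) {I : Fin k → ℕ}
    (hI : I ≤ S.top) (ha : I a = 0) (hb : 0 < I b) (hsum : ∑ a, I a = 1 + r) :
    ev (cup 1 (cobd s) ψ) (S.C I) = ev ψ (S.C (lower I b)) := by
  have := S.ev_cup_cobd (p := 0) (h := s) hψ hinv hI (by omega)
  rw [this, Finset.sum_eq_single b]
  · rw [if_pos hb]
    refine ev_congr fun l hl => ?_
    obtain ⟨hK, hlen⟩ := S.supp _ ((lower_le I b).trans hI) l hl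
    exact cup_zero_one (hs.anti_right _ (S.take_mem hK _) (by simp; omega))
  · intro j _ hj
    split_ifs with hpos
    · have hja : j ≠ a := by rintro rfl; omega
      refine ev_eq_zero fun l hl => ?_
      obtain ⟨hK, hlen⟩ := S.supp _ ((lower_le I j).trans hI) l hl
      simp only [HeavyFlat.cup]
      rw [hs.inv j hja hj _ (S.take_mem hK _) (by simp; omega), CharTwo.add_self_eq_zero, zero_mul]
    · rfl
  · simp

lemma System.SignPair.cobd_cocycle (s : List α → ZMod 2) :
    S.Cocycle 1 (cobd s) := fun l _ _ => cobd_cobd s l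

lemma System.SignPair.cobd_inv {a b : Fin k} {s : List α → ZMod 2}
    (hs : S.SignPair a b s) (j : Fin k) : S.InvAt j 1 (cobd s) := by
  intro l hl hlen
  have key : ∃ c : ZMod 2, ∀ l' ∈ S.K, l'.length = 1 → s (l'.map (S.g j)) = s l' + c := by
    have aux : ∀ x y : ZMod 2, x + y = 1 → y = x + 1 := by decide
    by_cases ha : j = a
    · subst ha; exact ⟨1, fun l' h1 h2 => aux _ _ (hs.anti_left l' h1 h2)⟩
    by_cases hb : j = b
    · subst hb; exact ⟨1, fun l' h1 h2 => aux _ _ (hs.anti_right l' h1 h2)⟩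
    exact ⟨0, fun l' h1 h2 => by rw [hs.inv j ha hb l' h1 h2, add_zero]⟩
  obtain ⟨c, hc⟩ := key
  rw [cobd_map, cobd_congr (ψ := fun l' => s l' + c)
    fun l' h1 h2 => hc l' (S.sublist_mem l hl l' h1) (by omega), cobd_add]
  have : cobd (fun _ => c) l = 0 := by
    rw [cobd_eq_sum, Finset.sum_const, Finset.card_univ, Fintype.card_fin, hlen]
    exact (by decide : ∀ c : ZMod 2, (1 + 1) • c = 0) c
  rw [this, add_zero]

/-- A list of pairs which lowers a multi-index to zero, each pair lowering its second entry while
the first one has value zero. -/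
def Lowers : List (Fin k × Fin k) → (Fin k → ℕ) → Prop
  | [], I => I = 0
  | (a, b) :: L, I => a ≠ b ∧ I a = 0 ∧ 0 < I b ∧ Lowers L (lower I b)

lemma Lowers.sum_eq {L : List (Fin k × Fin k)} {I : Fin k → ℕ} (h : Lowers L I) :
    ∑ a, I a = L.length := by
  induction L generalizing I with
  | nil => simp [show I = 0 from h]
  | cons p L ih =>
    obtain ⟨_, _, hb, hL⟩ := h
    have := sum_lower I p.2 hb
    rw [ih hL] at this
    simp [← this]

lemma exists_lowers (k : ℕ) : ∃ L : List (Fin k × Fin k), Lowers L (fun j : Fin k => (j : ℕ)) ∧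
    ∀ a b : Fin k, a < b → (a, b) ∈ L := by
  suffices H : ∀ c ≤ k, ∃ L : List (Fin k × Fin k),
      Lowers L (fun j => if (j : ℕ) < k - c then 0 else (j : ℕ)) ∧
      ∀ a b : Fin k, k - c ≤ (b : ℕ) → a < b → (a, b) ∈ L by
    obtain ⟨L, h1, h2⟩ := H k le_rfl
    exact ⟨L, by simpa using h1, fun a b hab => h2 a b (by simp) hab⟩
  intro c hc
  induction c with
  | zero =>
    refine ⟨[], ?_, fun a b h => by omega⟩
    show _ = _
    funext j; simp
  | succ c ih =>
    obtain ⟨L, h1, h2⟩ := ih (by omega)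
    obtain ⟨b, hb⟩ : ∃ b : Fin k, (b : ℕ) = k - (c + 1) := ⟨⟨k - (c + 1), by omega⟩, rfl⟩
    have step : ∀ r ≤ (b : ℕ), ∃ L' : List (Fin k × Fin k),
        Lowers L' (fun j => if (j : ℕ) < b then 0 else if j = b then r else (j : ℕ)) ∧
        (∀ p ∈ L, p ∈ L') ∧ ∀ a : Fin k, (a : ℕ) < r → (a, b) ∈ L' := by
      intro r hr
      induction r with
      | zero =>
        refine ⟨L, ?_, fun p hp => hp, fun a ha => by omega⟩
        convert h1 using 2 with j
        have : j = b ↔ (j : ℕ) = b := Fin.ext_iff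
        split_ifs <;> omega
      | succ r ihr =>
        obtain ⟨L', h3, h4, h5⟩ := ihr (by omega)
        refine ⟨(⟨r, by omega⟩, b) :: L', ⟨?_, ?_, ?_, ?_⟩, ?_, ?_⟩
        · intro h; rw [Fin.ext_iff] at h; simp at h; omega
        · simp; omega
        · simp
        · convert h3 using 1
          funext j
          by_cases hj : j = b
          · subst hj; simp [lower]
          · simp [lower, hj]
        · intro p hp; exact List.mem_cons_of_mem _ (h4 p hp)
        · intro a ha
          by_cases har : (a : ℕ) = r
          · have : a = ⟨r, by omega⟩ := Fin.ext har
            simp [this]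
          · exact List.mem_cons_of_mem _ (h5 a (by omega))
    obtain ⟨L', h3, h4, h5⟩ := step b le_rfl
    refine ⟨L', ?_, ?_⟩
    · convert h3 using 2 with j
      rw [← hb]
      split_ifs with _ h'
      · rfl
      · rw [h']
      · rfl
    · intro a b' hb' hab
      by_cases hbb : b' = b
      · subst hbb; exact h5 a hab
      · refine h4 _ (h2 a b' ?_ hab)
        have : (b' : ℕ) ≠ b := fun h => hbb (Fin.ext h)
        omega

/-- There is no system of chains all of whose simplices are avoided by one of the given Euler
cochains or sign pairs. -/
theorem System.no_avoiding (hk : 1 ≤ k) {N : ℕ} (e : Fin N → List α → ZMod 2)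
    (hE : ∀ i, Nonempty (S.Euler (e i))) (s : Fin k → Fin k → List α → ZMod 2)
    (hs : ∀ a b, a ≠ b → S.SignPair a b (s a b)) (htop : S.top = fun j : Fin k => N + (j : ℕ))
    (havoid : ∀ l ∈ S.K, l ≠ [] →
      (∃ i, ∀ l', l'.Sublist l → l'.length = k + 1 → e i l' = 0) ∨
      ∃ a b, a < b ∧ ∀ l', l'.Sublist l → l'.length = 2 → cobd (s a b) l' = 0) : False := by
  obtain ⟨L, hL, hLmem⟩ := exists_lowers k
  let W : List (Fin k × Fin k) → List (ℕ × (List α → ZMod 2)) :=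
    fun L => L.map fun p => (1, cobd (s p.1 p.2))
  have hne : ∀ {L : List (Fin k × Fin k)} {I : Fin k → ℕ}, Lowers L I → ∀ p ∈ L, p.1 ≠ p.2 := by
    intro L
    induction L with
    | nil => simp
    | cons q L ih =>
      intro I h p hp
      rcases List.mem_cons.1 hp with rfl | hp
      · exact h.1
      · exact ih h.2.2.2 p hp
  have hWc : ∀ L, ∀ φ ∈ W L, S.Cocycle φ.1 φ.2 := by
    intro L φ hφ
    obtain ⟨p, _, rfl⟩ := List.mem_map.1 hφ
    exact System.SignPair.cobd_cocycle _
  have hWi : ∀ {L I}, Lowers L I → ∀ j, ∀ φ ∈ W L, S.InvAt j φ.1 φ.2 := by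
    intro L I h j φ hφ
    obtain ⟨p, hp, rfl⟩ := List.mem_map.1 hφ
    exact (hs p.1 p.2 (hne h p hp)).cobd_inv j
  have hWd : ∀ L, degList (W L) = L.length := by
    intro L; simp [degList, W, Function.comp_def]
  have evW : ∀ {L I}, Lowers L I → I ≤ S.top → ev (cupList (W L)) (S.C I) = 1 := by
    intro L
    induction L with
    | nil =>
      intro I h _
      obtain ⟨v, hv⟩ := S.C_zero
      rw [show I = 0 from h, hv]
      simp [W, cupList]
    | cons p L ih =>
      intro I h hI
      obtain ⟨hab, ha, hb, hL⟩ := h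
      have := (hs p.1 p.2 hab).ev_cup hab (S.cupList_cocycle (W L) (hWc L))
        (fun j => S.cupList_inv (W L) j (hWi hL j)) hI ha hb (by
          have h1 := hL.sum_eq
          have h2 := sum_lower I p.2 hb
          rw [hWd]; omega)
      rw [show cupList (W (p :: L)) = cup 1 (cobd (s p.1 p.2)) (cupList (W L)) from rfl, this]
      exact ih hL ((lower_le _ _).trans hI)
  let X : List (Fin N) → List (ℕ × (List α → ZMod 2)) :=
    fun M => M.map (fun i => (k, e i)) ++ W L
  have hXc : ∀ M, ∀ φ ∈ X M, S.Cocycle φ.1 φ.2 := by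
    intro M φ hφ
    rcases List.mem_append.1 hφ with h | h
    · obtain ⟨i, _, rfl⟩ := List.mem_map.1 h
      exact (hE i).some.cocycle
    · exact hWc L φ h
  have hXi : ∀ M j, ∀ φ ∈ X M, S.InvAt j φ.1 φ.2 := by
    intro M j φ hφ
    rcases List.mem_append.1 hφ with h | h
    · obtain ⟨i, _, rfl⟩ := List.mem_map.1 h
      exact (hE i).some.inv j
    · exact hWi hL j φ h
  have hXd : ∀ M, degList (X M) = M.length * k + L.length := by
    intro M
    have := hWd L
    simp only [degList] at this
    simp [degList, X, Function.comp_def, this]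
  have sumI : ∀ M : ℕ, ∑ j : Fin k, (M + (j : ℕ)) = M * k + L.length := by
    intro M
    rw [Finset.sum_add_distrib, hL.sum_eq]; simp [mul_comm]
  have evX : ∀ M : List (Fin N), M.length ≤ N →
      ev (cupList (X M)) (S.C fun j : Fin k => M.length + (j : ℕ)) = 1 := by
    intro M
    induction M with
    | nil =>
      intro _
      have : (fun j : Fin k => ([] : List (Fin N)).length + (j : ℕ)) = fun j : Fin k => (j : ℕ) := by
        simp
      rw [this]
      exact evW hL (by rw [htop]; intro j; simp)
    | cons i M ih =>
      intro hM
      have hM' : M.length + 1 ≤ N := by simpa using hM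
      have h1 : (fun j : Fin k => (i :: M).length + (j : ℕ)) ≤ S.top := by
        rw [htop]; intro j; simp only [List.length_cons]; omega
      have := (hE i).some.ev_cup hk (S.cupList_cocycle (X M) (hXc M))
        (fun j => S.cupList_inv (X M) j (hXi M j)) h1 (fun j => by simp only [List.length_cons]; omega) (by
          rw [hXd, sumI, List.length_cons]; ring)
      rw [show cupList (X (i :: M)) = cup k (e i) (cupList (X M)) from rfl, this]
      have h2 : (fun j : Fin k => (i :: M).length + (j : ℕ) - 1) = fun j : Fin k => M.length + (j : ℕ) := by
        funext j; simp only [List.length_cons]; omega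
      rw [h2]
      exact ih (by omega)
  have h1 := evX (List.finRange N) (by simp)
  have h0 : ev (cupList (X (List.finRange N)))
      (S.C fun j : Fin k => (List.finRange N).length + (j : ℕ)) = 0 := by
    refine S.ev_cupList_eq_zero (by rw [htop]; intro j; simp) (by rw [sumI, hXd]) ?_
    intro l hl hlne
    rcases havoid l hl hlne with ⟨i, hi⟩ | ⟨a, b, hab, h⟩
    · exact ⟨(k, e i), List.mem_append_left _ (List.mem_map.2 ⟨i, List.mem_finRange i, rfl⟩), hi⟩
    · exact ⟨(1, cobd (s a b)), List.mem_append_right _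
        (List.mem_map.2 ⟨(a, b), hLmem a b hab, rfl⟩), h⟩
  rw [h1] at h0
  exact one_ne_zero h0

end Euler

/-! ### Coned chains for commuting involutions -/

section Coned

variable {α : Type*}

lemma linear_support_ext {M : Type*} [AddCommMonoid M] [Module (ZMod 2) M]
    {f h : Chain α →ₗ[ZMod 2] M} {c : Chain α}
    (H : ∀ l ∈ c.support, f (single l 1) = h (single l 1)) : f c = h c := by
  conv_lhs => rw [← Finsupp.sum_single c]
  conv_rhs => rw [← Finsupp.sum_single c]
  rw [map_finsuppSum, map_finsuppSum]
  refine Finsupp.sum_congr fun l hl => ?_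
  have : single l (c l) = c l • single l (1 : ZMod 2) := by simp
  rw [this, map_smul, map_smul, H l hl]

lemma support_linear {f : Chain α →ₗ[ZMod 2] Chain α} {c : Chain α} {l : List α}
    (h : l ∈ (f c).support) : ∃ l' ∈ c.support, l ∈ (f (single l' 1)).support := by
  classical
  have h1 : f c = ∑ l' ∈ c.support, c l' • f (single l' 1) := by
    conv_lhs => rw [← Finsupp.sum_single c]
    rw [map_finsuppSum]
    refine Finset.sum_congr rfl fun l' _ => ?_
    rw [← map_smul]; simp
  rw [h1] at h
  obtain ⟨l', hl', h2⟩ := support_sum h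
  exact ⟨l', hl', Finsupp.support_smul h2⟩

variable {k : ℕ} (g : Fin k → α → α) (v : (Fin k → ℕ) → α)

/-- The sum of the chains `c (I - e_j)` and their images under `g j`. -/
noncomputable def sphereChain (c : (Fin k → ℕ) → Chain α) (I : Fin k → ℕ) : Chain α :=
  ∑ j, if 0 < I j then c (lower I j) + chainMap (g j) (c (lower I j)) else 0

/-- Iterated cones, with fuel. -/
noncomputable def conedAux : ℕ → (Fin k → ℕ) → Chain α
  | 0, I => single [v I] 1
  | n + 1, I => cone (v I) (sphereChain g (conedAux n) I)

/-- The chain attached to a multi-index, built by iterated coning. -/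
noncomputable def coned (I : Fin k → ℕ) : Chain α := conedAux g v (∑ a, I a) I

lemma coned_zero : coned g v 0 = single [v 0] 1 := by simp [coned, conedAux]

lemma coned_eq {I : Fin k → ℕ} (hI : I ≠ 0) :
    coned g v I = cone (v I) (sphereChain g (coned g v) I) := by
  obtain ⟨n, hn⟩ : ∃ n, ∑ a, I a = n + 1 := by
    refine Nat.exists_eq_succ_of_ne_zero fun h => hI ?_
    funext a
    exact (Finset.sum_eq_zero_iff.1 h) a (Finset.mem_univ a)
  rw [coned, hn, conedAux]
  congr 1
  refine Finset.sum_congr rfl fun j _ => ?_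
  split_ifs with hj
  · have := sum_lower I j hj
    rw [coned, show ∑ a, lower I j a = n by omega]
  · rfl

lemma sum_symmetric_eq_zero {ι : Type*} [Fintype ι] [DecidableEq ι] (f : ι → ι → Chain α)
    (hs : ∀ a b, f a b = f b a) (hd : ∀ a, f a a = 0) : ∑ a, ∑ b, f a b = 0 := by
  rw [← Fintype.sum_prod_type']
  refine Finset.sum_involution (fun p _ => p.swap) ?_ ?_ ?_ ?_
  · rintro ⟨a, b⟩ _
    simp only [Prod.swap_prod_mk]
    rw [hs b a, add_self_chain]
  · rintro ⟨a, b⟩ _ h h'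
    simp only [Prod.swap_prod_mk, Prod.mk.injEq] at h'
    rw [h'.1] at h
    exact h (hd a)
  · simp
  · simp

lemma chainMap_id (c : Chain α) : chainMap id c = c := by
  have : chainMap (id : α → α) = LinearMap.id := by
    apply chain_hom_ext; intro l; simp
  simp [this]

lemma lower_lower (I : Fin k → ℕ) (a b : Fin k) : lower (lower I a) b = lower (lower I b) a := by
  by_cases h : a = b
  · rw [h]
  · funext j
    by_cases h1 : j = a
    · subst h1; simp [lower, h]
    · by_cases h2 : j = b
      · subst h2; simp [lower, h1]
      · simp [lower, h1, h2]

variable {g v}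

lemma bd_sphereChain (hg : ∀ j, g j ∘ g j = id) (hc : ∀ a b, g a ∘ g b = g b ∘ g a) (n : ℕ)
    (ih : ∀ I : Fin k → ℕ, ∑ a, I a = n → I ≠ 0 →
      bd (coned g v I) = sphereChain g (coned g v) I)
    {I : Fin k → ℕ} (hI : ∑ a, I a = n + 1) : bd (sphereChain g (coned g v) I) = 0 := by
  classical
  rcases Nat.eq_zero_or_pos n with rfl | hn
  · rw [sphereChain, map_sum]
    refine Finset.sum_eq_zero fun j _ => ?_
    split_ifs with hj
    · have h0 : lower I j = 0 := by
        have := sum_lower I j hj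
        funext a
        exact (Finset.sum_eq_zero_iff.1 (show ∑ a, lower I j a = 0 by omega)) a (Finset.mem_univ a)
      rw [h0, coned_zero, map_add, ← chainMap_bd]
      simp [add_self_chain]
    · simp
  · let f : Fin k → Fin k → Chain α := fun j j' =>
      if 0 < I j ∧ 0 < lower I j j' then
        (coned g v (lower (lower I j) j') + chainMap (g j') (coned g v (lower (lower I j) j'))) +
        chainMap (g j) (coned g v (lower (lower I j) j') +
          chainMap (g j') (coned g v (lower (lower I j) j')))
      else 0
    have : bd (sphereChain g (coned g v) I) = ∑ j, ∑ j', f j j' := by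
      rw [sphereChain, map_sum]
      refine Finset.sum_congr rfl fun j _ => ?_
      by_cases hj : 0 < I j
      · have hs := sum_lower I j hj
        have hne : lower I j ≠ 0 := by
          intro h; rw [h] at hs; simp at hs; omega
        rw [if_pos hj, map_add, ← chainMap_bd, ih _ (by omega) hne, sphereChain, map_sum,
          ← Finset.sum_add_distrib]
        refine Finset.sum_congr rfl fun j' _ => ?_
        by_cases hj' : 0 < lower I j j'
        · simp [f, hj, hj']
        · simp [f, hj']
      · simp [f, hj]
    rw [this]
    refine sum_symmetric_eq_zero f ?_ ?_
    · intro a b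
      by_cases hab : a = b
      · rw [hab]
      · have h1 : (0 < I a ∧ 0 < lower I a b) ↔ (0 < I b ∧ 0 < lower I b a) := by
          simp [lower, hab, Ne.symm hab, and_comm]
        simp only [f, h1, lower_lower I a b, map_add, chainMap_chainMap, hc a b]
        split_ifs
        · abel
        · rfl
    · intro a
      simp only [f, map_add, chainMap_chainMap, hg a, chainMap_id]
      split_ifs
      · rw [add_comm (chainMap (g a) _), add_self_chain]
      · rfl

lemma bd_coned (hg : ∀ j, g j ∘ g j = id) (hc : ∀ a b, g a ∘ g b = g b ∘ g a)
    {I : Fin k → ℕ} (hI : I ≠ 0) : bd (coned g v I) = sphereChain g (coned g v) I := by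
  suffices H : ∀ n, ∀ I : Fin k → ℕ, ∑ a, I a = n → I ≠ 0 →
      bd (coned g v I) = sphereChain g (coned g v) I from H _ I rfl hI
  intro n
  induction n with
  | zero =>
    intro I h0 hne
    exact absurd (funext fun a => (Finset.sum_eq_zero_iff.1 h0) a (Finset.mem_univ a)) hne
  | succ n ih =>
    intro I hn hne
    rw [coned_eq g v hne, bd_cone, bd_sphereChain hg hc n ih hn]
    simp

end Coned

/-! ### Barycentric subdivision -/

section Subdivision

variable {E : Type*} [AddCommGroup E] [Module ℝ E]

/-- The barycenter of a list of points. -/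
noncomputable def bary (l : List E) : E := (l.length : ℝ)⁻¹ • l.sum

/-- Barycentric subdivision of lists of given length. -/
noncomputable def sdAux : ℕ → List E → Chain E
  | 0, l => single l 1
  | n + 1, l => cone (bary l) (Finsupp.linearCombination (ZMod 2) (sdAux n) (bdList l))

/-- Barycentric subdivision of chains. -/
noncomputable def sd : Chain E →ₗ[ZMod 2] Chain E :=
  Finsupp.linearCombination (ZMod 2) fun l => sdAux l.length l

lemma sd_single_nil : sd (single ([] : List E) 1) = single [] 1 := by simp [sd, sdAux]

lemma sd_single {l : List E} (hl : l ≠ []) :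
    sd (single l 1) = cone (bary l) (sd (bdList l)) := by
  obtain ⟨n, hn⟩ : ∃ n, l.length = n + 1 :=
    Nat.exists_eq_succ_of_ne_zero (by simpa using hl)
  rw [sd, linearCombination_single, one_smul, hn, sdAux, Finsupp.linearCombination_apply,
    Finsupp.linearCombination_apply]
  congr 1
  refine Finsupp.sum_congr fun l' hl' => ?_
  have := (support_bdList hl').2
  rw [show l'.length = n by omega]

lemma sd_bdList_bd (l : List E) : bd (sd (single l 1)) = sd (bdList l) := by
  induction hn : l.length generalizing l with
  | zero =>
    rw [List.length_eq_zero_iff] at hn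
    subst hn
    simp [sd_single_nil]
  | succ n ih =>
    have hne : l ≠ [] := by rintro rfl; simp at hn
    have h0 : bd (sd (bdList l)) = 0 := by
      have : (bd ∘ₗ sd) (bdList l) = (sd ∘ₗ bd) (bdList l) := by
        refine linear_support_ext fun l' hl' => ?_
        have := (support_bdList hl').2
        simpa using ih l' (by omega)
      simpa [bd_bdList] using this
    rw [sd_single hne, bd_cone, h0]
    simp

lemma bd_sd (c : Chain E) : bd (sd c) = sd (bd c) := by
  have : bd ∘ₗ sd = (sd ∘ₗ bd : Chain E →ₗ[ZMod 2] Chain E) := by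
    apply chain_hom_ext; intro l; simpa using sd_bdList_bd l
  simpa using LinearMap.congr_fun this c

lemma bary_map (f : E →ₗ[ℝ] E) (l : List E) : bary (l.map f) = f (bary l) := by
  simp only [bary, List.length_map, map_smul, map_list_sum]

lemma chainMap_sd (f : E →ₗ[ℝ] E) (c : Chain E) : chainMap f (sd c) = sd (chainMap f c) := by
  have key : ∀ n, ∀ l : List E, l.length = n →
      chainMap f (sd (single l 1)) = sd (chainMap f (single l 1)) := by
    intro n
    induction n with
    | zero =>
      intro l hl
      rw [List.length_eq_zero_iff] at hl
      subst hl
      simp [sd_single_nil]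
    | succ n ih =>
      intro l hl
      have hne : l ≠ [] := by rintro rfl; simp at hl
      rw [sd_single hne, chainMap_cone, chainMap_single, sd_single (by simpa using hne), bary_map,
        bdList_map]
      congr 1
      have : (chainMap f ∘ₗ sd) (bdList l) = (sd ∘ₗ chainMap f) (bdList l) := by
        refine linear_support_ext fun l' hl' => ?_
        have := (support_bdList hl').2
        simpa using ih l' (by omega)
      simpa using this
  have : chainMap f ∘ₗ sd = (sd ∘ₗ chainMap f : Chain E →ₗ[ZMod 2] Chain E) := by
    apply chain_hom_ext; intro l; simpa using key _ l rfl
  simpa using LinearMap.congr_fun this c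

lemma sd_single_singleton (x : E) : sd (single [x] 1) = single [x] 1 := by
  rw [sd_single (by simp)]
  simp [sd_single_nil, bary]

lemma bary_mem {s : Set E} (hs : Convex ℝ s) {l : List E} (hl : l ≠ []) (h : ∀ x ∈ l, x ∈ s) :
    bary l ∈ s := by
  have h1 : bary l = ∑ i : Fin l.length, (l.length : ℝ)⁻¹ • l[i] := by
    rw [bary, ← Finset.smul_sum]
    congr 1
    exact (Fin.sum_univ_getElem l).symm
  have hpos : (0 : ℝ) < l.length := by
    exact_mod_cast List.length_pos_iff.2 hl
  rw [h1]
  refine hs.sum_mem (fun _ _ => by positivity) ?_ fun i _ => h _ (List.getElem_mem _)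
  simp [hpos.ne']

lemma support_sd {s : Set E} (hs : Convex ℝ s) {l l' : List E} (h : ∀ x ∈ l, x ∈ s)
    (hl' : l' ∈ (sd (single l 1)).support) : (∀ x ∈ l', x ∈ s) ∧ l'.length = l.length := by
  induction hn : l.length generalizing l l' with
  | zero =>
    rw [List.length_eq_zero_iff] at hn
    subst hn
    rw [sd_single_nil] at hl'
    have := Finsupp.support_single_subset hl'
    simp only [Finset.mem_singleton] at this
    simp [this]
  | succ n ih =>
    have hne : l ≠ [] := by rintro rfl; simp at hn
    rw [sd_single hne] at hl'
    obtain ⟨l₁, h1, rfl⟩ := support_cone hl'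
    obtain ⟨l₂, h2, h3⟩ := support_linear h1
    obtain ⟨hsub, hlen⟩ := support_bdList h2
    obtain ⟨h4, h5⟩ := ih (fun x hx => h x (hsub.subset hx)) h3 (by omega)
    refine ⟨?_, by simp [h5]⟩
    intro x hx
    rcases List.mem_cons.1 hx with rfl | hx
    · exact bary_mem hs hne h
    · exact h4 x hx

end Subdivision

section Mesh

variable {E : Type*} [NormedAddCommGroup E] [NormedSpace ℝ E]

lemma dist_bary_le {l : List E} {D : ℝ} (hD : ∀ x ∈ l, ∀ y ∈ l, dist x y ≤ D) {M : ℕ}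
    (hM : l.length ≤ M + 1) {x : E} (hx : x ∈ l) : dist (bary l) x ≤ M / (M + 1) * D := by
  classical
  have hpos : 0 < l.length := List.length_pos_of_mem hx
  obtain ⟨i, hi⟩ := List.mem_iff_get.1 hx
  have hn : (0 : ℝ) < l.length := by exact_mod_cast hpos
  have hD0 : 0 ≤ D := dist_nonneg.trans (hD x hx x hx)
  have h1 : bary l - x = ∑ j : Fin l.length, (l.length : ℝ)⁻¹ • (l[j] - x) := by
    have hsum : ∑ j : Fin l.length, l[j] = l.sum := Fin.sum_univ_getElem l
    rw [← Finset.smul_sum, Finset.sum_sub_distrib, hsum, smul_sub, bary]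
    simp only [Finset.sum_const, Finset.card_univ, Fintype.card_fin, ← Nat.cast_smul_eq_nsmul ℝ]
    rw [smul_smul, inv_mul_cancel₀ hn.ne', one_smul]
  rw [dist_eq_norm, h1, ← Finset.add_sum_erase _ _ (Finset.mem_univ i)]
  have h2 : l[i] - x = 0 := by
    rw [← hi]; simp
  rw [h2, smul_zero, zero_add]
  calc ‖∑ j ∈ Finset.univ.erase i, (l.length : ℝ)⁻¹ • (l[j] - x)‖
      ≤ ∑ j ∈ Finset.univ.erase i, (l.length : ℝ)⁻¹ * D := by
        refine norm_sum_le_of_le _ fun j _ => ?_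
        rw [norm_smul, norm_inv, RCLike.norm_natCast, ← dist_eq_norm]
        gcongr
        exact hD _ (List.getElem_mem _) _ hx
    _ = ((l.length : ℝ) - 1) / l.length * D := by
        rw [Finset.sum_const, Finset.card_erase_of_mem (Finset.mem_univ i)]
        simp only [Finset.card_univ, Fintype.card_fin, nsmul_eq_mul]
        rw [Nat.cast_sub hpos]
        push_cast
        field_simp
    _ ≤ M / (M + 1) * D := by
        gcongr ?_ * D
        have hM' : (l.length : ℝ) ≤ M + 1 := by exact_mod_cast hM
        rw [div_le_div_iff₀ hn (by positivity)]
        nlinarith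

lemma mesh_sd {l l' : List E} {D : ℝ} (hD : ∀ x ∈ l, ∀ y ∈ l, dist x y ≤ D) {M : ℕ}
    (hM : l.length ≤ M + 1) (hl' : l' ∈ (sd (single l 1)).support) :
    ∀ x ∈ l', ∀ y ∈ l', dist x y ≤ M / (M + 1) * D := by
  induction hn : l.length generalizing l l' with
  | zero =>
    rw [List.length_eq_zero_iff] at hn
    subst hn
    rw [sd_single_nil] at hl'
    have := Finsupp.support_single_subset hl'
    simp only [Finset.mem_singleton] at this
    simp [this]
  | succ n ih =>
    have hne : l ≠ [] := by rintro rfl; simp at hn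
    rw [sd_single hne] at hl'
    obtain ⟨l₁, h1, rfl⟩ := support_cone hl'
    obtain ⟨l₂, h2, h3⟩ := support_linear h1
    obtain ⟨hsub, hlen⟩ := support_bdList h2
    have h4 := ih (fun x hx y hy => hD x (hsub.subset hx) y (hsub.subset hy)) (by omega) h3
      (by omega)
    have h5 : ∀ x ∈ l₁, dist (bary l) x ≤ M / (M + 1) * D := by
      have hconv : Convex ℝ (Metric.closedBall (bary l) (M / (M + 1) * D)) :=
        convex_closedBall _ _
      intro x hx
      have := (support_sd hconv (l := l₂) (fun y hy => by
        rw [Metric.mem_closedBall, dist_comm]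
        exact dist_bary_le hD hM (hsub.subset hy)) h3).1 x hx
      rwa [Metric.mem_closedBall, dist_comm] at this
    have hD0 : 0 ≤ D := by
      obtain ⟨x, hx⟩ := List.exists_mem_of_ne_nil l hne
      exact dist_nonneg.trans (hD x hx x hx)
    intro x hx y hy
    rcases List.mem_cons.1 hx with rfl | hx <;> rcases List.mem_cons.1 hy with rfl | hy
    · rw [dist_self]; positivity
    · exact h5 y hy
    · rw [dist_comm]; exact h5 x hx
    · exact h4 x hx y hy

lemma support_iterate_sd {s : Set E} (hs : Convex ℝ s) {l l' : List E} (h : ∀ x ∈ l, x ∈ s)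
    {D : ℝ} (hD : ∀ x ∈ l, ∀ y ∈ l, dist x y ≤ D) {M : ℕ} (hM : l.length ≤ M + 1) (r : ℕ)
    (hl' : l' ∈ ((sd ^ r : Module.End (ZMod 2) (Chain E)) (single l 1)).support) :
    (∀ x ∈ l', x ∈ s) ∧ l'.length = l.length ∧
      ∀ x ∈ l', ∀ y ∈ l', dist x y ≤ ((M : ℝ) / (M + 1)) ^ r * D := by
  induction r generalizing l' with
  | zero =>
    rw [pow_zero] at hl'
    have := Finsupp.support_single_subset hl'
    simp only [Finset.mem_singleton] at this
    subst this
    simpa using ⟨h, hD⟩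
  | succ r ih =>
    rw [pow_succ', Module.End.mul_apply] at hl'
    obtain ⟨l₁, h1, h2⟩ := support_linear hl'
    obtain ⟨h3, h4, h5⟩ := ih h1
    obtain ⟨h6, h7⟩ := support_sd hs h3 h2
    refine ⟨h6, by omega, ?_⟩
    rw [pow_succ', mul_assoc]
    exact mesh_sd h5 (by omega) h2

end Mesh

/-! ### The system of small chains on a product of cross-polytopes -/

section Crosspolytope

variable {k D : ℕ}

/-- The linear map changing the sign of row `j`. -/
def flipRow (j : Fin k) : (Fin k → Fin D → ℝ) →ₗ[ℝ] (Fin k → Fin D → ℝ) where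
  toFun u a := if a = j then -u a else u a
  map_add' u v := by
    funext a; by_cases h : a = j <;> simp [h, add_comm]
  map_smul' c u := by
    funext a; by_cases h : a = j <;> simp [h]

lemma flipRow_apply (j a : Fin k) (u : Fin k → Fin D → ℝ) :
    flipRow j u a = if a = j then -u a else u a := rfl

lemma flipRow_self (j : Fin k) (u : Fin k → Fin D → ℝ) : flipRow j u j = -u j := by
  simp [flipRow_apply]

lemma flipRow_of_ne {j a : Fin k} (h : a ≠ j) (u : Fin k → Fin D → ℝ) : flipRow j u a = u a := by
  simp [flipRow_apply, h]

lemma flipRow_comp_self (j : Fin k) :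
    (flipRow j : (Fin k → Fin D → ℝ) → _) ∘ flipRow j = id := by
  funext u a
  by_cases h : a = j <;> simp [flipRow_apply, h]

lemma flipRow_comm (i j : Fin k) :
    (flipRow i : (Fin k → Fin D → ℝ) → _) ∘ flipRow j = flipRow j ∘ flipRow i := by
  funext u a
  simp only [Function.comp_apply, flipRow_apply]
  split_ifs <;> rfl

/-- Matrices all of whose rows have `ℓ¹`-norm one. -/
def unitRows (k D : ℕ) : Set (Fin k → Fin D → ℝ) := {u | ∀ j, ∑ a, |u j a| = 1}

lemma dist_le_of_unitRows {u v : Fin k → Fin D → ℝ} (hu : u ∈ unitRows k D)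
    (hv : v ∈ unitRows k D) : dist u v ≤ 2 := by
  have h1 : ∀ {w : Fin k → Fin D → ℝ}, w ∈ unitRows k D → ∀ j a, |w j a| ≤ 1 := by
    intro w hw j a
    rw [← hw j]
    exact Finset.single_le_sum (f := fun a => |w j a|) (fun _ _ => abs_nonneg _) (Finset.mem_univ a)
  refine (dist_pi_le_iff (by norm_num)).2 fun j => (dist_pi_le_iff (by norm_num)).2 fun a => ?_
  rw [Real.dist_eq]
  have := abs_sub (u j a) (v j a)
  linarith [h1 hu j a, h1 hv j a]

/-- The matrix whose `j`-th row is the standard basis vector with index `I j`. -/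
def stdVertex (D : ℕ) (I : Fin k → ℕ) : Fin k → Fin D → ℝ :=
  fun j a => if (a : ℕ) = I j then 1 else 0

/-- A cell of the product of cross-polytopes, given by a sign pattern and the dimensions of the
coordinate subspaces. -/
def cell (s : Fin k → Fin D → ℝ) (I : Fin k → ℕ) : Set (Fin k → Fin D → ℝ) :=
  {u | ∀ j, (∀ a, 0 ≤ s j a * u j a) ∧ ∑ a, s j a * u j a = 1 ∧ ∀ a : Fin D, I j < a → u j a = 0}

lemma convex_cell (s : Fin k → Fin D → ℝ) (I : Fin k → ℕ) : Convex ℝ (cell s I) := by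
  intro u hu v hv p q hp hq hpq j
  obtain ⟨h1, h2, h3⟩ := hu j
  obtain ⟨h4, h5, h6⟩ := hv j
  have e : ∀ a, s j a * (p • u + q • v) j a = p * (s j a * u j a) + q * (s j a * v j a) := by
    intro a; simp; ring
  refine ⟨fun a => ?_, ?_, fun a ha => ?_⟩
  · rw [e]
    have := h1 a
    have := h4 a
    positivity
  · simp_rw [e]
    rw [Finset.sum_add_distrib, ← Finset.mul_sum, ← Finset.mul_sum, h2, h5]
    linarith
  · simp [h3 a ha, h6 a ha]

lemma cell_subset {s : Fin k → Fin D → ℝ} (hs : ∀ j a, s j a = 1 ∨ s j a = -1) (I : Fin k → ℕ) :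
    cell s I ⊆ unitRows k D := by
  intro u hu j
  obtain ⟨h1, h2, -⟩ := hu j
  rw [← h2]
  refine Finset.sum_congr rfl fun a _ => ?_
  have := h1 a
  rcases hs j a with h | h <;> rw [h] at this ⊢
  · rw [one_mul, abs_of_nonneg (by linarith)]
  · rw [abs_of_nonpos (by linarith)]; ring

lemma support_coned {I : Fin k → ℕ} (hI : ∀ j, I j < D) {l : List (Fin k → Fin D → ℝ)}
    (hl : l ∈ (coned (fun j => flipRow j) (stdVertex D) I).support) :
    l.length = ∑ a, I a + 1 ∧ ∃ s : Fin k → Fin D → ℝ, (∀ j a, s j a = 1 ∨ s j a = -1) ∧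
      (∀ j, ∀ a : Fin D, (a : ℕ) = I j → s j a = 1) ∧ ∀ u ∈ l, u ∈ cell s I := by
  classical
  induction hn : ∑ a, I a generalizing I l with
  | zero =>
    have h0 : I = 0 := funext fun a => (Finset.sum_eq_zero_iff.1 hn) a (Finset.mem_univ a)
    subst h0
    rw [coned_zero] at hl
    have := Finsupp.support_single_subset hl
    simp only [Finset.mem_singleton] at this
    subst this
    refine ⟨by simp, fun _ _ => 1, by simp, by simp, ?_⟩
    intro u hu j
    rw [List.mem_singleton] at hu
    subst hu
    refine ⟨fun a => ?_, ?_, fun a ha => ?_⟩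
    · simp only [stdVertex]; split_ifs <;> norm_num
    · have := Fintype.sum_eq_single (f := fun a : Fin D => 1 * stdVertex D (0 : Fin k → ℕ) j a)
        ⟨0, hI j⟩ (fun a ha => by
          have : (a : ℕ) ≠ 0 := fun h => ha (Fin.ext h)
          simp [stdVertex, this])
      rw [this]; simp [stdVertex]
    · have : (a : ℕ) ≠ 0 := by simp at ha; omega
      simp [stdVertex, this]
  | succ n ih =>
    have hne : I ≠ 0 := by rintro rfl; simp at hn
    rw [coned_eq _ _ hne] at hl
    obtain ⟨l₁, h1, rfl⟩ := support_cone hl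
    obtain ⟨j, -, h2⟩ := support_sum h1
    by_cases hj : 0 < I j
    swap
    · simp [hj] at h2
    rw [if_pos hj] at h2
    have hsum := sum_lower I j hj
    have hlow : ∀ a, lower I j a < D := fun a => (lower_le I j a).trans_lt (hI a)
    have key : l₁.length = n + 1 ∧ ∃ s : Fin k → Fin D → ℝ, (∀ j a, s j a = 1 ∨ s j a = -1) ∧
        (∀ i, i ≠ j → ∀ a : Fin D, (a : ℕ) = I i → s i a = 1) ∧
          ∀ u ∈ l₁, u ∈ cell s (lower I j) := by
      rcases support_add h2 with h3 | h3
      · obtain ⟨h4, s, h5, h6, h7⟩ := ih hlow h3 (by omega)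
        exact ⟨h4, s, h5, fun i hi a ha => h6 i a (by simpa [lower, hi] using ha), h7⟩
      · obtain ⟨l₂, h3', rfl⟩ := support_chainMap h3
        obtain ⟨h4, s, h5, h6, h7⟩ := ih hlow h3' (by omega)
        refine ⟨by simpa using h4, flipRow j s, ?_, ?_, ?_⟩
        · intro i a
          by_cases hi : i = j
          · simp only [flipRow_apply, hi, if_true, Pi.neg_apply]
            rcases h5 j a with h | h <;> simp [h]
          · simp only [flipRow_apply, hi, if_false]; exact h5 i a
        · intro i hi a ha
          simp only [flipRow_apply, hi, if_false]
          exact h6 i a (by simpa [lower, hi] using ha)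
        · intro u hu
          obtain ⟨w, hw, rfl⟩ := List.mem_map.1 hu
          intro i
          have := h7 w hw i
          by_cases hi : i = j
          · subst hi; simpa [flipRow_apply] using this
          · simpa [flipRow_apply, hi] using this
    obtain ⟨hlen, s, hs1, hs2, hs3⟩ := key
    let s' : Fin k → Fin D → ℝ := fun i a => if (a : ℕ) = I i then 1 else s i a
    refine ⟨by simp [hlen], s', ?_, ?_, ?_⟩
    · intro i a
      simp only [s']
      split_ifs
      · exact Or.inl rfl
      · exact hs1 i a
    · intro i a ha; simp [s', ha]
    · intro u hu i
      rcases List.mem_cons.1 hu with rfl | hu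
      · refine ⟨fun a => ?_, ?_, fun a ha => ?_⟩
        · simp only [stdVertex, s']; split_ifs <;> norm_num
        · rw [Fintype.sum_eq_single (⟨I i, hI i⟩ : Fin D)]
          · simp [stdVertex, s']
          · intro a ha
            have : (a : ℕ) ≠ I i := fun h => ha (Fin.ext h)
            simp [stdVertex, this]
        · have : (a : ℕ) ≠ I i := by omega
          simp [stdVertex, this]
      · have e : ∀ a, s' i a * u i a = s i a * u i a := by
          intro a
          by_cases ha : (a : ℕ) = I i
          · by_cases hi : i = j
            · subst hi
              have : u i a = 0 := (hs3 u hu i).2.2 a (by simp [lower]; omega)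
              simp [this]
            · simp [s', ha, hs2 i hi a ha]
          · simp [s', ha]
        obtain ⟨h4, h5, h6⟩ := hs3 u hu i
        refine ⟨fun a => by rw [e]; exact h4 a, by simp_rw [e]; exact h5, fun a ha => ?_⟩
        exact h6 a ((lower_le I j i).trans_lt ha)

/-- Changing signs of rows. -/
def signAct (σ : Fin k → ℤˣ) (u : Fin k → Fin D → ℝ) : Fin k → Fin D → ℝ := fun a => σ a • u a

lemma flipRow_signAct (j : Fin k) (σ : Fin k → ℤˣ) (u : Fin k → Fin D → ℝ) :
    flipRow j (signAct σ u) = signAct (Function.update σ j (-σ j)) u := by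
  funext a
  by_cases h : a = j
  · subst h; simp [flipRow_apply, signAct, Units.neg_smul]
  · simp [flipRow_apply, signAct, h]

lemma signAct_mem_unitRows {u : Fin k → Fin D → ℝ} (hu : u ∈ unitRows k D) (σ : Fin k → ℤˣ) :
    signAct σ u ∈ unitRows k D := by
  intro j
  rw [← hu j]
  refine Finset.sum_congr rfl fun a _ => ?_
  rcases Int.units_eq_one_or (σ j) with h | h <;> simp [signAct, h, Units.neg_smul]

lemma chainMap_iterate_sd {E : Type*} [AddCommGroup E] [Module ℝ E] (f : E →ₗ[ℝ] E) (r : ℕ)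
    (c : Chain E) : chainMap f ((sd ^ r : Module.End (ZMod 2) (Chain E)) c) =
      (sd ^ r : Module.End (ZMod 2) (Chain E)) (chainMap f c) := by
  induction r with
  | zero => simp
  | succ r ih => rw [pow_succ', Module.End.mul_apply, chainMap_sd, ih, Module.End.mul_apply]

lemma bd_iterate_sd {E : Type*} [AddCommGroup E] [Module ℝ E] (r : ℕ)
    (c : Chain E) : bd ((sd ^ r : Module.End (ZMod 2) (Chain E)) c) =
      (sd ^ r : Module.End (ZMod 2) (Chain E)) (bd c) := by
  induction r with
  | zero => simp
  | succ r ih => rw [pow_succ', Module.End.mul_apply, bd_sd, ih, Module.End.mul_apply]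

/-- Systems of arbitrarily small chains on matrices with unit rows. -/
theorem exists_system (top : Fin k → ℕ) (htop : ∀ j, top j < D) {δ : ℝ} (hδ : 0 < δ) :
    ∃ (S : System (Fin k → Fin D → ℝ) k) (U : Set (Fin k → Fin D → ℝ)),
      (S.g = fun j => ⇑(flipRow j : (Fin k → Fin D → ℝ) →ₗ[ℝ] _)) ∧
      S.top = top ∧ U.Finite ∧ U ⊆ unitRows k D ∧
      (∀ j, ∀ u ∈ U, flipRow j u ∈ U) ∧
      S.K = {l | (∀ u ∈ l, u ∈ U) ∧ ∀ u ∈ l, ∀ v ∈ l, dist u v < δ} := by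
  classical
  set M : ℕ := ∑ a, top a
  obtain ⟨r, hr⟩ : ∃ r : ℕ, ((M : ℝ) / (M + 1)) ^ r < δ / 2 :=
    exists_pow_lt_of_lt_one (by positivity) (by rw [div_lt_one (by positivity)]; linarith)
  let c : (Fin k → ℕ) → Chain (Fin k → Fin D → ℝ) := fun I =>
    (sd ^ r : Module.End (ZMod 2) (Chain (Fin k → Fin D → ℝ)))
      (coned (fun j => flipRow j) (stdVertex D) I)
  have hc : ∀ I ≤ top, ∀ l ∈ (c I).support, (∀ u ∈ l, u ∈ unitRows k D) ∧
      l.length = ∑ a, I a + 1 ∧ ∀ u ∈ l, ∀ v ∈ l, dist u v < δ := by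
    intro I hI l hl
    obtain ⟨l', h1, h2⟩ := support_linear hl
    obtain ⟨h3, s, h4, -, h5⟩ := support_coned (fun j => (hI j).trans_lt (htop j)) h1
    have hsub := cell_subset h4 I
    have hM : l'.length ≤ M + 1 := by
      rw [h3]; exact Nat.succ_le_succ (Finset.sum_le_sum fun a _ => hI a)
    obtain ⟨h6, h7, h8⟩ := support_iterate_sd (convex_cell s I) h5 (D := 2)
      (fun x hx y hy => dist_le_of_unitRows (hsub (h5 x hx)) (hsub (h5 y hy))) hM r h2
    refine ⟨fun u hu => hsub (h6 u hu), by omega, fun u hu v hv => ?_⟩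
    have := h8 u hu v hv
    linarith
  let V : Finset (Fin k → Fin D → ℝ) :=
    (Finset.Icc 0 top).biUnion fun I => (c I).support.biUnion fun l => l.toFinset
  have hV : ∀ u, u ∈ V ↔ ∃ I ≤ top, ∃ l ∈ (c I).support, u ∈ l := by
    intro u; simp [V]
  let U : Set (Fin k → Fin D → ℝ) := (fun p : (Fin k → ℤˣ) × (Fin k → Fin D → ℝ) =>
    signAct p.1 p.2) '' (Set.univ ×ˢ (V : Set (Fin k → Fin D → ℝ)))
  have hVU : ∀ u ∈ V, u ∈ U := by
    intro u hu
    exact ⟨(fun _ => 1, u), ⟨Set.mem_univ _, hu⟩, by funext a; simp [signAct]⟩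
  have hUflip : ∀ j, ∀ u ∈ U, flipRow j u ∈ U := by
    rintro j _ ⟨⟨σ, u⟩, ⟨-, hu⟩, rfl⟩
    exact ⟨(Function.update σ j (-σ j), u), ⟨Set.mem_univ _, hu⟩, (flipRow_signAct j σ u).symm⟩
  refine ⟨{ g := fun j => flipRow j
            K := {l | (∀ u ∈ l, u ∈ U) ∧ ∀ u ∈ l, ∀ v ∈ l, dist u v < δ}
            C := c
            top := top
            sublist_mem := ?_, map_mem := ?_, supp := ?_, bd_C := ?_, C_zero := ?_ },
          U, rfl, rfl, ?_, ?_, hUflip, rfl⟩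
  · rintro l ⟨h1, h2⟩ l' hl'
    exact ⟨fun u hu => h1 u (hl'.subset hu),
      fun u hu v hv => h2 u (hl'.subset hu) v (hl'.subset hv)⟩
  · rintro j l ⟨h1, h2⟩
    refine ⟨fun u hu => ?_, fun u hu v hv => ?_⟩
    · obtain ⟨w, hw, rfl⟩ := List.mem_map.1 hu
      exact hUflip j w (h1 w hw)
    · obtain ⟨w, hw, rfl⟩ := List.mem_map.1 hu
      obtain ⟨x, hx, rfl⟩ := List.mem_map.1 hv
      refine lt_of_le_of_lt ?_ (h2 w hw x hx)
      refine (dist_pi_le_iff dist_nonneg).2 fun a => ?_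
      by_cases h : a = j
      · subst h
        rw [flipRow_self, flipRow_self, dist_neg_neg]
        exact dist_le_pi_dist w x a
      · rw [flipRow_of_ne h, flipRow_of_ne h]
        exact dist_le_pi_dist w x a
  · intro I hI l hl
    obtain ⟨-, h2, h3⟩ := hc I hI l hl
    exact ⟨⟨fun u hu => hVU u ((hV u).2 ⟨I, hI, l, hl, hu⟩), h3⟩, h2⟩
  · intro I _ hne
    simp only [c]
    rw [bd_iterate_sd, bd_coned flipRow_comp_self flipRow_comm hne, sphereChain, map_sum]
    refine Finset.sum_congr rfl fun j _ => ?_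
    split_ifs
    · rw [map_add, chainMap_iterate_sd]
    · simp
  · refine ⟨stdVertex D 0, ?_⟩
    simp only [c]
    rw [coned_zero]
    clear hr hc hV hVU hUflip
    induction r with
    | zero => simp
    | succ r ih => rw [pow_succ', Module.End.mul_apply, ih, sd_single_singleton]
  · exact (Set.finite_univ.prod V.finite_toSet).image _
  · rintro _ ⟨⟨σ, u⟩, ⟨-, hu⟩, rfl⟩
    obtain ⟨I, hI, l, hl, hul⟩ := (hV u).1 hu
    exact signAct_mem_unitRows ((hc I hI l hl).1 u hul) σ

end Crosspolytope

/-! ### Parity in Radon's theorem -/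

section Radon

variable {ι E : Type*} [AddCommGroup E] [Module ℝ E]

lemma mem_convexHull_image_finset {w : ι → E} {T : Finset ι} {x : E} :
    x ∈ convexHull ℝ (w '' T) ↔
      ∃ c : ι → ℝ, (∀ i ∈ T, 0 ≤ c i) ∧ ∑ i ∈ T, c i = 1 ∧ ∑ i ∈ T, c i • w i = x := by
  classical
  constructor
  · intro hx
    have hconv : Convex ℝ {x | ∃ c : ι → ℝ, (∀ i ∈ T, 0 ≤ c i) ∧ ∑ i ∈ T, c i = 1 ∧
        ∑ i ∈ T, c i • w i = x} := by
      rintro x ⟨c, h1, h2, rfl⟩ y ⟨c', h1', h2', rfl⟩ p q hp hq hpq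
      refine ⟨fun i => p * c i + q * c' i, fun i hi => ?_, ?_, ?_⟩
      · have := h1 i hi
        have := h1' i hi
        positivity
      · rw [Finset.sum_add_distrib, ← Finset.mul_sum, ← Finset.mul_sum, h2, h2']; linarith
      · simp [add_smul, Finset.sum_add_distrib, Finset.smul_sum, mul_smul]
    refine convexHull_min ?_ hconv hx
    rintro _ ⟨i, hi, rfl⟩
    refine ⟨fun j => if j = i then 1 else 0, fun j _ => by dsimp only; split_ifs <;> norm_num, ?_, ?_⟩
    · simp [Finset.mem_coe.1 hi]
    · simp [Finset.mem_coe.1 hi]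
  · rintro ⟨c, h1, h2, rfl⟩
    exact (convex_convexHull ℝ _).sum_mem h1 h2
      fun i hi => subset_convexHull ℝ _ ⟨i, hi, rfl⟩

lemma zero_mem_convexHull_image_iff {w : ι → E} {T : Finset ι} :
    0 ∈ convexHull ℝ (w '' T) ↔
      ∃ c : ι → ℝ, (∀ i ∈ T, 0 ≤ c i) ∧ (∃ i ∈ T, c i ≠ 0) ∧ ∑ i ∈ T, c i • w i = 0 := by
  rw [mem_convexHull_image_finset]
  constructor
  · rintro ⟨c, h1, h2, h3⟩
    refine ⟨c, h1, ?_, h3⟩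
    by_contra! h
    rw [Finset.sum_eq_zero h] at h2
    exact zero_ne_one h2
  · rintro ⟨c, h1, ⟨i, hi, hne⟩, h3⟩
    have hpos : 0 < ∑ i ∈ T, c i :=
      Finset.sum_pos' h1 ⟨i, hi, lt_of_le_of_ne (h1 i hi) hne.symm⟩
    refine ⟨fun i => (∑ i ∈ T, c i)⁻¹ * c i, fun i hi => ?_, ?_, ?_⟩
    · have := h1 i hi; positivity
    · rw [← Finset.mul_sum, inv_mul_cancel₀ hpos.ne']
    · simp only [mul_smul]
      rw [← Finset.smul_sum, h3, smul_zero]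

lemma zero_notMem_convexHull {w : ι → E} {T : Finset ι} (h : LinearIndepOn ℝ w (T : Set ι)) :
    (0 : E) ∉ convexHull ℝ (w '' T) := by
  rw [zero_mem_convexHull_image_iff]
  rintro ⟨c, -, ⟨i, hi, hne⟩, h3⟩
  exact hne (linearIndepOn_finset_iff.1 h c h3 i hi)

/-- If a space of dependencies is at least two-dimensional and no nonzero dependency has two zeros,
then the number of indices at which some nonnegative nonzero dependency vanishes is even. -/
lemma even_card_vanishing [Fintype ι] [DecidableEq ι] (Λ : Submodule ℝ (ι → ℝ))
    (hZ : ∀ c ∈ Λ, ∀ a b, a ≠ b → c a = 0 → c b = 0 → c = 0)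
    (hD : ∀ c ∈ Λ, ∃ c' ∈ Λ, ∀ r : ℝ, c' ≠ r • c) (G : Finset ι)
    (hG : ∀ i, i ∈ G ↔ ∃ c ∈ Λ, (∀ j, 0 ≤ c j) ∧ c ≠ 0 ∧ c i = 0) : Even G.card := by
  have hpos : ∀ c ∈ Λ, (∀ j, 0 ≤ c j) → c ≠ 0 → ∀ i, c i = 0 → ∀ j, j ≠ i → 0 < c j := by
    intro c hc h1 h2 i hi j hj
    exact lt_of_le_of_ne (h1 j) fun h => h2 (hZ c hc j i hj h.symm hi)
  rcases G.eq_empty_or_nonempty with rfl | ⟨i, hi⟩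
  · simp
  obtain ⟨c, hc, hc0, hcne, hci⟩ := (hG i).1 hi
  have hcpos := hpos c hc hc0 hcne i hci
  have hnei : ∃ j, j ≠ i := by
    by_contra! h
    refine hcne (funext fun j => ?_)
    rw [h j, hci]; rfl
  -- another vanishing index
  obtain ⟨j₀, hj₀, hj₀G⟩ : ∃ j, j ≠ i ∧ j ∈ G := by
    obtain ⟨μ, hμ, hμne⟩ := hD c hc
    have hμi : μ i ≠ 0 := by
      intro h
      obtain ⟨j, hj⟩ := hnei
      refine hμne (μ j / c j) ?_
      have := hZ (μ - (μ j / c j) • c) (Λ.sub_mem hμ (Λ.smul_mem _ hc)) i j hj.symm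
        (by simp [h, hci]) (by simp [(hcpos j hj).ne'])
      exact sub_eq_zero.1 this
    let μ' := (μ i)⁻¹ • μ
    obtain ⟨j, hj, hmin⟩ := Finset.exists_min_image (Finset.univ.erase i) (fun j => μ' j / c j)
      (by obtain ⟨j, hj⟩ := hnei; exact ⟨j, by simp [hj]⟩)
    have hji : j ≠ i := (Finset.mem_erase.1 hj).1
    have hi1 : (μ' - (μ' j / c j) • c) i = 1 := by simp [μ', hci, hμi]
    refine ⟨j, hji, (hG j).2 ⟨μ' - (μ' j / c j) • c,
      Λ.sub_mem (Λ.smul_mem _ hμ) (Λ.smul_mem _ hc), ?_, ?_, ?_⟩⟩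
    · intro a
      by_cases ha : a = i
      · rw [ha, hi1]; norm_num
      · have := hmin a (by simp [ha])
        have hca := hcpos a ha
        rw [le_div_iff₀ hca] at this
        simpa using this
    · intro h
      rw [h] at hi1
      simp at hi1
    · simp [(hcpos j hji).ne']
  have hcard : G = {i, j₀} := by
    ext j
    simp only [Finset.mem_insert, Finset.mem_singleton]
    constructor
    · intro hj
      by_contra! hcon
      obtain ⟨hji, hjj⟩ := hcon
      obtain ⟨a, ha, ha0, hane, haj⟩ := (hG j₀).1 hj₀G
      obtain ⟨b, hb, hb0, hbne, hbj⟩ := (hG j).1 hj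
      have hai := hpos a ha ha0 hane j₀ haj i hj₀.symm
      have hbi := hpos b hb hb0 hbne j hbj i hji.symm
      have haj' := hpos a ha ha0 hane j₀ haj j hjj
      have hbj' := hpos b hb hb0 hbne j hbj j₀ hjj.symm
      let r := (b i * a j₀ - a i * b j₀) / c j₀
      have hz := hZ (b i • a - a i • b - r • c)
        (Λ.sub_mem (Λ.sub_mem (Λ.smul_mem _ ha) (Λ.smul_mem _ hb)) (Λ.smul_mem _ hc)) i j₀ hj₀.symm
        (by simp [hci]; ring) (by simp [r, (hcpos j₀ hj₀).ne'])
      have h1 := congrFun hz j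
      simp only [Pi.sub_apply, Pi.smul_apply, smul_eq_mul, hbj, mul_zero, sub_zero,
        Pi.zero_apply] at h1
      have hr : r ≤ 0 := by
        simp only [r, haj, mul_zero, zero_sub]
        exact div_nonpos_of_nonpos_of_nonneg (by nlinarith [mul_pos hai hbj']) (hc0 j₀)
      nlinarith [mul_pos hbi haj', hcpos j hji, mul_nonneg (neg_nonneg.2 hr) (hc0 j)]
    · rintro (rfl | rfl) <;> assumption
  rw [hcard, Finset.card_pair hj₀.symm]
  decide

end Radon

section RadonList

variable {β : Type*}

open Classical in
/-- The cochain detecting whether the convex hull of the images contains the origin. -/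
noncomputable def hits {E : Type*} [AddCommGroup E] [Module ℝ E] (w : β → E) (l : List β) :
    ZMod 2 := if 0 ∈ convexHull ℝ (w '' {x | x ∈ l}) then 1 else 0

lemma hits_eq_zero_of_indep {E : Type*} [AddCommGroup E] [Module ℝ E] {w : β → E} {l : List β}
    (h : LinearIndepOn ℝ w {x | x ∈ l}) : hits w l = 0 := by
  classical
  have e : {x | x ∈ l} = (l.toFinset : Set β) := by ext; simp
  rw [hits, if_neg]
  rw [e] at h ⊢
  exact zero_notMem_convexHull h

lemma cobd_hits_of_nodup {q : ℕ} (w : β → Fin q → ℝ) (l : List β) (hlen : l.length = q + 2)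
    (hl : l.Nodup)
    (hind : ∀ T : Finset β, (∀ x ∈ T, x ∈ l) → T.card ≤ q → LinearIndepOn ℝ w (T : Set β)) :
    cobd (hits w) l = 0 := by
  classical
  rw [cobd_eq_sum]
  let w' : Fin l.length → Fin q → ℝ := fun i => w l[i]
  let Λ : Submodule ℝ (Fin l.length → ℝ) := LinearMap.ker (Fintype.linearCombination ℝ w')
  have hΛ : ∀ c, c ∈ Λ ↔ ∑ i, c i • w' i = 0 := by
    intro c; simp [Λ, LinearMap.mem_ker, Fintype.linearCombination_apply]
  have hdim : 2 ≤ Module.finrank ℝ Λ := by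
    have h1 := LinearMap.finrank_range_add_finrank_ker (Fintype.linearCombination ℝ w')
    have h2 := Submodule.finrank_le (LinearMap.range (Fintype.linearCombination ℝ w'))
    simp only [Module.finrank_fintype_fun_eq_card, Fintype.card_fin] at h1 h2
    change _ ≤ Module.finrank ℝ (LinearMap.ker _)
    omega
  have himg : ∀ i : Fin l.length, w '' {x | x ∈ l.eraseIdx i} =
      w' '' ((Finset.univ.erase i : Finset (Fin l.length)) : Set (Fin l.length)) := by
    intro i
    ext v
    simp only [Set.mem_image, Set.mem_ofPred_eq, List.mem_eraseIdx_iff_getElem, Finset.coe_erase,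
      Finset.coe_univ]
    constructor
    · rintro ⟨x, ⟨j, hj, hji, rfl⟩, rfl⟩
      exact ⟨⟨j, hj⟩, by simpa [Fin.ext_iff] using hji, rfl⟩
    · rintro ⟨j, hj, rfl⟩
      exact ⟨l[j], ⟨j, j.2, by simpa [Fin.ext_iff] using hj, rfl⟩, rfl⟩
  let G : Finset (Fin l.length) :=
    Finset.univ.filter fun i => 0 ∈ convexHull ℝ (w '' {x | x ∈ l.eraseIdx i})
  have hsum : ∑ i : Fin l.length, hits w (l.eraseIdx i) = (G.card : ZMod 2) := by
    simp only [hits, G, Finset.sum_boole]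
  rw [hsum, ZMod.natCast_eq_zero_iff_even]
  refine even_card_vanishing Λ ?_ ?_ G ?_
  · intro c hc a b hab ha hb
    rw [hΛ] at hc
    have hmem : ∀ i, i ∈ (Finset.univ.erase a).erase b ↔ i ≠ b ∧ i ≠ a := by simp
    let T : Finset β := ((Finset.univ.erase a).erase b).image fun i : Fin l.length => l[i]
    have hinj : Function.Injective fun i : Fin l.length => l[i] := fun i j h =>
      List.nodup_iff_injective_get.1 hl h
    have hT : T.card ≤ q := by
      refine Finset.card_image_le.trans ?_
      rw [Finset.card_erase_of_mem (by simpa using hab.symm),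
        Finset.card_erase_of_mem (Finset.mem_univ a), Finset.card_univ, Fintype.card_fin]
      omega
    have hlin := hind T (by
      intro x hx
      obtain ⟨i, -, rfl⟩ := Finset.mem_image.1 hx
      exact List.getElem_mem _) hT
    rw [Finset.coe_image] at hlin
    have hlin' := hlin.comp_of_image hinj.injOn
    rw [linearIndepOn_finset_iff] at hlin'
    have hs : ∑ i ∈ (Finset.univ.erase a).erase b, c i • w' i = 0 := by
      rw [← hc]
      refine Finset.sum_subset (Finset.subset_univ _) fun i _ hi => ?_
      rw [hmem] at hi
      by_cases h : i = b
      · simp [h, hb]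
      · have : i = a := by tauto
        simp [this, ha]
    funext i
    by_cases h : i = b
    · rw [h, hb]; rfl
    by_cases h' : i = a
    · rw [h', ha]; rfl
    exact hlin' c hs i ((hmem i).2 ⟨h, h'⟩)
  · intro c _
    by_contra! h
    have hle : Λ ≤ Submodule.span ℝ {c} := by
      intro c' hc'
      obtain ⟨r, hr⟩ := h c' hc'
      exact Submodule.mem_span_singleton.2 ⟨r, hr.symm⟩
    have := (Submodule.finrank_mono hle).trans (finrank_span_le_card ({c} : Set _))
    simp at this
    omega
  · intro i
    simp only [G, Finset.mem_filter, Finset.mem_univ, true_and]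
    rw [himg, zero_mem_convexHull_image_iff]
    constructor
    · rintro ⟨c, h1, ⟨j, hj, hne⟩, h3⟩
      refine ⟨Function.update c i 0, (hΛ _).2 ?_, ?_, ?_, by simp⟩
      · rw [← Finset.add_sum_erase _ _ (Finset.mem_univ i)]
        simp only [Function.update_self, zero_smul, zero_add]
        rw [← h3]
        refine Finset.sum_congr rfl fun a ha => ?_
        rw [Function.update_of_ne (Finset.mem_erase.1 ha).1]
      · intro a
        by_cases ha : a = i
        · subst ha; simp
        · rw [Function.update_of_ne ha]; exact h1 a (by simp [ha])
      · intro h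
        have := congrFun h j
        rw [Function.update_of_ne (Finset.mem_erase.1 hj).1] at this
        exact hne this
    · rintro ⟨c, hc, h1, h2, h3⟩
      refine ⟨c, fun a _ => h1 a, ?_, ?_⟩
      · obtain ⟨j, hj⟩ := Function.ne_iff.1 h2
        refine ⟨j, ?_, hj⟩
        rw [Finset.mem_erase]
        refine ⟨?_, Finset.mem_univ j⟩
        rintro rfl
        exact hj h3
      · have := (hΛ c).1 hc
        rw [← Finset.add_sum_erase _ _ (Finset.mem_univ i), h3, zero_smul, zero_add] at this
        exact this

/-- Among the faces of a list of `q + 2` vectors in general position in `q`-space, an even number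
contains the origin. -/
theorem cobd_hits {q : ℕ} (w : β → Fin q → ℝ) (l : List β) (hlen : l.length = q + 2)
    (hind : ∀ T : Finset β, (∀ x ∈ T, x ∈ l) → T.card ≤ q → LinearIndepOn ℝ w (T : Set β)) :
    cobd (hits w) l = 0 := by
  classical
  by_cases hl : l.Nodup
  · exact cobd_hits_of_nodup w l hlen hl hind
  rw [List.nodup_iff_injective_get] at hl
  obtain ⟨a, b, hab, hne⟩ : ∃ a b : Fin l.length, l.get a = l.get b ∧ a ≠ b := by
    simpa [Function.Injective] using hl
  rw [cobd_eq_sum, ← Finset.add_sum_erase _ _ (Finset.mem_univ a),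
    ← Finset.add_sum_erase _ _ (show b ∈ Finset.univ.erase a by simpa using hne.symm)]
  have hmem : ∀ (i : Fin l.length) (x : β), x ∈ l.eraseIdx i ↔ ∃ j, j ≠ i ∧ l.get j = x := by
    intro i x
    rw [List.mem_eraseIdx_iff_getElem]
    constructor
    · rintro ⟨j, hj, hji, rfl⟩; exact ⟨⟨j, hj⟩, by simpa [Fin.ext_iff] using hji, rfl⟩
    · rintro ⟨j, hj, rfl⟩; exact ⟨j, j.2, by simpa [Fin.ext_iff] using hj, rfl⟩
  have hEq : {x | x ∈ l.eraseIdx a} = {x | x ∈ l.eraseIdx b} := by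
    ext x
    simp only [Set.mem_ofPred_eq, hmem]
    constructor
    · rintro ⟨j, hj, rfl⟩
      by_cases h : j = b
      · exact ⟨a, hne, by rw [h, hab]⟩
      · exact ⟨j, h, rfl⟩
    · rintro ⟨j, hj, rfl⟩
      by_cases h : j = a
      · exact ⟨b, hne.symm, by rw [h, hab]⟩
      · exact ⟨j, h, rfl⟩
  have h1 : hits w (l.eraseIdx a) = hits w (l.eraseIdx b) := by
    simp only [hits, hEq]
  have h2 : ∑ i ∈ (Finset.univ.erase a).erase b, hits w (l.eraseIdx i) = 0 := by
    refine Finset.sum_eq_zero fun i hi => hits_eq_zero_of_indep ?_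
    have hib : i ≠ b := (Finset.mem_erase.1 hi).1
    have hia : i ≠ a := (Finset.mem_erase.1 (Finset.mem_erase.1 hi).2).1
    let T : Finset β := ((Finset.univ.erase i).erase a).image l.get
    have hT : {x | x ∈ l.eraseIdx i} = (T : Set β) := by
      ext x
      simp only [Set.mem_ofPred_eq, hmem, T, Finset.coe_image, Set.mem_image, Finset.mem_coe,
        Finset.mem_erase, Finset.mem_univ, and_true]
      constructor
      · rintro ⟨j, hj, rfl⟩
        by_cases h : j = a
        · exact ⟨b, ⟨hne.symm, hib.symm⟩, by rw [h, hab]⟩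
        · exact ⟨j, ⟨h, hj⟩, rfl⟩
      · rintro ⟨j, ⟨_, hj⟩, rfl⟩
        exact ⟨j, hj, rfl⟩
    rw [hT]
    refine hind T ?_ ?_
    · intro x hx
      obtain ⟨j, -, rfl⟩ := Finset.mem_image.1 hx
      exact List.get_mem _ _
    · refine Finset.card_image_le.trans ?_
      rw [Finset.card_erase_of_mem (by simpa using hia.symm),
        Finset.card_erase_of_mem (Finset.mem_univ i), Finset.card_univ, Fintype.card_fin]
      omega
  rw [h1, h2, add_zero, CharTwo.add_self_eq_zero]

end RadonList

/-! ### The tower of truncations -/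

section Tower

variable {β : Type*} {k : ℕ}

/-- The first `q` coordinates of a vector. -/
def trunc (q : ℕ) : (Fin k → ℝ) →ₗ[ℝ] (Fin q → ℝ) where
  toFun v a := if h : (a : ℕ) < k then v ⟨a, h⟩ else 0
  map_add' u v := by funext a; simp only [Pi.add_apply]; split_ifs <;> simp
  map_smul' c u := by funext a; simp

/-- Change the sign of the coordinate with index `j`. -/
def flipCoord {n : ℕ} (j : ℕ) : (Fin n → ℝ) →ₗ[ℝ] (Fin n → ℝ) where
  toFun v a := if (a : ℕ) = j then -v a else v a
  map_add' u v := by funext a; simp only [Pi.add_apply]; split_ifs <;> ring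
  map_smul' c u := by funext a; simp

lemma flipCoord_apply {n : ℕ} (j : ℕ) (v : Fin n → ℝ) (a : Fin n) :
    flipCoord j v a = if (a : ℕ) = j then -v a else v a := rfl

lemma trunc_apply (q : ℕ) (v : Fin k → ℝ) (a : Fin q) :
    trunc q v a = if h : (a : ℕ) < k then v ⟨a, h⟩ else 0 := rfl

lemma flipCoord_injective {n : ℕ} (j : ℕ) :
    Function.Injective (flipCoord j : (Fin n → ℝ) →ₗ[ℝ] (Fin n → ℝ)) := by
  refine Function.LeftInverse.injective (g := flipCoord j) fun v => ?_
  funext a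
  simp only [flipCoord_apply]
  split_ifs <;> simp

lemma trunc_flipCoord (q j : ℕ) (v : Fin k → ℝ) :
    trunc q (flipCoord j v) = flipCoord j (trunc q v) := by
  funext a
  simp only [trunc_apply, flipCoord_apply]
  split_ifs <;> simp

lemma trunc_self (v : Fin k → ℝ) : trunc k v = v := by
  funext a; simp [trunc_apply]

lemma hits_eq_one_iff {E : Type*} [AddCommGroup E] [Module ℝ E] {w : β → E} {l : List β} :
    hits w l = 1 ↔ 0 ∈ convexHull ℝ (w '' {x | x ∈ l}) := by
  rw [hits]; split_ifs with h <;> simp [h]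

lemma hits_congr {γ E F : Type*} [AddCommGroup E] [Module ℝ E] [AddCommGroup F] [Module ℝ F]
    {w : β → E} {l : List β} {w' : γ → F} {l' : List γ}
    (h : (0 : E) ∈ convexHull ℝ (w '' {x | x ∈ l}) ↔ (0 : F) ∈ convexHull ℝ (w' '' {x | x ∈ l'})) :
    hits w l = hits w' l' := by
  have aux : ∀ a b : ZMod 2, (a = 1 ↔ b = 1) → a = b := by decide
  exact aux _ _ (by rw [hits_eq_one_iff, hits_eq_one_iff, h])

lemma hits_map {γ E : Type*} [AddCommGroup E] [Module ℝ E] (w : γ → E) (f : β → γ) (l : List β) :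
    hits w (l.map f) = hits (fun x => w (f x)) l := by
  have : w '' {x | x ∈ l.map f} = (fun x => w (f x)) '' {x | x ∈ l} := by
    ext v; simp
  exact hits_congr (by rw [this])

lemma hits_comp_injective {E F : Type*} [AddCommGroup E] [Module ℝ E] [AddCommGroup F] [Module ℝ F]
    (f : E →ₗ[ℝ] F) (hf : Function.Injective f) (w : β → E) (l : List β) :
    hits (fun x => f (w x)) l = hits w l := by
  have h1 : (fun x => f (w x)) '' {x | x ∈ l} = f '' (w '' {x | x ∈ l}) := by
    rw [Set.image_image]
  have h2 : (0 : F) ∈ convexHull ℝ (f '' (w '' {x | x ∈ l})) ↔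
      (0 : E) ∈ convexHull ℝ (w '' {x | x ∈ l}) := by
    rw [← LinearMap.image_convexHull]
    constructor
    · rintro ⟨v, hv, h0⟩
      rwa [← (map_eq_zero_iff f hf).1 h0]
    · intro h; exact ⟨0, h, map_zero f⟩
  exact hits_congr (by rw [h1, h2])

/-- All truncations of a family are as independent as dimensions allow. -/
def GenericOn (z : β → Fin k → ℝ) (B : Set β) : Prop :=
  ∀ q ≤ k, ∀ T : Finset β, (T : Set β) ⊆ B → T.card ≤ q →
    LinearIndepOn ℝ (fun x => trunc q (z x)) (T : Set β)

/-- The family of truncations with an additional vector on the last axis. -/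
noncomputable def withAxis (z : β → Fin k → ℝ) (q : ℕ) (s : ℝ) : Option β → Fin (q + 1) → ℝ
  | Option.none => Pi.single (Fin.last q) (-s)
  | Option.some x => trunc (q + 1) (z x)

/-- The cochain detecting whether the convex hull of the truncations meets the open half of the last
axis. -/
noncomputable def halfHits (z : β → Fin k → ℝ) (q : ℕ) (l : List β) : ZMod 2 :=
  hits (withAxis z q 1) (none :: l.map Option.some)

lemma GenericOn.cobd_hits {z : β → Fin k → ℝ} {l : List β} (h : GenericOn z {x | x ∈ l}) {q : ℕ}
    (hq : q ≤ k) (hlen : l.length = q + 2) : cobd (hits fun x => trunc q (z x)) l = 0 :=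
  HeavyFlat.cobd_hits _ _ hlen fun T hT hcard => h q hq T hT hcard

lemma GenericOn.withAxis {z : β → Fin k → ℝ} {B : Set β} (h : GenericOn z B) {q : ℕ} (hq : q < k)
    (T : Finset (Option β)) (hT : ∀ x, Option.some x ∈ T → x ∈ B) (hcard : T.card ≤ q + 1) :
    LinearIndepOn ℝ (withAxis z q 1) (T : Set (Option β)) := by
  classical
  let T' : Finset β := Finset.eraseNone T
  have hT' : ∀ x, x ∈ T' ↔ Option.some x ∈ T := fun x => Finset.mem_eraseNone
  have hsub : (T' : Set β) ⊆ B := fun x hx => hT x ((hT' x).1 hx)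
  rw [linearIndepOn_finset_iff]
  intro c hc
  have himg : T'.image Option.some = T.erase none := by
    rw [Finset.image_some_eraseNone]
  by_cases hn : none ∈ T
  · have hc' := hc
    rw [← Finset.add_sum_erase _ _ hn, ← himg, Finset.sum_image (by simp)] at hc
    have hcardT' : T'.card ≤ q := by
      have := Finset.card_erase_of_mem hn
      rw [← himg, Finset.card_image_of_injective _ (Option.some_injective _)] at this
      omega
    have hlin := h q hq.le T' hsub hcardT'
    rw [linearIndepOn_finset_iff] at hlin
    have h0 : ∀ x ∈ T', c (Option.some x) = 0 := by
      refine hlin (fun x => c (Option.some x)) ?_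
      funext a
      have := congrFun hc a.castSucc
      simp only [Pi.add_apply, Pi.smul_apply, Finset.sum_apply, HeavyFlat.withAxis] at this ⊢
      rw [Pi.single_eq_of_ne (Fin.castSucc_lt_last a).ne] at this
      simpa [trunc_apply] using this
    have h1 : c none = 0 := by
      rw [Finset.sum_eq_zero (fun x hx => by rw [h0 x hx, zero_smul]), add_zero] at hc
      have := congrFun hc (Fin.last q)
      simpa [HeavyFlat.withAxis] using this
    intro x hx
    cases x with
    | none => exact h1
    | some x => exact h0 x ((hT' x).2 hx)
  · rw [Finset.erase_eq_of_notMem hn] at himg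
    rw [← himg, Finset.sum_image (by simp)] at hc
    have hlin := h (q + 1) hq T' hsub (by
      rwa [← himg, Finset.card_image_of_injective _ (Option.some_injective _)] at hcard)
    rw [linearIndepOn_finset_iff] at hlin
    have := hlin (fun x => c (Option.some x)) hc
    intro x hx
    cases x with
    | none => exact absurd hx hn
    | some x => exact this x ((hT' x).2 hx)

lemma GenericOn.cobd_halfHits {z : β → Fin k → ℝ} {l : List β} (h : GenericOn z {x | x ∈ l})
    {q : ℕ} (hq : q < k) (hlen : l.length = q + 2) :
    hits (fun x => trunc (q + 1) (z x)) l = cobd (halfHits z q) l := by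
  have h1 := HeavyFlat.cobd_hits (HeavyFlat.withAxis z q 1) (none :: l.map Option.some) (by simp [hlen])
    fun T hT hcard => h.withAxis hq T (fun x hx => by simpa using hT _ hx) hcard
  rw [cobd_cons, hits_map, cobd_map, CharTwo.add_eq_zero] at h1
  exact h1

lemma hits_withAxis {z : β → Fin k → ℝ} {q : ℕ} {s : ℝ} (hs : s ≠ 0) {l : List β} (hl : l ≠ [])
    (h0 : hits (fun x => trunc (q + 1) (z x)) l = 0) :
    hits (withAxis z q s) (none :: l.map Option.some) = 1 ↔
      ∃ v ∈ convexHull ℝ ((fun x => trunc (q + 1) (z x)) '' {x | x ∈ l}),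
        (∀ a, a ≠ Fin.last q → v a = 0) ∧ 0 < s * v (Fin.last q) := by
  have h0' : (0 : Fin (q + 1) → ℝ) ∉
      convexHull ℝ ((fun x => trunc (q + 1) (z x)) '' {x | x ∈ l}) := by
    intro h; rw [hits, if_pos h] at h0; exact one_ne_zero h0
  have e : withAxis z q s '' {x | x ∈ none :: l.map Option.some} =
      insert (Pi.single (Fin.last q) (-s)) ((fun x => trunc (q + 1) (z x)) '' {x | x ∈ l}) := by
    ext v
    simp only [Set.mem_image, Set.mem_ofPred_eq, List.mem_cons, List.mem_map, Set.mem_insert_iff]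
    constructor
    · rintro ⟨x, rfl | ⟨y, hy, rfl⟩, rfl⟩
      · exact Or.inl rfl
      · exact Or.inr ⟨y, hy, rfl⟩
    · rintro (rfl | ⟨y, hy, rfl⟩)
      · exact ⟨none, Or.inl rfl, rfl⟩
      · exact ⟨Option.some y, Or.inr ⟨y, hy, rfl⟩, rfl⟩
  have hne : ((fun x => trunc (q + 1) (z x)) '' {x | x ∈ l}).Nonempty := by
    obtain ⟨x, hx⟩ := List.exists_mem_of_ne_nil l hl
    exact ⟨_, x, hx, rfl⟩
  have h1 : hits (withAxis z q s) (none :: l.map Option.some) = 1 ↔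
      0 ∈ convexHull ℝ (withAxis z q s '' {x | x ∈ none :: l.map Option.some}) := by
    exact hits_eq_one_iff
  rw [h1, e, convexHull_insert hne, convexJoin_singleton_left]
  simp only [Set.mem_iUnion, exists_prop]
  refine exists_congr fun v => and_congr_right fun hv => ?_
  constructor
  · rintro ⟨p, r, hp, hr, hpr, hsum⟩
    have hr0 : r ≠ 0 := by
      rintro rfl
      have : p = 1 := by linarith
      have := congrFun hsum (Fin.last q)
      simp [‹p = 1›, hs] at this
    have hp0 : p ≠ 0 := by
      rintro rfl
      have : r = 1 := by linarith
      rw [this] at hsum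
      simp at hsum
      rw [hsum] at hv
      exact h0' hv
    constructor
    · intro a ha
      have := congrFun hsum a
      simpa [Pi.single_eq_of_ne ha, hr0] using this
    · have h3 := congrFun hsum (Fin.last q)
      simp only [Pi.add_apply, Pi.smul_apply, Pi.single_eq_same, smul_eq_mul, Pi.zero_apply] at h3
      have hr' : 0 < r := lt_of_le_of_ne hr hr0.symm
      have hp' : 0 < p := lt_of_le_of_ne hp hp0.symm
      have h4 : r * (s * v (Fin.last q)) = p * s ^ 2 := by linear_combination s * h3
      have : 0 < r * (s * v (Fin.last q)) := by rw [h4]; positivity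
      exact (mul_pos_iff_of_pos_left hr').1 this
  · rintro ⟨h2, h3⟩
    have hs2 : 0 < s ^ 2 := by positivity
    set t := s * v (Fin.last q)
    have ht : 0 < t + s ^ 2 := by positivity
    refine ⟨t / (t + s ^ 2), s ^ 2 / (t + s ^ 2), by positivity, by positivity, by field_simp, ?_⟩
    funext a
    by_cases ha : a = Fin.last q
    · subst ha
      simp only [Pi.add_apply, Pi.smul_apply, Pi.single_eq_same, smul_eq_mul, Pi.zero_apply, t]
      field_simp
      ring
    · simp [Pi.single_eq_of_ne ha, h2 a ha]

lemma hits_trunc {z : β → Fin k → ℝ} {q : ℕ} {l : List β} :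
    hits (fun x => trunc q (z x)) l = 1 ↔
      ∃ v ∈ convexHull ℝ ((fun x => trunc (q + 1) (z x)) '' {x | x ∈ l}),
        ∀ a, a ≠ Fin.last q → v a = 0 := by
  let f : (Fin (q + 1) → ℝ) →ₗ[ℝ] (Fin q → ℝ) := LinearMap.funLeft ℝ ℝ Fin.castSucc
  have e : (fun x => trunc q (z x)) '' {x | x ∈ l} =
      f '' ((fun x => trunc (q + 1) (z x)) '' {x | x ∈ l}) := by
    rw [Set.image_image]
    refine Set.image_congr fun x _ => ?_
    funext a
    simp [f, LinearMap.funLeft_apply, trunc_apply]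
  rw [hits_eq_one_iff, e, ← LinearMap.image_convexHull]
  refine exists_congr fun v => and_congr_right fun _ => ?_
  constructor
  · intro h a ha
    obtain ⟨b, rfl⟩ := Fin.exists_castSucc_eq.2 ha
    exact congrFun h b
  · intro h
    funext b
    exact h _ (Fin.castSucc_lt_last b).ne

/-- Changing the sign of the last coordinate changes the half-axis met. -/
lemma halfHits_add_flip {z z' : β → Fin k → ℝ} {q : ℕ}
    (hz : ∀ x, z' x = flipCoord q (z x)) {l : List β} (hl : l ≠ [])
    (h0 : hits (fun x => trunc (q + 1) (z x)) l = 0) :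
    halfHits z q l + halfHits z' q l = hits (fun x => trunc q (z x)) l := by
  have h1 : halfHits z' q l = hits (withAxis z q (-1)) (none :: l.map Option.some) := by
    rw [halfHits, ← hits_comp_injective (flipCoord q) (flipCoord_injective q)
      (withAxis z q (-1))]
    congr 1
    funext x
    cases x with
    | none =>
      funext a
      simp only [withAxis, flipCoord_apply]
      by_cases ha : a = Fin.last q
      · subst ha; simp
      · have : (a : ℕ) ≠ q := fun h => ha (Fin.ext (by simpa using h))
        simp [this, Pi.single_eq_of_ne ha]
    | some x => simp only [withAxis, hz, trunc_flipCoord]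
  have h2 := hits_withAxis (z := z) (q := q) (s := 1) one_ne_zero hl h0
  have h3 := hits_withAxis (z := z) (q := q) (s := -1) (by norm_num) hl h0
  have h4 := hits_trunc (z := z) (q := q) (l := l)
  rw [h1, halfHits]
  have aux : ∀ a b c : ZMod 2, (c = 1 ↔ (a = 1 ∨ b = 1)) → ¬ (a = 1 ∧ b = 1) → a + b = c := by
    decide
  refine aux _ _ _ ?_ ?_
  · rw [h2, h3, h4]
    constructor
    · rintro ⟨v, hv, hv0⟩
      have hne : v (Fin.last q) ≠ 0 := by
        intro h
        have hv' : v = 0 := by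
          funext a
          by_cases ha : a = Fin.last q
          · rw [ha, h]; rfl
          · exact hv0 a ha
        rw [hv'] at hv
        rw [hits_eq_one_iff.2 hv] at h0
        exact one_ne_zero h0
      rcases lt_or_gt_of_ne hne with h | h
      · exact Or.inr ⟨v, hv, hv0, by linarith⟩
      · exact Or.inl ⟨v, hv, hv0, by linarith⟩
    · rintro (⟨v, hv, hv0, -⟩ | ⟨v, hv, hv0, -⟩) <;> exact ⟨v, hv, hv0⟩
  · rw [h2, h3]
    rintro ⟨⟨v, hv, hv0, hpos⟩, ⟨w, hw, hw0, hneg⟩⟩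
    rw [one_mul] at hpos
    have hneg' : 0 < -w (Fin.last q) := by linarith
    have hsum : 0 < v (Fin.last q) + -w (Fin.last q) := by linarith
    have hmem := (convex_convexHull ℝ _) hv hw
      (a := -w (Fin.last q) / (v (Fin.last q) + -w (Fin.last q)))
      (b := v (Fin.last q) / (v (Fin.last q) + -w (Fin.last q))) (by positivity) (by positivity)
      (by field_simp; ring)
    have hz : (-w (Fin.last q) / (v (Fin.last q) + -w (Fin.last q))) • v +
        (v (Fin.last q) / (v (Fin.last q) + -w (Fin.last q))) • w = 0 := by
      funext a
      by_cases ha : a = Fin.last q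
      · subst ha
        simp only [Pi.add_apply, Pi.smul_apply, smul_eq_mul, Pi.zero_apply]
        field_simp
        ring
      · simp [hv0 a ha, hw0 a ha]
    rw [hz] at hmem
    rw [hits_eq_one_iff.2 hmem] at h0
    exact one_ne_zero h0

lemma halfHits_flip_of_ne {z z' : β → Fin k → ℝ} {q j : ℕ} (hj : j ≠ q)
    (hz : ∀ x, z' x = flipCoord j (z x)) (l : List β) : halfHits z' q l = halfHits z q l := by
  rw [halfHits, halfHits, ← hits_comp_injective (flipCoord j) (flipCoord_injective j)
      (withAxis z q 1)]
  congr 1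
  funext x
  cases x with
  | none =>
    funext a
    simp only [withAxis, flipCoord_apply]
    by_cases ha : a = Fin.last q
    · subst ha; simp [hj.symm]
    · simp [Pi.single_eq_of_ne ha]
  | some x => simp only [withAxis, hz, trunc_flipCoord]

lemma hits_trunc_flip {z z' : β → Fin k → ℝ} {q j : ℕ}
    (hz : ∀ x, z' x = flipCoord j (z x)) (l : List β) :
    hits (fun x => trunc q (z' x)) l = hits (fun x => trunc q (z x)) l := by
  rw [← hits_comp_injective (flipCoord j) (flipCoord_injective j) (fun x => trunc q (z x))]
  simp only [hz, trunc_flipCoord]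

end Tower

/-! ### Generic perturbations -/

section Generic

variable {k : ℕ}

/-- Multiply the coordinates of a vector by signs. -/
def signScale (g : Fin k → SignType) : (Fin k → ℝ) →ₗ[ℝ] (Fin k → ℝ) where
  toFun v a := (g a : ℝ) * v a
  map_add' u v := by funext a; simp [mul_add]
  map_smul' c u := by funext a; simp; ring

lemma signScale_apply (g : Fin k → SignType) (v : Fin k → ℝ) (a : Fin k) :
    signScale g v a = (g a : ℝ) * v a := rfl

lemma signType_mul_self {s : SignType} (hs : s ≠ 0) : ((s : SignType) : ℝ) * s = 1 := by
  cases s <;> simp_all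

lemma signScale_surjective {g : Fin k → SignType} (hg : ∀ a, g a ≠ 0) :
    Function.Surjective (signScale g) := by
  refine Function.RightInverse.surjective (g := signScale g) fun v => ?_
  funext a
  rw [signScale_apply, signScale_apply, ← mul_assoc, signType_mul_self (hg a), one_mul]

lemma trunc_surjective {q : ℕ} (hq : q ≤ k) :
    Function.Surjective (trunc q : (Fin k → ℝ) →ₗ[ℝ] (Fin q → ℝ)) := by
  intro v
  refine ⟨fun a => if h : (a : ℕ) < q then v ⟨a, h⟩ else 0, ?_⟩
  funext a
  have : (a : ℕ) < k := a.2.trans_le hq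
  simp [trunc_apply, this]

lemma exists_near_notMem_submodules {E ι : Type*} [NormedAddCommGroup E] [NormedSpace ℝ E]
    [FiniteDimensional ℝ E] [Finite ι] (S : ι → Submodule ℝ E) (hS : ∀ i, S i ≠ ⊤) (x : E)
    {η : ℝ} (hη : 0 < η) : ∃ v, dist v x < η ∧ ∀ i, v ∉ S i := by
  borelize E
  let μ : MeasureTheory.Measure E := MeasureTheory.Measure.addHaar
  by_contra! h
  have h1 : Metric.ball x η ⊆ ⋃ i, (S i : Set E) := by
    intro v hv
    obtain ⟨i, hi⟩ := h v hv
    exact Set.mem_iUnion.2 ⟨i, hi⟩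
  have h2 : μ (⋃ i, (S i : Set E)) = 0 :=
    MeasureTheory.measure_iUnion_null fun i => MeasureTheory.Measure.addHaar_submodule μ _ (hS i)
  exact (Metric.measure_ball_pos μ x hη).ne' (MeasureTheory.measure_mono_null h1 h2)

/-- A finite family of vectors can be perturbed so that, for all choices of signs, all truncations
are as independent as dimensions allow. -/
lemma exists_generic {γ : Type*} [Finite γ] (a : γ → Fin k → ℝ) {η : ℝ} (hη : 0 < η) :
    ∃ w : γ → Fin k → ℝ, (∀ x, dist (w x) (a x) < η) ∧
      ∀ g : γ → Fin k → SignType, (∀ x i, g x i ≠ 0) → ∀ q ≤ k, ∀ T : Finset γ, T.card ≤ q →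
        LinearIndepOn ℝ (fun x => trunc q (signScale (g x) (w x))) (T : Set γ) := by
  classical
  have := Fintype.ofFinite γ
  suffices H : ∀ B : Finset γ, ∃ w : γ → Fin k → ℝ, (∀ x, dist (w x) (a x) < η) ∧
      ∀ g : γ → Fin k → SignType, (∀ x i, g x i ≠ 0) → ∀ q ≤ k, ∀ T ⊆ B, T.card ≤ q →
        LinearIndepOn ℝ (fun x => trunc q (signScale (g x) (w x))) (T : Set γ) by
    obtain ⟨w, h1, h2⟩ := H Finset.univ
    exact ⟨w, h1, fun g hg q hq T => h2 g hg q hq T (Finset.subset_univ T)⟩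
  intro B
  induction B using Finset.induction_on with
  | empty =>
    refine ⟨a, fun x => by simpa using hη, fun g hg q hq T hT _ => ?_⟩
    rw [Finset.subset_empty.1 hT]
    simp
  | insert b B hb ih =>
    obtain ⟨w, hw, hind⟩ := ih
    let J := {p : (γ → Fin k → SignType) × Fin (k + 1) × Finset γ //
      (∀ x i, p.1 x i ≠ 0) ∧ p.2.2.card < p.2.1}
    let S : J → Submodule ℝ (Fin k → ℝ) := fun p =>
      (Submodule.span ℝ ((fun x => trunc (p.1.2.1 : ℕ) (signScale (p.1.1 x) (w x))) ''
        (p.1.2.2 : Set γ))).comap (trunc (p.1.2.1 : ℕ) ∘ₗ signScale (p.1.1 b))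
    obtain ⟨v, hv, hvS⟩ := exists_near_notMem_submodules S (by
      rintro ⟨⟨g, q, T⟩, hg, hT⟩ htop
      simp only [S] at htop hT hg
      have hsurj : Function.Surjective (trunc (q : ℕ) ∘ₗ signScale (g b)) :=
        (trunc_surjective (Nat.lt_succ_iff.1 q.2)).comp (signScale_surjective (hg b))
      have h1 : Submodule.span ℝ ((fun x => trunc (q : ℕ) (signScale (g x) (w x))) ''
          (T : Set γ)) = ⊤ := by
        rw [eq_top_iff]
        intro y _
        obtain ⟨x, rfl⟩ := hsurj y
        have : x ∈ (⊤ : Submodule ℝ (Fin k → ℝ)) := trivial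
        rw [← htop] at this
        exact this
      have h2 := finrank_span_finset_le_card (R := ℝ)
        (T.image fun x => trunc (q : ℕ) (signScale (g x) (w x)))
      rw [Finset.coe_image, Set.finrank, h1, finrank_top, Module.finrank_fin_fun] at h2
      have := h2.trans Finset.card_image_le
      omega) (a b) hη
    refine ⟨Function.update w b v, fun x => ?_, fun g hg q hq T hT hcard => ?_⟩
    · by_cases hx : x = b
      · subst hx; simpa using hv
      · simpa [hx] using hw x
    have hcongr : ∀ T ⊆ B, Set.EqOn (fun x => trunc q (signScale (g x) (Function.update w b v x)))
        (fun x => trunc q (signScale (g x) (w x))) (T : Set γ) := by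
      intro T hT x hx
      have : x ≠ b := fun h => hb (h ▸ hT hx)
      simp [this]
    by_cases hbT : b ∈ T
    · have hsub : T.erase b ⊆ B := by
        intro x hx
        rw [Finset.mem_erase] at hx
        exact Finset.mem_of_mem_insert_of_ne (hT hx.2) hx.1
      have hcard' := Finset.card_erase_lt_of_mem hbT
      rw [← Finset.insert_erase hbT, Finset.coe_insert, linearIndepOn_insert (by simp)]
      refine ⟨(linearIndepOn_congr (hcongr _ hsub)).2
        (hind g hg q hq _ hsub (by omega)), ?_⟩
      rw [Set.image_congr (hcongr _ hsub)]
      have := hvS ⟨⟨g, ⟨q, by omega⟩, T.erase b⟩, hg, by simp only; omega⟩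
      simpa [S] using this
    · have hsub : T ⊆ B := (Finset.subset_insert_iff_of_notMem hbT).1 hT
      exact (linearIndepOn_congr (hcongr _ hsub)).2 (hind g hg q hq _ hsub hcard)

end Generic

section Rows

variable {k D : ℕ}

/-- The sign of a vector in the lexicographic order. -/
noncomputable def lexSign (r : Fin D → ℝ) : SignType := SignType.sign (toLex r)

lemma lexSign_neg (r : Fin D → ℝ) : lexSign (-r) = -lexSign r := Left.sign_neg (toLex r)

lemma lexSign_ne_zero {r : Fin D → ℝ} (hr : r ≠ 0) : lexSign r ≠ 0 := by
  rw [lexSign, Ne, sign_eq_zero_iff]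
  exact hr

/-- The representative of the orbit of a matrix under sign changes of rows. -/
noncomputable def orbitRep (u : Fin k → Fin D → ℝ) : Fin k → Fin D → ℝ :=
  fun j => (lexSign (u j) : ℝ) • u j

lemma orbitRep_flipRow (j : Fin k) (u : Fin k → Fin D → ℝ) :
    orbitRep (flipRow j u) = orbitRep u := by
  funext a
  by_cases h : a = j
  · subst h; simp [orbitRep, flipRow_self, lexSign_neg, SignType.coe_neg]
  · simp [orbitRep, flipRow_of_ne h]

lemma unitRows_ne_zero {u : Fin k → Fin D → ℝ} (hu : u ∈ unitRows k D) (j : Fin k) : u j ≠ 0 := by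
  intro h
  have := hu j
  simp [h] at this

/-- Orbits under sign changes are spread out. -/
lemma orbitRep_injOn {u v : Fin k → Fin D → ℝ} (hu : u ∈ unitRows k D) (hv : v ∈ unitRows k D)
    (hdist : D * dist u v < 2) (h : orbitRep u = orbitRep v) : u = v := by
  by_contra hne
  obtain ⟨j, hj⟩ : ∃ j, u j ≠ v j := by
    by_contra! H; exact hne (funext H)
  have hrow : v j = -u j := by
    have h1 := congrFun h j
    simp only [orbitRep] at h1
    have hu0 := lexSign_ne_zero (unitRows_ne_zero hu j)
    have hv0 := lexSign_ne_zero (unitRows_ne_zero hv j)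
    revert h1 hu0 hv0
    cases hs : lexSign (u j) <;> cases ht : lexSign (v j) <;> intro h1 hu0 hv0 <;>
      simp_all
  have h2 : (2 : ℝ) ≤ D * dist u v := by
    have h3 : ∀ a, 2 * |u j a| ≤ dist u v := by
      intro a
      have h4 : dist (u j a) (v j a) ≤ dist u v :=
        (dist_le_pi_dist (u j) (v j) a).trans (dist_le_pi_dist u v j)
      rw [hrow, Pi.neg_apply, Real.dist_eq, sub_neg_eq_add, ← two_mul, abs_mul, abs_two] at h4
      exact h4
    calc (2 : ℝ) = 2 * ∑ a, |u j a| := by rw [hu j, mul_one]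
      _ = ∑ a, 2 * |u j a| := by rw [Finset.mul_sum]
      _ ≤ ∑ _a : Fin D, dist u v := Finset.sum_le_sum fun a _ => h3 a
      _ = D * dist u v := by simp
  linarith

/-- The values of the rows of a matrix on a vector. -/
def rowsApply (u : Fin k → Fin D → ℝ) (y : Fin D → ℝ) : Fin k → ℝ := fun j => u j ⬝ᵥ y

/-- Equivariant generic perturbations of the values of matrices on points. -/
lemma exists_equivariant_generic {V : Type*} [Finite V] (pt : V → Fin D → ℝ)
    {U : Set (Fin k → Fin D → ℝ)} (hU : U.Finite) (hUS : U ⊆ unitRows k D) {η : ℝ} (hη : 0 < η) :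
    ∃ z : (Fin k → Fin D → ℝ) × V → Fin k → ℝ,
      (∀ u y, ∀ j : Fin k, z (flipRow j u, y) = flipCoord j (z (u, y))) ∧
      (∀ u ∈ U, ∀ y, dist (z (u, y)) (rowsApply u (pt y)) < η) ∧
      ∀ B : Set ((Fin k → Fin D → ℝ) × V), (∀ p ∈ B, p.1 ∈ U) →
        (∀ p ∈ B, ∀ p' ∈ B, D * dist p.1 p'.1 < 2) → GenericOn z B := by
  classical
  let γ := ↥(orbitRep '' U) × V
  have : Finite γ := @Finite.instProd _ _ (hU.image _).to_subtype _
  obtain ⟨w, hw, hgen⟩ := exists_generic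
    (fun p : γ => rowsApply (p.1 : Fin k → Fin D → ℝ) (pt p.2)) hη
  let W : (Fin k → Fin D → ℝ) → V → Fin k → ℝ := fun u y =>
    if h : u ∈ orbitRep '' U then w (⟨u, h⟩, y) else 0
  refine ⟨fun p => signScale (fun j => lexSign (p.1 j)) (W (orbitRep p.1) p.2), ?_, ?_, ?_⟩
  · intro u y j
    funext a
    simp only [flipCoord_apply, signScale_apply, orbitRep_flipRow]
    by_cases h : a = j
    · subst h; simp [flipRow_self, lexSign_neg, SignType.coe_neg]
    · simp [flipRow_of_ne h, h, Fin.val_inj]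
  · intro u hu y
    have hmem : orbitRep u ∈ orbitRep '' U := ⟨u, hu, rfl⟩
    have h1 := hw (⟨orbitRep u, hmem⟩, y)
    refine lt_of_le_of_lt ?_ h1
    rw [dist_pi_le_iff dist_nonneg]
    intro a
    refine le_trans (le_of_eq ?_) (dist_le_pi_dist _ _ a)
    simp only [signScale_apply, W, dif_pos hmem, Real.dist_eq, rowsApply, orbitRep, smul_dotProduct]
    have h2 := signType_mul_self (lexSign_ne_zero (unitRows_ne_zero (hUS hu) a))
    have h3 : |((lexSign (u a) : SignType) : ℝ)| = 1 := by
      rw [← abs_mul_abs_self] at h2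
      nlinarith [abs_nonneg ((lexSign (u a) : SignType) : ℝ)]
    have h4 : ∀ x y s : ℝ, s * s = 1 → |s| = 1 → |s * x - y| = |x - s • y| := by
      intro x y s hs hs'
      rw [← one_mul |x - s • y|, ← hs', ← abs_mul, smul_eq_mul, mul_sub, ← mul_assoc, hs, one_mul]
    exact h4 _ _ _ h2 h3
  · intro B hB hdist q hq T hT hcard
    have hmem : ∀ p : T, orbitRep p.1.1 ∈ orbitRep '' U := fun p => ⟨_, hB _ (hT p.2), rfl⟩
    let f' : T → γ := fun p => (⟨orbitRep p.1.1, hmem p⟩, p.1.2)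
    have hinj : Function.Injective f' := by
      rintro ⟨⟨u, y⟩, hp⟩ ⟨⟨u', y'⟩, hp'⟩ h
      have hrep : orbitRep u = orbitRep u' := congrArg (fun x : γ => (x.1 : Fin k → Fin D → ℝ)) h
      have := orbitRep_injOn (hUS (hB _ (hT hp))) (hUS (hB _ (hT hp')))
        (hdist _ (hT hp) _ (hT hp')) hrep
      simp only [Subtype.mk.injEq, Prod.mk.injEq]
      exact ⟨this, congrArg (fun x : γ => x.2) h⟩
    let g : γ → Fin k → SignType := fun x j =>
      if h : ∃ p, f' p = x then lexSign (h.choose.1.1 j) else 1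
    have hg : ∀ x i, g x i ≠ 0 := by
      intro x i
      simp only [g]
      split_ifs with h
      · exact lexSign_ne_zero (unitRows_ne_zero (hUS (hB _ (hT h.choose.2))) i)
      · decide
    have hgf : ∀ p : T, g (f' p) = fun j => lexSign (p.1.1 j) := by
      intro p
      funext j
      have h : ∃ p', f' p' = f' p := ⟨p, rfl⟩
      simp only [g, dif_pos h]
      rw [hinj h.choose_spec]
    have h1 := hgen g hg q hq (T.attach.image f') (by
      rw [Finset.card_image_of_injective _ hinj, Finset.card_attach]; exact hcard)
    rw [Finset.coe_image] at h1
    have h2 := h1.comp_of_image hinj.injOn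
    have h3 : LinearIndependent ℝ (fun p : T => trunc q (signScale (g (f' p)) (w (f' p)))) := by
      have h4 : ((T.attach : Finset T) : Set T) = Set.univ := by ext; simp
      rw [h4, linearIndepOn_univ_iff] at h2
      exact h2
    have h5 : (fun p : T => trunc q (signScale (g (f' p)) (w (f' p)))) = fun p : T =>
        trunc q (signScale (fun j => lexSign (p.1.1 j)) (W (orbitRep p.1.1) p.1.2)) := by
      funext p
      rw [hgf]
      simp only [W, f', dif_pos (hmem p)]
    rw [h5] at h3
    exact h3

end Rows

/-! ### The product of two simplices -/

section EilenbergZilber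

variable {α β : Type*}

/-- The chain of all monotone lattice paths in the product of two simplices. -/
noncomputable def ez : List α → List β → Chain (α × β)
  | [], [_] => single [] 1
  | [], [] => 0
  | [], _ :: _ :: _ => 0
  | _ :: _, [] => 0
  | u :: us, y :: ys => cone (u, y) (ez us (y :: ys) + ez (u :: us) ys)
termination_by us ys => us.length + ys.length

lemma ez_nil_right (us : List α) : ez us ([] : List β) = 0 := by
  cases us <;> simp [ez]

lemma ez_cons_cons (u : α) (us : List α) (y : β) (ys : List β) :
    ez (u :: us) (y :: ys) = cone (u, y) (ez us (y :: ys) + ez (u :: us) ys) := by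
  rw [ez]

lemma ez_singleton (us : List α) (y : β) : ez us [y] = single (us.map fun u => (u, y)) 1 := by
  induction us with
  | nil => simp [ez]
  | cons u us ih => rw [ez_cons_cons, ih, ez_nil_right, add_zero, cone_single]; rfl

lemma support_ez (us : List α) (ys : List β) {l : List (α × β)} (hl : l ∈ (ez us ys).support) :
    l.length + 1 = us.length + ys.length ∧ ∀ p ∈ l, p.1 ∈ us ∧ p.2 ∈ ys := by
  induction us, ys using ez.induct generalizing l with
  | case1 y =>
    rw [ez] at hl
    have := Finsupp.support_single_subset hl
    simp_all
  | case2 => simp [ez] at hl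
  | case3 => simp [ez] at hl
  | case4 => simp [ez] at hl
  | case5 u us y ys ih1 ih2 =>
    rw [ez_cons_cons] at hl
    obtain ⟨l', hl', rfl⟩ := support_cone hl
    rcases support_add hl' with h | h
    · obtain ⟨h1, h2⟩ := ih1 h
      refine ⟨by simp at h1 ⊢; omega, fun p hp => ?_⟩
      rcases List.mem_cons.1 hp with rfl | hp
      · simp
      · exact ⟨List.mem_cons_of_mem _ (h2 p hp).1, (h2 p hp).2⟩
    · obtain ⟨h1, h2⟩ := ih2 h
      refine ⟨by simp at h1 ⊢; omega, fun p hp => ?_⟩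
      rcases List.mem_cons.1 hp with rfl | hp
      · simp
      · exact ⟨(h2 p hp).1, List.mem_cons_of_mem _ (h2 p hp).2⟩

lemma ez_map {α' : Type*} (f : α → α') (us : List α) (ys : List β) :
    ez (us.map f) ys = chainMap (Prod.map f id) (ez us ys) := by
  induction us, ys using ez.induct with
  | case1 y => simp [ez, chainMap_single]
  | case2 => simp [ez]
  | case3 => simp [ez]
  | case4 => simp [ez]
  | case5 u us y ys ih1 ih2 =>
    rw [List.map_cons, ez_cons_cons, ez_cons_cons, chainMap_cone, map_add (chainMap _), ← ih1, ← ih2]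
    rfl

/-- The bilinear extension of `ez`. -/
noncomputable def ezChain : Chain α →ₗ[ZMod 2] Chain β →ₗ[ZMod 2] Chain (α × β) :=
  Finsupp.linearCombination (ZMod 2) fun us => Finsupp.linearCombination (ZMod 2) (ez us)

lemma ezChain_single (us : List α) (ys : List β) :
    ezChain (single us 1) (single ys 1) = ez us ys := by
  simp [ezChain]

lemma ezChain_cone_cons (u : α) (c : Chain α) (y : β) (ys : List β) :
    ezChain (cone u c) (single (y :: ys) 1) =
      cone (u, y) (ezChain c (single (y :: ys) 1) + ezChain (cone u c) (single ys 1)) := by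
  have : (ezChain.flip (single (y :: ys) 1)) ∘ₗ cone u =
      cone (u, y) ∘ₗ (ezChain.flip (single (y :: ys) 1) + ezChain.flip (single ys 1) ∘ₗ cone u) := by
    refine chain_hom_ext fun us => ?_
    simp only [LinearMap.comp_apply, LinearMap.add_apply, LinearMap.flip_apply, cone_single,
      ezChain_single, ez_cons_cons]
  exact LinearMap.congr_fun this c

lemma ezChain_cons_cone (u : α) (us : List α) (y : β) (c : Chain β) :
    ezChain (single (u :: us) 1) (cone y c) =
      cone (u, y) (ezChain (single us 1) (cone y c) + ezChain (single (u :: us) 1) c) := by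
  have : (ezChain (single (u :: us) 1)) ∘ₗ cone y =
      cone (u, y) ∘ₗ (ezChain (single us 1) ∘ₗ cone y + ezChain (single (u :: us) 1)) := by
    refine chain_hom_ext fun ys => ?_
    simp only [LinearMap.comp_apply, LinearMap.add_apply, cone_single,
      ezChain_single, ez_cons_cons]
  exact LinearMap.congr_fun this c

lemma ezChain_nil_right (c : Chain α) : ezChain c (single ([] : List β) 1) = 0 := by
  have : ezChain.flip (single ([] : List β) 1) = (0 : Chain α →ₗ[ZMod 2] Chain (α × β)) := by
    refine chain_hom_ext fun us => ?_
    rw [LinearMap.flip_apply, ezChain_single, ez_nil_right, LinearMap.zero_apply]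
  exact LinearMap.congr_fun this c

lemma ezChain_nil_cone_cone (y y' : β) (c : Chain β) :
    ezChain (single ([] : List α) 1) (cone y (cone y' c)) = 0 := by
  have : ezChain (single ([] : List α) 1) ∘ₗ cone y ∘ₗ cone y' = 0 := by
    refine chain_hom_ext fun ys => ?_
    rw [LinearMap.comp_apply, LinearMap.comp_apply, cone_single, cone_single, ezChain_single, ez,
      LinearMap.zero_apply]
  exact LinearMap.congr_fun this c

lemma bd_ez (us : List α) (ys : List β) :
    bd (ez us ys) = ezChain (bdList us) (single ys 1) + ezChain (single us 1) (bdList ys) := by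
  induction us, ys using ez.induct with
  | case1 y =>
    simp [ez, ezChain_single]
  | case2 => simp [ez]
  | case3 y y' ys =>
    simp only [ez, bdList_cons, bdList_nil, map_add, map_zero, LinearMap.zero_apply,
      ezChain_nil_cone_cone, cone_single, ezChain_single]
    cases ys <;> simp [ez, add_self_chain]
  | case4 u us => rw [ez_nil_right, ezChain_nil_right]; simp
  | case5 u us y ys ih1 ih2 =>
    rw [ez_cons_cons, bd_cone]
    simp only [map_add, ih1, ih2, bdList_cons, LinearMap.add_apply, ezChain_cone_cons,
      ezChain_cons_cone, ezChain_single]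
    have h := add_self_chain (cone (u, y) (ez us ys))
    have aux : ∀ A B C G H I J : Chain (α × β), G + G = 0 →
        A + B + (C + (G + H) + (G + I + J)) = A + (C + I) + (B + (H + J)) := by
      intro A B C G H I J hG
      calc A + B + (C + (G + H) + (G + I + J)) = A + (C + I) + (B + (H + J)) + (G + G) := by abel
        _ = _ := by rw [hG, add_zero]
    exact aux _ _ _ _ _ _ _ h

/-- The pairing of a cochain on the product with pairs of simplices. -/
noncomputable def slant (φ : List (α × β) → ZMod 2) (us : List α) (ys : List β) : ZMod 2 :=
  ev φ (ez us ys)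

lemma cobd_slant (φ : List (α × β) → ZMod 2) (us : List α) (ys : List β) :
    cobd (fun us' => slant φ us' ys) us + cobd (slant φ us) ys = ev (cobd φ) (ez us ys) := by
  have h1 : ev (fun us' => slant φ us' ys) = ev φ ∘ₗ ezChain.flip (single ys 1) := by
    refine chain_hom_ext fun us => ?_
    rw [ev_single, LinearMap.comp_apply, LinearMap.flip_apply, ezChain_single, slant]
  have h2 : ev (slant φ us) = ev φ ∘ₗ ezChain (single us 1) := by
    refine chain_hom_ext fun ys => ?_
    rw [ev_single, LinearMap.comp_apply, ezChain_single, slant]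
  rw [← ev_bd, bd_ez, map_add, cobd, cobd, h1, h2]
  rfl

lemma slant_nil_right (φ : List (α × β) → ZMod 2) (us : List α) : slant φ us [] = 0 := by
  rw [slant, ez_nil_right, map_zero]

lemma slant_nil_left (φ : List (α × β) → ZMod 2) {ys : List β} (h : 2 ≤ ys.length) :
    slant φ [] ys = 0 := by
  match ys, h with
  | _ :: _ :: _, _ => rw [slant, ez, map_zero]

lemma slant_singleton (φ : List (α × β) → ZMod 2) (us : List α) (y : β) :
    slant φ us [y] = φ (us.map fun u => (u, y)) := by
  rw [slant, ez_singleton, ev_single]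

lemma slant_map {φ : List (α × β) → ZMod 2} {f : α → α}
    (hφ : ∀ l, φ (l.map (Prod.map f id)) = φ l) (us : List α) (ys : List β) :
    slant φ (us.map f) ys = slant φ us ys := by
  rw [slant, ez_map, ev_chainMap]
  simp only [hφ]
  rfl

lemma exists_of_slant_ne_zero {φ : List (α × β) → ZMod 2} {us : List α} {ys : List β}
    (h : slant φ us ys ≠ 0) : ∃ l : List (α × β), (∀ p ∈ l, p.1 ∈ us ∧ p.2 ∈ ys) ∧ φ l ≠ 0 := by
  by_contra! H
  exact h (ev_eq_zero fun l hl => H l (support_ez us ys hl).2)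

end EilenbergZilber

/-! ### Economical fillings of cochains on coloured simplices -/

section Counting

variable {C : Type*} {n : ℕ}

/-- The number of simplices with vertices of the given colours in the support of a cochain. -/
def cnt : List C → (List (C × Fin n) → ZMod 2) → ℕ
  | [], f => if f [] = 0 then 0 else 1
  | j :: js, f => ∑ x, cnt js fun ys => f ((j, x) :: ys)

lemma cnt_mono {js : List C} {f f' : List (C × Fin n) → ZMod 2}
    (h : ∀ ys : List (C × Fin n), ys.map Prod.fst = js → f ys ≠ 0 → f' ys ≠ 0) :
    cnt js f ≤ cnt js f' := by
  induction js generalizing f f' with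
  | nil =>
    have := h [] rfl
    simp only [cnt]
    split_ifs <;> simp_all
  | cons j js ih =>
    refine Finset.sum_le_sum fun x _ => ih fun ys hys => h _ ?_
    rw [List.map_cons, hys]

lemma cnt_zero (js : List C) : cnt js (fun _ : List (C × Fin n) => (0 : ZMod 2)) = 0 := by
  induction js with
  | nil => simp [cnt]
  | cons j js ih => simp [cnt, ih]

lemma cnt_add_le (js : List C) (f f' : List (C × Fin n) → ZMod 2) :
    cnt js (fun ys => f ys + f' ys) ≤ cnt js f + cnt js f' := by
  induction js generalizing f f' with
  | nil =>
    simp only [cnt]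
    split_ifs <;> simp_all
  | cons j js ih =>
    simp only [cnt]
    rw [← Finset.sum_add_distrib]
    exact Finset.sum_le_sum fun x _ => ih _ _

lemma cnt_sum_le {ι : Type*} (s : Finset ι) (js : List C) (f : ι → List (C × Fin n) → ZMod 2) :
    cnt js (fun ys => ∑ i ∈ s, f i ys) ≤ ∑ i ∈ s, cnt js (f i) := by
  classical
  induction s using Finset.induction_on with
  | empty => simp [cnt_zero]
  | insert a s ha ih =>
    simp only [Finset.sum_insert ha]
    exact (cnt_add_le _ _ _).trans (Nat.add_le_add_left ih _)

lemma exists_mul_cnt_le [NeZero n] (j : C) (js : List C) (f : List (C × Fin n) → ZMod 2) :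
    ∃ x : Fin n, n * cnt js (fun ys => f ((j, x) :: ys)) ≤ cnt (j :: js) f := by
  obtain ⟨x, -, hx⟩ := Finset.exists_min_image (Finset.univ : Finset (Fin n))
    (fun x => cnt js (fun ys => f ((j, x) :: ys))) Finset.univ_nonempty
  refine ⟨x, ?_⟩
  have := Finset.card_nsmul_le_sum Finset.univ (fun x => cnt js (fun ys => f ((j, x) :: ys))) _ hx
  simpa [cnt] using this

lemma cobd_cons_eq {V : Type*} {f : List V → ZMod 2} {x : V} {ys : List V}
    (h : cobd f (x :: ys) = 0) :
    cobd (fun ys => f (x :: ys)) ys = f ys := by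
  rw [cobd_cons] at h
  exact (CharTwo.add_eq_zero.1 h).symm

/-- A one-cocycle is the coboundary of a function with at most half of the points in its support. -/
lemma exists_balanced_filling [NeZero n] (a b : C) (f : List (C × Fin n) → ZMod 2)
    (hf : ∀ ys, ys.length = 3 → cobd f ys = 0) :
    ∃ h : List (C × Fin n) → ZMod 2, (∀ ys, ys.length = 2 → cobd h ys = f ys) ∧
      cnt [a] h + cnt [b] h ≤ n ∧
      cnt [a, b] f + 2 * (cnt [a] h * cnt [b] h) = n * (cnt [a] h + cnt [b] h) := by
  have key : ∀ h : List (C × Fin n) → ZMod 2, (∀ ys, ys.length = 2 → cobd h ys = f ys) →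
      cnt [a, b] f + 2 * (cnt [a] h * cnt [b] h) = n * (cnt [a] h + cnt [b] h) := by
    intro h hh
    simp only [cnt]
    have h1 : ∀ x y, f [(a, x), (b, y)] = h [(b, y)] + h [(a, x)] := by
      intro x y
      rw [← hh _ rfl]
      simp [cobd_eq_sum, Fin.sum_univ_succ]
    simp only [h1]
    rw [Finset.sum_mul_sum, Finset.mul_sum, ← Finset.sum_add_distrib]
    have h2 : ∀ u v : ZMod 2, (if v + u = 0 then 0 else 1) + 2 * ((if u = 0 then 0 else 1) *
        (if v = 0 then 0 else 1)) = (if u = 0 then 0 else 1) + (if v = 0 then 0 else 1) := by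
      decide
    simp_rw [Finset.mul_sum, ← Finset.sum_add_distrib, h2]
    simp only [Finset.sum_add_distrib, Finset.sum_const, Finset.card_univ, Fintype.card_fin,
      smul_eq_mul, ← Finset.mul_sum]
    ring
  let h₀ : List (C × Fin n) → ZMod 2 := fun ys => f ((a, 0) :: ys)
  have h1 : ∀ ys, ys.length = 2 → cobd h₀ ys = f ys := fun ys hys =>
    cobd_cons_eq (hf _ (by simp [hys]))
  have h2 : ∀ ys : List (C × Fin n), ys.length = 2 → cobd (fun ys => h₀ ys + 1) ys = f ys := by
    intro ys hys
    rw [cobd_add, h1 ys hys, cobd_one_of_two hys, add_zero]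
  have h3 : ∀ c : C, cnt [c] h₀ + cnt [c] (fun ys => h₀ ys + 1) = n := by
    intro c
    simp only [cnt]
    rw [← Finset.sum_add_distrib]
    have h4 : ∀ u : ZMod 2, (if u = 0 then 0 else 1) + (if u + 1 = 0 then 0 else 1) = 1 := by decide
    simp [h4]
  by_cases hle : cnt [a] h₀ + cnt [b] h₀ ≤ n
  · exact ⟨h₀, h1, hle, key h₀ h1⟩
  · refine ⟨fun ys => h₀ ys + 1, h2, ?_, key _ h2⟩
    have := h3 a
    have := h3 b
    omega

end Counting

lemma filling_numerics {k : ℕ} (hk : 1 ≤ k) {n B ε p q a : ℝ} (hn : 0 < n) (hB : 0 ≤ B)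
    (hp : 0 ≤ p) (hq : 0 ≤ q) (hpq : p + q ≤ n) (hcut : n * (p + q) - 2 * (p * q) ≤ a * n ^ 2)
    (ha : a ≤ (k.factorial : ℝ) *
      (2 * k / ((Nat.factorial (k + 1) : ℝ) * (k + 1)) - ε + k * (B / n)))
    (hlarge : B * (k + 2) < n * ε) : (k + 1) * (p + q) + 2 * B < 2 * n := by
  by_contra! hcon
  have hk' : (1 : ℝ) ≤ k := by exact_mod_cast hk
  have hfac : (1 : ℝ) ≤ k.factorial := by exact_mod_cast Nat.factorial_pos k
  set f : ℝ := ((k.factorial : ℕ) : ℝ) with hf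
  set S := (k + 1) * (p + q) with hS
  have h1 : a * n ^ 2 * (k + 1) ^ 2 ≤
      2 * k * n ^ 2 - (k + 1) ^ 2 * f * n * (ε * n - k * B) := by
    have : f * (2 * k / ((Nat.factorial (k + 1) : ℝ) * (k + 1)) - ε + k * (B / n)) *
        n ^ 2 * (k + 1) ^ 2 = 2 * k * n ^ 2 - (k + 1) ^ 2 * f * n * (ε * n - k * B) := by
      rw [Nat.factorial_succ]
      push_cast
      rw [← hf]
      field_simp
      ring
    rw [← this]
    gcongr
  have h2 : 2 * n * (k + 1) * S - S ^ 2 ≤ 2 * (a * n ^ 2 * (k + 1) ^ 2) := by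
    have h3 : 4 * (p * q) ≤ (p + q) ^ 2 := by nlinarith [sq_nonneg (p - q)]
    have h4 : 2 * n * (p + q) - (p + q) ^ 2 ≤ 2 * (a * n ^ 2) := by linarith
    have h5 := mul_le_mul_of_nonneg_right h4 (by positivity : (0 : ℝ) ≤ (k + 1) ^ 2)
    rw [hS]
    linarith
  have hSle : S ≤ (k + 1) * n := by rw [hS]; gcongr
  have hS0 : 0 ≤ S := by rw [hS]; positivity
  have h6 : -(2 * B) * (2 * n * k) ≤ (S - 2 * n) * (2 * n * k - S) := by
    have h7 : 0 ≤ 2 * n * k - S := by nlinarith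
    nlinarith [mul_nonneg (by linarith : (0 : ℝ) ≤ S - 2 * n + 2 * B) h7, mul_nonneg hB hS0]
  have h8 : (k + 1) ^ 2 * f * n * (ε * n - k * B) ≤ 2 * B * k * n := by nlinarith
  have h9 : 2 * B < ε * n - k * B := by nlinarith
  have h10 : (k + 1) ^ 2 * f * (ε * n - k * B) ≤ 2 * B * k := by
    have : ((k + 1) ^ 2 * f * (ε * n - k * B)) * n ≤ (2 * B * k) * n := by linarith
    exact le_of_mul_le_mul_right this hn
  have h11 : (k : ℝ) ≤ (k + 1) ^ 2 * f := by
    nlinarith [mul_nonneg (sq_nonneg ((k : ℝ) + 1)) (by linarith : (0:ℝ) ≤ f - 1)]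
  have h12 : k * (ε * n - k * B) ≤ (k + 1) ^ 2 * f * (ε * n - k * B) :=
    mul_le_mul_of_nonneg_right h11 (by linarith)
  nlinarith

section Filling

variable {α : Type*} {k n : ℕ}

/-- The colours from `j` on. -/
def colorsFrom (k j : ℕ) : List (Fin (k + 1)) := (List.finRange (k + 1)).drop j

lemma colorsFrom_eq_cons {j : ℕ} (hj : j < k + 1) :
    colorsFrom k j = ⟨j, hj⟩ :: colorsFrom k (j + 1) := by
  rw [colorsFrom, List.drop_eq_getElem_cons (by simpa using hj)]
  simp [colorsFrom]

lemma length_colorsFrom (j : ℕ) : (colorsFrom k j).length = k + 1 - j := by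
  simp [colorsFrom]

lemma colorsFrom_last : colorsFrom k (k + 1) = [] := by
  rw [← List.length_eq_zero_iff, length_colorsFrom, Nat.sub_self]

/-- Degree `j` of the filling process: a cochain of colour depth `j` is filled by a cochain whose
support is small. -/
lemma exists_fill [NeZero n] (j : ℕ) (f : List (Fin (k + 1) × Fin n) → ZMod 2) :
    ∃ h : List (Fin (k + 1) × Fin n) → ZMod 2,
      (∀ ys, ys.length = k + 2 - j → cobd f ys = 0) →
        (j < k → ∀ ys, ys.length = k + 1 - j → cobd h ys = f ys) ∧
        (j + 1 < k → n * cnt (colorsFrom k (j + 1)) h ≤ cnt (colorsFrom k j) f) ∧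
        (∀ hjk : j + 1 = k, cnt [⟨j, by omega⟩] h + cnt [⟨j + 1, by omega⟩] h ≤ n ∧
          cnt (colorsFrom k j) f + 2 * (cnt [⟨j, by omega⟩] h * cnt [⟨j + 1, by omega⟩] h) =
            n * (cnt [⟨j, by omega⟩] h + cnt [⟨j + 1, by omega⟩] h)) := by
  by_cases hf : ∀ ys, ys.length = k + 2 - j → cobd f ys = 0
  swap
  · exact ⟨f, fun h => absurd h hf⟩
  by_cases hjk : j + 1 = k
  · obtain ⟨h, h1, h2, h3⟩ := exists_balanced_filling (⟨j, by omega⟩ : Fin (k + 1))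
      ⟨j + 1, by omega⟩ f fun ys hys => hf ys (by omega)
    refine ⟨h, fun _ => ⟨fun _ ys hys => h1 ys (by omega), fun h => by omega, fun _ => ⟨h2, ?_⟩⟩⟩
    rw [← h3, colorsFrom_eq_cons (by omega : j < k + 1),
      colorsFrom_eq_cons (by omega : j + 1 < k + 1)]
    have : colorsFrom k (j + 1 + 1) = [] := by rw [hjk, colorsFrom_last]
    rw [this]
  · by_cases hj : j < k
    · obtain ⟨x, hx⟩ := exists_mul_cnt_le (⟨j, by omega⟩ : Fin (k + 1)) (colorsFrom k (j + 1)) f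
      refine ⟨fun ys => f ((⟨j, by omega⟩, x) :: ys), fun _ => ⟨fun _ ys hys => ?_, fun _ => ?_,
        fun h => absurd h hjk⟩⟩
      · exact cobd_cons_eq (hf _ (by simp only [List.length_cons]; omega))
      · rw [colorsFrom_eq_cons (by omega : j < k + 1)]
        exact hx
    · exact ⟨f, fun _ => ⟨fun h => absurd h hj, fun h => by omega, fun h => absurd h hjk⟩⟩

variable [NeZero n]

/-- A choice of fillings. -/
noncomputable def fill (j : ℕ) (f : List (Fin (k + 1) × Fin n) → ZMod 2) :
    List (Fin (k + 1) × Fin n) → ZMod 2 :=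
  (exists_fill j f).choose

/-- The successive fillings of the slants of a cochain; the boundary of a simplex with `j + 1`
vertices is filled at stage `j + 1`. -/
noncomputable def filling (F : List α → List (Fin (k + 1) × Fin n) → ZMod 2) :
    ℕ → List α → List (Fin (k + 1) × Fin n) → ZMod 2
  | 0, _ => 0
  | j + 1, us => fill j fun ys => F us ys + cobd (fun us' => filling F j us' ys) us

/-- The slant of a cochain corrected by the fillings on the boundary. -/
noncomputable def corrected (F : List α → List (Fin (k + 1) × Fin n) → ZMod 2) (j : ℕ)
    (us : List α) (ys : List (Fin (k + 1) × Fin n)) : ZMod 2 :=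
  F us ys + cobd (fun us' => filling F j us' ys) us

variable {F : List α → List (Fin (k + 1) × Fin n) → ZMod 2}

lemma filling_succ (j : ℕ) (us : List α) : filling F (j + 1) us = fill j (corrected F j us) := rfl

lemma filling_map {g : α → α} (hg : ∀ us ys, F (us.map g) ys = F us ys) (j : ℕ) (us : List α) :
    filling F j (us.map g) = filling F j us := by
  induction j generalizing us with
  | zero => rfl
  | succ j ih =>
    rw [filling_succ, filling_succ]
    congr 1
    funext ys
    simp only [corrected, hg, cobd_map, ih]

lemma cobd_cobd_comm {V : Type*} (f : List α → List V → ZMod 2) (us : List α) (ys : List V) :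
    cobd (fun ys' => cobd (fun us' => f us' ys') us) ys =
      cobd (fun us' => cobd (f us') ys) us := by
  simp only [cobd_eq_sum]
  rw [Finset.sum_comm]

lemma cobd_corrected {K : Set (List α)} (hK : ∀ l ∈ K, ∀ l' : List α, l'.Sublist l → l' ∈ K)
    (hF0 : ∀ ys, ys.length = k + 2 → F [] ys = 0)
    (hF : ∀ us ∈ K, ∀ ys, us.length + ys.length = k + 3 →
      cobd (fun us' => F us' ys) us + cobd (F us) ys = 0)
    (j : ℕ) (us : List α)
    (hus : us ∈ K) (hlen : us.length = j + 1) (hj : j ≤ k) (ys : List (Fin (k + 1) × Fin n))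
    (hys : ys.length = k + 2 - j) :
    cobd (corrected F j us) ys = 0 := by
  induction j generalizing us ys with
  | zero =>
    obtain ⟨u, rfl⟩ := List.length_eq_one_iff.1 hlen
    have h1 := hF [u] hus ys (by simp [hys]; omega)
    have h2 : cobd (fun us' => F us' ys) [u] = 0 := by
      rw [cobd_eq_sum]; simp [hF0 ys hys]
    have h3 : corrected F 0 [u] = F [u] := by
      funext ys'
      simp [corrected, filling, cobd_eq_sum]
    rw [h3]
    rwa [h2, zero_add] at h1
  | succ j ih =>
    have h1 := hF us hus ys (by omega)
    have h2 : cobd (corrected F (j + 1) us) ys = cobd (F us) ys +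
        cobd (fun us' => cobd (filling F (j + 1) us') ys) us := by
      rw [← cobd_cobd_comm, ← cobd_add]
      rfl
    have h3 : cobd (fun us' => cobd (filling F (j + 1) us') ys) us =
        cobd (fun us' => F us' ys + cobd (fun us'' => filling F j us'' ys) us') us := by
      refine cobd_congr fun us' hus' hlen' => ?_
      have hmem := hK us hus us' hus'
      replace hlen' : us'.length = j + 1 := by omega
      have := (exists_fill j (corrected F j us')).choose_spec
        fun ys hys => ih us' hmem hlen' (by omega) ys hys
      exact this.1 (by omega) ys (by omega)
    rw [h2, h3, cobd_add, cobd_cobd, add_zero, add_comm]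
    exact h1

lemma cnt_corrected_le_sum (js : List (Fin (k + 1))) (j : ℕ) (us : List α) :
    (cnt js (corrected F j us) : ℝ) ≤ cnt js (F us) +
      ∑ i : Fin us.length, (cnt js (filling F j (us.eraseIdx i)) : ℝ) := by
  have h : cnt js (corrected F j us) ≤ cnt js (F us) +
      ∑ i : Fin us.length, cnt js (filling F j (us.eraseIdx i)) := by
    refine (cnt_add_le js _ _).trans (Nat.add_le_add_left ?_ _)
    simp only [cobd_eq_sum]
    exact cnt_sum_le _ _ _
  exact_mod_cast h

lemma cnt_corrected_le {R : Set (List α)} (hR : ∀ l ∈ R, ∀ l' : List α, l'.Sublist l → l' ∈ R)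
    {js : List (Fin (k + 1))} {j : ℕ} {b c : ℝ} {us : List α} (hus : us ∈ R)
    (hlen : us.length = j + 1) (h1 : (cnt js (F us) : ℝ) ≤ b)
    (h2 : ∀ us' ∈ R, us'.length = j → (cnt js (filling F j us') : ℝ) ≤ c) :
    (cnt js (corrected F j us) : ℝ) ≤ b + (j + 1) * c := by
  have h4 : (∑ i : Fin us.length, (cnt js (filling F j (us.eraseIdx i)) : ℝ)) ≤
      ∑ _i : Fin us.length, c := by
    refine Finset.sum_le_sum fun i _ => h2 _ (hR us hus _ (List.eraseIdx_sublist _ _)) ?_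
    rw [List.length_eraseIdx_of_lt i.2]
    omega
  have h5 := cnt_corrected_le_sum (F := F) js j us
  simp only [Finset.sum_const, Finset.card_univ, Fintype.card_fin, nsmul_eq_mul, hlen] at h4
  push_cast at h4
  linarith

/-- If all slants over a region have small supports, then the last corrected slant
vanishes there. -/
lemma corrected_eq_zero {K : Set (List α)} (hK : ∀ l ∈ K, ∀ l' : List α, l'.Sublist l → l' ∈ K)
    (hF0 : ∀ ys, ys.length = k + 2 → F [] ys = 0)
    (hF : ∀ us ∈ K, ∀ ys, us.length + ys.length = k + 3 →
      cobd (fun us' => F us' ys) us + cobd (F us) ys = 0)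
    (hk : 1 ≤ k) {R : Set (List α)} (hRK : R ⊆ K)
    (hR : ∀ l ∈ R, ∀ l' : List α, l'.Sublist l → l' ∈ R) {B ε : ℝ} (hB : 0 ≤ B)
    (hlarge : B * (k + 2) < n * ε)
    (hzero : ∀ us ∈ R, us.length = 1 → (cnt (colorsFrom k 0) (F us) : ℝ) ≤
      (2 * k / ((Nat.factorial (k + 1) : ℝ) * (k + 1)) - ε) * n ^ (k + 1))
    (hpos : ∀ us ∈ R, ∀ js : List (Fin (k + 1)), 2 ≤ us.length → us.length + js.length = k + 2 →
      (cnt js (F us) : ℝ) ≤ B * n ^ (js.length - 1))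
    (us : List α) (hus : us ∈ R) (hlen : us.length = k + 1) (x : Fin (k + 1) × Fin n) :
    corrected F k us [x] = 0 := by
  have hn : (0 : ℝ) < n := by exact_mod_cast Nat.pos_of_ne_zero (NeZero.ne n)
  set c : ℝ := 2 * k / ((Nat.factorial (k + 1) : ℝ) * (k + 1)) - ε with hc
  let a : ℕ → ℝ := fun j => Nat.rec c (fun j a => B / n + (j + 2) * a) j
  have ha0 : a 0 = c := rfl
  have hasucc : ∀ j, a (j + 1) = B / n + (j + 2) * a j := fun j => rfl
  have hBn : 0 ≤ B / n := by positivity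
  have ha : ∀ j, a j ≤ ((j + 1).factorial : ℝ) * (c + j * (B / n)) := by
    intro j
    induction j with
    | zero => simp [ha0]
    | succ j ih =>
      rw [hasucc, Nat.factorial_succ (j + 1)]
      push_cast
      have hf : (1 : ℝ) ≤ ((j + 1 + 1) * ((j + 1).factorial : ℝ)) := by
        exact_mod_cast Nat.factorial_pos (j + 1 + 1)
      have h1 : B / n ≤ ((j + 1 + 1) * ((j + 1).factorial : ℝ)) * (B / n) := by nlinarith
      have h2 : ((j : ℝ) + 2) * a j ≤ (j + 2) * (((j + 1).factorial : ℝ) * (c + j * (B / n))) := by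
        gcongr
      linarith
  have hspec := fun (j : ℕ) (us : List α) (hus : us ∈ R) (hlen : us.length = j + 1) (hj : j ≤ k) =>
    (exists_fill j (corrected F j us)).choose_spec
      fun ys hys => cobd_corrected hK hF0 hF j us (hRK hus) hlen hj ys hys
  have hA : ∀ j < k, ∀ us ∈ R, us.length = j + 1 →
      (cnt (colorsFrom k j) (corrected F j us) : ℝ) ≤ a j * n ^ (k + 1 - j) := by
    intro j
    induction j with
    | zero =>
      intro _ us hus hlen
      have h3 : corrected F 0 us = F us := by
        funext ys'
        simp [corrected, filling, cobd_eq_sum]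
      rw [h3, ha0]
      exact hzero us hus hlen
    | succ j ih =>
      intro hj us hus hlen
      have h1 := hpos us hus (colorsFrom k (j + 1)) (by omega)
        (by rw [length_colorsFrom]; omega)
      rw [length_colorsFrom] at h1
      have h2 := cnt_corrected_le hR (c := a j * n ^ (k - j)) hus hlen h1 (fun us' hus' hlen' => by
        have h3 := (hspec j us' hus' hlen' (by omega)).2.1 hj
        have h4 := ih (by omega) us' hus' hlen'
        have h5 : (n : ℝ) * cnt (colorsFrom k (j + 1)) (filling F (j + 1) us') ≤
            cnt (colorsFrom k j) (corrected F j us') := by exact_mod_cast h3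
        have h6 : (n : ℝ) ^ (k + 1 - j) = n * n ^ (k - j) := by
          rw [← pow_succ']; congr 1; omega
        rw [h6] at h4
        have h7 : (n : ℝ) * cnt (colorsFrom k (j + 1)) (filling F (j + 1) us') ≤
            n * (a j * n ^ (k - j)) := by linarith
        exact le_of_mul_le_mul_left h7 hn)
      refine h2.trans (le_of_eq ?_)
      have h8 : k + 1 - (j + 1) = (k - (j + 1)) + 1 := by omega
      have h9 : k - j = (k - (j + 1)) + 1 := by omega
      rw [hasucc, h8, h9, Nat.add_sub_cancel, pow_succ]
      push_cast
      field_simp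
      ring
  obtain ⟨m, rfl⟩ : ∃ m, k = m + 1 := ⟨k - 1, by omega⟩
  have hG : ∀ us ∈ R, us.length = m + 1 →
      (m + 1 + 1) * ((cnt [⟨m, by omega⟩] (filling F (m + 1) us) : ℝ) +
        cnt [⟨m + 1, by omega⟩] (filling F (m + 1) us)) + 2 * B < 2 * n := by
    intro us hus hlen
    obtain ⟨h1, h2⟩ := (hspec m us hus hlen (by omega)).2.2 rfl
    have h3 := hA m (by omega) us hus hlen
    set p := cnt [⟨m, by omega⟩] (filling F (m + 1) us)
    set q := cnt [⟨m + 1, by omega⟩] (filling F (m + 1) us)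
    have h1' : (p : ℝ) + q ≤ n := by exact_mod_cast h1
    have h2' : (cnt (colorsFrom (m + 1) m) (corrected F m us) : ℝ) + 2 * (p * q) = n * (p + q) := by
      exact_mod_cast h2
    have h4 := filling_numerics hk hn hB (Nat.cast_nonneg p) (Nat.cast_nonneg q) h1' (a := a m) (ε := ε)
      (by
        have h5 : m + 1 + 1 - m = 2 := by omega
        rw [h5] at h3
        linarith) (by
        refine (ha m).trans ?_
        have : c + (m : ℝ) * (B / n) ≤ c + ((m + 1 : ℕ) : ℝ) * (B / n) := by
          push_cast; nlinarith
        gcongr) hlarge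
    push_cast at h4
    exact h4
  have hconst : ∀ y, corrected F (m + 1) us [y] = corrected F (m + 1) us [x] := by
    intro y
    have := cobd_corrected hK hF0 hF (m + 1) us (hRK hus) hlen le_rfl [x, y] (by simp)
    rw [cobd_eq_sum] at this
    simp [Fin.sum_univ_succ] at this
    exact CharTwo.add_eq_zero.1 this
  by_contra hne
  have hfull : ∀ col, cnt [col] (corrected F (m + 1) us) = n := by
    intro col
    simp [cnt, hconst, hne]
  have hF1 : ∀ col, (cnt [col] (F us) : ℝ) ≤ B := by
    intro col
    have := hpos us hus [col] (by omega) (by simp [hlen])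
    simpa using this
  have h1 := cnt_corrected_le_sum (F := F) [⟨m, by omega⟩] (m + 1) us
  have h2 := cnt_corrected_le_sum (F := F) [⟨m + 1, by omega⟩] (m + 1) us
  rw [hfull] at h1 h2
  have h3 : ∑ i : Fin us.length, (m + 1 + 1 : ℝ) *
      ((cnt [⟨m, by omega⟩] (filling F (m + 1) (us.eraseIdx i)) : ℝ) +
        cnt [⟨m + 1, by omega⟩] (filling F (m + 1) (us.eraseIdx i))) <
      ∑ _i : Fin us.length, (2 * n - 2 * B : ℝ) := by
    have : Nonempty (Fin us.length) := ⟨⟨0, by omega⟩⟩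
    refine Finset.sum_lt_sum_of_nonempty Finset.univ_nonempty fun i _ => ?_
    have := hG _ (hR us hus _ (List.eraseIdx_sublist us i)) (by
      rw [List.length_eraseIdx_of_lt i.2]; omega)
    linarith
  rw [← Finset.mul_sum, Finset.sum_add_distrib] at h3
  simp only [Finset.sum_const, Finset.card_univ, Fintype.card_fin, nsmul_eq_mul] at h3
  have h4 : ((us.length : ℕ) : ℝ) = m + 1 + 1 := by rw [hlen]; push_cast; ring
  rw [h4] at h3
  have h5 := lt_of_mul_lt_mul_left h3 (by positivity)
  have := hF1 ⟨m, by omega⟩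
  have := hF1 ⟨m + 1, by omega⟩
  linarith

end Filling

/-! ### Counting dependent coloured tuples -/

section Dependent

variable {C E : Type*} [AddCommGroup E] [Module ℝ E] {n : ℕ}

/-- Some vector of the list lies in the span of its predecessors and a given subspace. -/
def SeqDep {V : Type*} (w : V → E) : Submodule ℝ E → List V → Prop
  | _, [] => False
  | W, y :: ys => w y ∈ W ∨ SeqDep w (W ⊔ Submodule.span ℝ {w y}) ys

lemma notMem_of_not_seqDep {V : Type*} {w : V → E} {W : Submodule ℝ E} {ys : List V}
    (h : ¬ SeqDep w W ys) : ∀ v ∈ convexHull ℝ (w '' {y | y ∈ ys}), v ∉ W := by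
  induction ys generalizing W with
  | nil => simp
  | cons y ys ih =>
    simp only [SeqDep, not_or] at h
    have e : w '' {x | x ∈ y :: ys} = insert (w y) (w '' {x | x ∈ ys}) := by
      ext v; simp [eq_comm]
    intro v hv hvW
    rw [e] at hv
    rcases Set.eq_empty_or_nonempty (w '' {x | x ∈ ys}) with h0 | hne
    · rw [h0] at hv
      simp at hv
      exact h.1 (hv ▸ hvW)
    · rw [convexHull_insert hne, convexJoin_singleton_left] at hv
      simp only [Set.mem_iUnion, exists_prop] at hv
      obtain ⟨s, hs, p, q, hp, hq, hpq, rfl⟩ := hv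
      by_cases hq0 : q = 0
      · subst hq0
        rw [add_zero] at hpq
        subst hpq
        simp at hvW
        exact h.1 hvW
      · refine ih h.2 s hs ?_
        have h1 : s = q⁻¹ • (p • w y + q • s) + (-(q⁻¹ * p)) • w y := by
          rw [smul_add, smul_smul, smul_smul, inv_mul_cancel₀ hq0, one_smul]
          module
        rw [h1]
        exact Submodule.add_mem_sup (W.smul_mem _ hvW)
          (Submodule.smul_mem _ _ (Submodule.mem_span_singleton_self _))

lemma cnt_le_pow (js : List C) (f : List (C × Fin n) → ZMod 2) : cnt js f ≤ n ^ js.length := by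
  induction js generalizing f with
  | nil => simp only [cnt]; split_ifs <;> simp
  | cons j js ih =>
    calc cnt (j :: js) f ≤ ∑ _x : Fin n, n ^ js.length := Finset.sum_le_sum fun x _ => ih _
      _ = n ^ (j :: js).length := by simp [pow_succ']

open Classical in
/-- If every proper subspace contains few points of each colour, then few coloured tuples are
dependent. -/
lemma cnt_seqDep_le [FiniteDimensional ℝ E] (w : C × Fin n → E) (N : ℕ)
    (hw : ∀ W : Submodule ℝ E, W ≠ ⊤ → ∀ c : C,
      (Finset.univ.filter fun x : Fin n => w (c, x) ∈ W).card ≤ N) (js : List C)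
    (W : Submodule ℝ E) (hW : Module.finrank ℝ W + js.length ≤ Module.finrank ℝ E) :
    cnt js (fun ys => if SeqDep w W ys then 1 else 0) ≤ js.length * (N * n ^ (js.length - 1)) := by
  induction js generalizing W with
  | nil => simp [cnt, SeqDep]
  | cons j js ih =>
    simp only [List.length_cons] at hW
    have h1 : ∀ x : Fin n, cnt js (fun ys => if SeqDep w W ((j, x) :: ys) then 1 else 0) ≤
        (if w (j, x) ∈ W then n ^ js.length else 0) + js.length * (N * n ^ (js.length - 1)) := by
      intro x
      by_cases hx : w (j, x) ∈ W
      · rw [if_pos hx]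
        exact (cnt_le_pow _ _).trans (Nat.le_add_right _ _)
      · rw [if_neg hx, zero_add]
        simp only [SeqDep, hx, false_or]
        refine ih _ ?_
        have h2 := Submodule.finrank_add_le_finrank_add_finrank W (Submodule.span ℝ {w (j, x)})
        have h3 : Module.finrank ℝ (Submodule.span ℝ {w (j, x)}) ≤ 1 := by
          simpa using finrank_span_le_card (R := ℝ) {w (j, x)}
        omega
    have hWtop : W ≠ ⊤ := by
      rintro rfl
      rw [finrank_top] at hW
      omega
    calc cnt (j :: js) (fun ys => if SeqDep w W ys then 1 else 0)
        ≤ ∑ x : Fin n, ((if w (j, x) ∈ W then n ^ js.length else 0) +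
            js.length * (N * n ^ (js.length - 1))) := Finset.sum_le_sum fun x _ => h1 x
      _ = (Finset.univ.filter fun x : Fin n => w (j, x) ∈ W).card * n ^ js.length +
            js.length * (N * (n * n ^ (js.length - 1))) := by
          rw [Finset.sum_add_distrib, ← Finset.sum_filter, Finset.sum_const, Finset.sum_const]
          simp only [Finset.card_univ, Fintype.card_fin, smul_eq_mul]
          ring
      _ ≤ N * n ^ js.length + js.length * (N * n ^ js.length) := by
          refine Nat.add_le_add (Nat.mul_le_mul_right _ (hw W hWtop j)) ?_
          cases js with
          | nil => simp
          | cons i js => simp [pow_succ']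
      _ = _ := by simp only [List.length_cons, Nat.add_sub_cancel]; ring

lemma cnt_hits_le [FiniteDimensional ℝ E] (w : C × Fin n → E) (N : ℕ)
    (hw : ∀ W : Submodule ℝ E, W ≠ ⊤ → ∀ c : C, {x : Fin n | w (c, x) ∈ W}.ncard ≤ N)
    (js : List C) (hjs : js.length ≤ Module.finrank ℝ E) :
    cnt js (hits w) ≤ js.length * (N * n ^ (js.length - 1)) := by
  classical
  refine le_trans (cnt_mono fun ys _ h => ?_) (cnt_seqDep_le w N (fun W hW c => ?_) js ⊥ (by simpa))
  · have : SeqDep w ⊥ ys := by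
      by_contra hnot
      refine h ?_
      rw [hits, if_neg]
      intro h0
      exact notMem_of_not_seqDep hnot 0 h0 (Submodule.zero_mem _)
    simp [this]
  · have := hw W hW c
    rwa [Set.ncard_eq_toFinset_card', Set.toFinset_ofPred] at this

end Dependent

/-! ### Euler cochains of matrices -/

section EulerCochain

variable {k D : ℕ} {V : Type*}

lemma halfHits_map {β γ : Type*} (z : γ → Fin k → ℝ) (q : ℕ) (f : β → γ) (l : List β) :
    halfHits z q (l.map f) = halfHits (fun x => z (f x)) q l := by
  have h : Option.none :: (l.map f).map Option.some =
      (Option.none :: l.map Option.some).map (Option.map f) := by simp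
  rw [halfHits, h, hits_map, halfHits]
  congr 1
  funext x
  cases x <;> rfl

/-- The equivariance of a perturbation of the values of matrices on points. -/
def RowEquivariant (z : (Fin k → Fin D → ℝ) × V → Fin k → ℝ) : Prop :=
  ∀ u y, ∀ j : Fin k, z (flipRow j u, y) = flipCoord j (z (u, y))

variable {z : (Fin k → Fin D → ℝ) × V → Fin k → ℝ}

lemma RowEquivariant.hits_map (hz : RowEquivariant z) (q : ℕ) (j : Fin k)
    (l : List ((Fin k → Fin D → ℝ) × V)) :
    hits (fun p => trunc q (z p)) (l.map (Prod.map (flipRow j) id)) =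
      hits (fun p => trunc q (z p)) l := by
  rw [HeavyFlat.hits_map]
  exact hits_trunc_flip (z := z) (fun p => hz p.1 p.2 j) l

lemma map_map_pair (g : (Fin k → Fin D → ℝ) → Fin k → Fin D → ℝ) (x : V)
    (us : List (Fin k → Fin D → ℝ)) :
    (us.map g).map (fun u => (u, x)) = (us.map fun u => (u, x)).map (Prod.map g id) := by
  simp

variable {n : ℕ} {z : (Fin k → Fin D → ℝ) × (Fin (k + 1) × Fin n) → Fin k → ℝ}

lemma RowEquivariant.slant_relation {S : System (Fin k → Fin D → ℝ) k}
    (hgen : ∀ us ∈ S.K, GenericOn z {p | p.1 ∈ us}) (us : List (Fin k → Fin D → ℝ)) (hus : us ∈ S.K)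
    (ys : List (Fin (k + 1) × Fin n)) (hlen : us.length + ys.length = k + 3) :
    cobd (fun us' => slant (hits fun p => trunc k (z p)) us' ys) us +
      cobd (slant (hits fun p => trunc k (z p)) us) ys = 0 := by
  rw [cobd_slant]
  refine ev_eq_zero fun l hl => ?_
  obtain ⟨h1, h2⟩ := support_ez us ys hl
  refine GenericOn.cobd_hits (fun q hq T hT => hgen us hus q hq T fun p hp => (h2 p (hT hp)).1)
    le_rfl (by omega)

/-- The corrected slants at a point form an Euler cochain. -/
lemma nonempty_euler [NeZero n] {S : System (Fin k → Fin D → ℝ) k}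
    (hS : S.g = fun j => ⇑(flipRow j : (Fin k → Fin D → ℝ) →ₗ[ℝ] _)) (hz : RowEquivariant z)
    (hgen : ∀ us ∈ S.K, GenericOn z {p | p.1 ∈ us}) (x : Fin (k + 1) × Fin n) :
    Nonempty (S.Euler fun us => corrected (slant (hits fun p => trunc k (z p))) k us [x]) := by
  set F : List (Fin k → Fin D → ℝ) → List (Fin (k + 1) × Fin n) → ZMod 2 :=
    slant (hits fun p => trunc k (z p)) with hFdef
  have hFmap : ∀ (j : Fin k) us ys, F (us.map (flipRow j)) ys = F us ys := fun j us ys =>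
    slant_map (fun l => hz.hits_map k j l) us ys
  have hgen' : ∀ us ∈ S.K, GenericOn z {p | p ∈ us.map fun u => (u, x)} := by
    intro us hus q hq T hT
    refine hgen us hus q hq T fun p hp => ?_
    obtain ⟨u, hu, rfl⟩ := List.mem_map.1 (hT hp)
    exact hu
  refine ⟨{ t := fun q us => hits (fun p => trunc q (z p)) (us.map fun u => (u, x))
            h := fun q us => halfHits z q (us.map fun u => (u, x))
            b := fun us => filling F k us [x]
            cocycle := ?_, inv := ?_, b_inv := ?_, eq := ?_, t_zero := ?_, t_succ := ?_,
            h_inv := ?_, h_anti := ?_ }⟩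
  · intro us hus hlen
    have h1 := RowEquivariant.slant_relation hgen us hus [x] (by simp [hlen])
    have h2 : cobd (F us) [x] = 0 := by
      rw [cobd_eq_sum]; simp [hFdef, slant_nil_right]
    simp only [corrected]
    rw [cobd_add, cobd_cobd, add_zero]
    rw [← hFdef, h2, add_zero] at h1
    exact h1
  · intro j us _ _
    simp only [hS, corrected, cobd_map, hFmap, filling_map (hFmap j)]
  · intro j us _ _
    simp only [hS, filling_map (hFmap j)]
  · intro us _ _
    simp only [corrected, hFdef, slant_singleton]
  · intro us _ hlen
    rw [hits_eq_one_iff]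
    obtain ⟨u, rfl⟩ := List.length_eq_one_iff.1 hlen
    refine subset_convexHull ℝ _ ⟨(u, x), by simp, Subsingleton.elim _ _⟩
  · intro q hq us hus hlen
    rw [(hgen' us hus).cobd_halfHits hq (by simpa using hlen), cobd_map]
  · intro q hq j hj us _ _
    simp only [hS]
    rw [map_map_pair, halfHits_map]
    exact halfHits_flip_of_ne (z := z) hj (fun p => hz p.1 p.2 j) _
  · intro j us hus hlen
    simp only [hS]
    rw [map_map_pair, halfHits_map z j (Prod.map (flipRow j) id)]
    have hlen' : (us.map fun u => (u, x)).length = (j : ℕ) + 1 := by simpa using hlen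
    have hne : (us.map fun u => (u, x)) ≠ [] := List.ne_nil_of_length_eq_add_one hlen'
    refine halfHits_add_flip (z := z) (fun p => hz p.1 p.2 j) hne ?_
    classical
    refine hits_eq_zero_of_indep ?_
    have := hgen' us hus (j + 1) j.2 (us.map fun u => (u, x)).toFinset
      (fun p hp => List.mem_toFinset.1 hp) ((List.toFinset_card_le _).trans hlen'.le)
    rwa [List.coe_toFinset] at this

end EulerCochain

open Filter Topology

/-! ### Robustness and compactness -/

section Compactness

variable {k D : ℕ}

lemma continuous_rowsApply :
    Continuous fun p : (Fin k → Fin D → ℝ) × (Fin D → ℝ) => rowsApply p.1 p.2 := by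
  refine continuous_pi fun j => ?_
  simp only [rowsApply, dotProduct]
  fun_prop

lemma exists_separation_radius {V E : Type*} [Finite V] [NormedAddCommGroup E] [NormedSpace ℝ E]
    (w : V → E) : ∃ ρ > 0, ∀ τ : Set V, (0 : E) ∉ convexHull ℝ (w '' τ) →
      (0 : E) ∉ Metric.thickening ρ (convexHull ℝ (w '' τ)) := by
  have h : ∀ τ : Set V, ∀ᶠ ρ : ℝ in 𝓝[>] 0, (0 : E) ∉ convexHull ℝ (w '' τ) →
      (0 : E) ∉ Metric.thickening ρ (convexHull ℝ (w '' τ)) := by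
    intro τ
    by_cases h0 : (0 : E) ∈ convexHull ℝ (w '' τ)
    · exact Eventually.of_forall fun ρ h => absurd h0 h
    have hcl : IsClosed (convexHull ℝ (w '' τ)) :=
      (Set.toFinite (w '' τ)).isClosed_convexHull ℝ
    obtain ⟨ε, hε, hball⟩ := Metric.isOpen_iff.1 hcl.isOpen_compl 0 h0
    filter_upwards [Ioo_mem_nhdsGT hε] with ρ hρ _ hmem
    obtain ⟨y, hy, hdist⟩ := Metric.mem_thickening_iff.1 hmem
    exact hball (by rw [Metric.mem_ball, dist_comm]; exact hdist.trans hρ.2) hy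
  obtain ⟨ρ, h1, h2⟩ := ((eventually_all.2 h).and self_mem_nhdsWithin).exists
  exact ⟨ρ, h2, h1⟩

/-- Perturbations of the values of matrices near `u₀` do not create new hits. -/
def Robust {V : Type*} (pt : V → Fin D → ℝ) (u₀ : Fin k → Fin D → ℝ) (r : ℝ) : Prop :=
  ∀ (z : (Fin k → Fin D → ℝ) × V → Fin k → ℝ) (A : Set ((Fin k → Fin D → ℝ) × V)),
    (∀ p ∈ A, dist p.1 u₀ < r) → (∀ p ∈ A, dist (z p) (rowsApply p.1 (pt p.2)) < r) →
    0 ∈ convexHull ℝ (z '' A) → 0 ∈ convexHull ℝ ((fun y => rowsApply u₀ (pt y)) '' (Prod.snd '' A))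

lemma exists_robust {V : Type*} [Finite V] (pt : V → Fin D → ℝ) (u₀ : Fin k → Fin D → ℝ) :
    ∃ r > 0, Robust pt u₀ r := by
  obtain ⟨ρ, hρ, hsep⟩ := exists_separation_radius fun y => rowsApply u₀ (pt y)
  have hcont : ∀ᶠ u in 𝓝 u₀, ∀ y, dist (rowsApply u (pt y)) (rowsApply u₀ (pt y)) < ρ / 2 := by
    refine eventually_all.2 fun y => ?_
    have hc : Continuous fun u : Fin k → Fin D → ℝ => rowsApply u (pt y) :=
      continuous_rowsApply.comp (continuous_id.prodMk continuous_const)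
    exact hc.continuousAt.eventually (Metric.ball_mem_nhds _ (half_pos hρ))
  obtain ⟨r, hr, hball⟩ := Metric.eventually_nhds_iff.1 hcont
  refine ⟨min r (ρ / 2), lt_min hr (half_pos hρ), fun z A hA hz h0 => ?_⟩
  by_contra hnot
  refine hsep _ hnot ?_
  refine convexHull_min ?_ ((convex_convexHull ℝ _).thickening ρ) h0
  rintro _ ⟨p, hp, rfl⟩
  refine Metric.mem_thickening_iff.2
    ⟨rowsApply u₀ (pt p.2), subset_convexHull ℝ _ ⟨p.2, ⟨p, hp, rfl⟩, rfl⟩, ?_⟩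
  have h1 := (hz p hp).trans_le (min_le_right _ _)
  have h2 := hball ((hA p hp).trans_le (min_le_left _ _)) p.2
  linarith [dist_triangle (z p) (rowsApply p.1 (pt p.2)) (rowsApply u₀ (pt p.2))]

lemma exists_uniform_radius {X : Type*} [PseudoMetricSpace X] {K : Set X} (hK : IsCompact K)
    {Q : X → ℝ → Prop} (hQ : ∀ x ∈ K, ∃ r > 0, Q x r) :
    ∃ δ > 0, ∀ x ∈ K, ∃ x₀ ∈ K, ∃ r, δ ≤ r ∧ Q x₀ r ∧ Metric.ball x δ ⊆ Metric.ball x₀ r := by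
  choose! r hr hQr using hQ
  obtain ⟨t, htK, htc⟩ := hK.elim_nhds_subcover (fun x => Metric.ball x (r x))
    fun x hx => Metric.ball_mem_nhds x (hr x hx)
  obtain ⟨δ, hδ, hleb⟩ := lebesgue_number_lemma_of_metric
    (c := fun x : t => Metric.ball (x : X) (r x))
    hK (fun _ => Metric.isOpen_ball) (fun x hx => by simpa using htc hx)
  have hmin : ∀ᶠ η : ℝ in 𝓝[>] 0, ∀ x ∈ t, η < r x :=
    (eventually_all_finset t).2 fun x hx => by
      filter_upwards [Ioo_mem_nhdsGT (hr x (htK x hx))] with η hη using hη.2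
  obtain ⟨η, h1, h2⟩ := (hmin.and self_mem_nhdsWithin).exists
  refine ⟨min δ η, lt_min hδ h2, fun x hx => ?_⟩
  obtain ⟨x₀, hx₀⟩ := hleb x hx
  exact ⟨x₀, htK _ x₀.2, r x₀, (min_le_right _ _).trans (h1 _ x₀.2).le, hQr _ (htK _ x₀.2),
    (Metric.ball_subset_ball (min_le_left _ _)).trans hx₀⟩

lemma isCompact_unitRows : IsCompact (unitRows k D) := by
  refine Metric.isCompact_of_isClosed_isBounded ?_ (Metric.isBounded_iff.2 ⟨2, fun u hu v hv =>
    dist_le_of_unitRows hu hv⟩)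
  simp only [unitRows, Set.ofPred_forall]
  exact isClosed_iInter fun j => isClosed_eq (by fun_prop) continuous_const

end Compactness

/-! ### Signs of inner products of rows -/

section Signs

variable {k D : ℕ}

/-- The sign of the inner product of two rows, with ties broken. -/
noncomputable def pairSign (a b : Fin k) (u : Fin k → Fin D → ℝ) : SignType :=
  if u a ⬝ᵥ u b = 0 then lexSign (u a) * lexSign (u b) else SignType.sign (u a ⬝ᵥ u b)

lemma pairSign_ne_zero {u : Fin k → Fin D → ℝ} (hu : u ∈ unitRows k D) (a b : Fin k) :
    pairSign a b u ≠ 0 := by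
  rw [pairSign]
  split_ifs with h
  · exact mul_ne_zero (lexSign_ne_zero (unitRows_ne_zero hu a))
      (lexSign_ne_zero (unitRows_ne_zero hu b))
  · rwa [Ne, sign_eq_zero_iff]

lemma pairSign_flipRow_left {a b : Fin k} (hab : a ≠ b) (u : Fin k → Fin D → ℝ) :
    pairSign a b (flipRow a u) = -pairSign a b u := by
  simp only [pairSign, flipRow_self, flipRow_of_ne hab.symm, neg_dotProduct, neg_eq_zero,
    lexSign_neg, Left.sign_neg]
  split_ifs
  · rw [neg_mul]
  · rfl

lemma pairSign_comm (a b : Fin k) (u : Fin k → Fin D → ℝ) : pairSign a b u = pairSign b a u := by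
  simp only [pairSign, dotProduct_comm (u a), mul_comm (lexSign (u a))]

lemma pairSign_flipRow_of_ne {a b j : Fin k} (ha : j ≠ a) (hb : j ≠ b) (u : Fin k → Fin D → ℝ) :
    pairSign a b (flipRow j u) = pairSign a b u := by
  simp only [pairSign, flipRow_of_ne ha.symm, flipRow_of_ne hb.symm]

/-- The cochain of degree zero given by the sign of the inner product of two rows. -/
noncomputable def signCochain (a b : Fin k) : List (Fin k → Fin D → ℝ) → ZMod 2
  | [u] => if pairSign a b u = 1 then 1 else 0
  | _ => 0

lemma signPair_signCochain {S : System (Fin k → Fin D → ℝ) k}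
    (hS : S.g = fun j => ⇑(flipRow j : (Fin k → Fin D → ℝ) →ₗ[ℝ] _))
    (hK : ∀ l ∈ S.K, ∀ u ∈ l, u ∈ unitRows k D) {a b : Fin k} (hab : a ≠ b) :
    S.SignPair a b (signCochain a b) := by
  have aux : ∀ σ : SignType, σ ≠ 0 →
      (if σ = 1 then 1 else 0 : ZMod 2) + (if -σ = 1 then 1 else 0 : ZMod 2) = 1 := by decide
  refine ⟨fun j ha hb l _ hlen => ?_, fun l hl hlen => ?_, fun l hl hlen => ?_⟩
  all_goals
    obtain ⟨u, rfl⟩ := List.length_eq_one_iff.1 hlen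
    simp only [hS, List.map_cons, List.map_nil, signCochain]
  · rw [pairSign_flipRow_of_ne ha hb]
  · rw [pairSign_flipRow_left hab]
    exact aux _ (pairSign_ne_zero (hK _ hl u (by simp)) a b)
  · rw [pairSign_comm a b (flipRow b u), pairSign_flipRow_left hab.symm, pairSign_comm b a]
    exact aux _ (pairSign_ne_zero (hK _ hl u (by simp)) a b)

lemma cobd_signCochain_eq_zero {a b : Fin k} {l : List (Fin k → Fin D → ℝ)} (hlen : l.length = 2)
    (h : ∀ u ∈ l, ∀ v ∈ l, 0 < (u a ⬝ᵥ u b) * (v a ⬝ᵥ v b)) : cobd (signCochain a b) l = 0 := by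
  obtain ⟨u, v, rfl⟩ := List.length_eq_two.1 hlen
  have huv := h u (by simp) v (by simp)
  have e : pairSign a b u = pairSign a b v := by
    rw [pairSign, pairSign, if_neg (left_ne_zero_of_mul huv.ne'),
      if_neg (right_ne_zero_of_mul huv.ne')]
    rcases pos_and_pos_or_neg_and_neg_of_mul_pos huv with ⟨h1, h2⟩ | ⟨h1, h2⟩
    · rw [sign_pos h1, sign_pos h2]
    · rw [sign_neg h1, sign_neg h2]
  rw [cobd_eq_sum]
  simp [Fin.sum_univ_two, signCochain, e, CharTwo.add_self_eq_zero]

end Signs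

/-! ### Heavy orthogonal matrices -/

section Heavy

variable {k D : ℕ}

/-- Matrices with pairwise orthogonal rows of `ℓ¹`-norm one. -/
def orthRows (k D : ℕ) : Set (Fin k → Fin D → ℝ) :=
  {u | u ∈ unitRows k D ∧ ∀ a b, a ≠ b → u a ⬝ᵥ u b = 0}

lemma linearIndependent_of_mem_orthRows {u : Fin k → Fin D → ℝ} (hu : u ∈ orthRows k D) :
    LinearIndependent ℝ u := by
  rw [Fintype.linearIndependent_iff]
  intro g hg j
  have h := congrArg (fun v => v ⬝ᵥ u j) hg
  simp only [sum_dotProduct, smul_dotProduct, zero_dotProduct, smul_eq_mul] at h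
  rw [Finset.sum_eq_single j (fun b _ hb => by rw [hu.2 b j hb, mul_zero]) (by simp)] at h
  refine (mul_eq_zero.1 h).resolve_right fun h0 => unitRows_ne_zero hu.1 j ?_
  exact dotProduct_self_eq_zero.1 h0

/-- A coloured family is in general position if every hyperplane contains few points of each
colour. -/
def GeneralPosition {C : Type*} {n : ℕ} (pt : C × Fin n → Fin D → ℝ) : Prop :=
  ∀ f : Fin D → ℝ, f ≠ 0 → ∀ c, {x | f ⬝ᵥ pt (c, x) = 0}.ncard ≤ D

lemma exists_dual_of_mem_orthRows {u : Fin k → Fin D → ℝ} (hu : u ∈ orthRows k D)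
    {f : (Fin k → ℝ) →ₗ[ℝ] ℝ} (hf : f ≠ 0) :
    ∃ g : Fin D → ℝ, g ≠ 0 ∧ ∀ y, f (rowsApply u y) = g ⬝ᵥ y := by
  refine ⟨∑ j, f (Pi.single j 1) • u j, fun h0 => ?_, fun y => ?_⟩
  · have h1 := Fintype.linearIndependent_iff.1 (linearIndependent_of_mem_orthRows hu) _ h0
    refine hf (LinearMap.pi_ext' fun j => LinearMap.ext_ring ?_)
    simpa using h1 j
  · rw [LinearMap.pi_apply_eq_sum_univ f]
    simp only [sum_dotProduct, smul_dotProduct, rowsApply, smul_eq_mul]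
    refine Finset.sum_congr rfl fun j _ => ?_
    rw [mul_comm]
    congr 2
    funext i
    simp [Pi.single_apply, eq_comm]

lemma GeneralPosition.ncard_rowsApply_le {C : Type*} {n : ℕ} {pt : C × Fin n → Fin D → ℝ}
    (hpt : GeneralPosition pt) {u : Fin k → Fin D → ℝ} (hu : u ∈ orthRows k D)
    (W : Submodule ℝ (Fin k → ℝ)) (hW : W ≠ ⊤) (c : C) :
    {x | rowsApply u (pt (c, x)) ∈ W}.ncard ≤ D := by
  obtain ⟨f, hf, hWf⟩ := Submodule.exists_le_ker_of_lt_top W hW.lt_top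
  obtain ⟨g, hg0, hfg⟩ := exists_dual_of_mem_orthRows hu hf
  refine (Set.ncard_le_ncard (fun x hx => ?_) (Set.toFinite _)).trans (hpt g hg0 c)
  have : f (rowsApply u (pt (c, x))) = 0 := hWf hx
  rwa [hfg] at this

/-- The number of rainbow tuples whose image contains the origin in its convex hull. -/
noncomputable def weight {n : ℕ} (u : Fin k → Fin D → ℝ) (pt : Fin (k + 1) × Fin n → Fin D → ℝ) :
    ℕ := cnt (colorsFrom k 0) (hits fun y => rowsApply u (pt y))

lemma corrected_eq_zero_of_robust {n : ℕ} [NeZero n] (hk : 1 ≤ k) {S : System (Fin k → Fin D → ℝ) k}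
    {pt : Fin (k + 1) × Fin n → Fin D → ℝ} (hpt : GeneralPosition pt) {ε : ℝ}
    (hlarge : (k * D : ℝ) * (k + 2) < n * ε) {u₀ : Fin k → Fin D → ℝ} (hu₀ : u₀ ∈ orthRows k D)
    (hw : (weight u₀ pt : ℝ) ≤ (2 * k / ((Nat.factorial (k + 1) : ℝ) * (k + 1)) - ε) * n ^ (k + 1))
    {r : ℝ} (hr : Robust pt u₀ r)
    {z : (Fin k → Fin D → ℝ) × (Fin (k + 1) × Fin n) → Fin k → ℝ}
    (hz : ∀ us ∈ S.K, ∀ u ∈ us, ∀ y, dist (z (u, y)) (rowsApply u (pt y)) < r)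
    (hgen : ∀ us ∈ S.K, GenericOn z {p | p.1 ∈ us})
    {us : List (Fin k → Fin D → ℝ)} (hus : us ∈ S.K) (hball : ∀ u ∈ us, dist u u₀ < r)
    (hlen : us.length = k + 1) (x : Fin (k + 1) × Fin n) :
    corrected (slant (hits fun p => trunc k (z p))) k us [x] = 0 := by
  set F : List (Fin k → Fin D → ℝ) → List (Fin (k + 1) × Fin n) → ZMod 2 :=
    slant (hits fun p => trunc k (z p)) with hFdef
  let R : Set (List (Fin k → Fin D → ℝ)) := {l | l ∈ S.K ∧ ∀ u ∈ l, dist u u₀ < r}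
  have hhit : ∀ l ∈ R, ∀ ys, F l ys ≠ 0 → hits (fun y => rowsApply u₀ (pt y)) ys ≠ 0 := by
    intro l hl ys hne
    obtain ⟨L, hL, hL0⟩ := exists_of_slant_ne_zero hne
    have h1 : (0 : Fin k → ℝ) ∈ convexHull ℝ (z '' {p | p ∈ L}) := by
      by_contra hnot
      refine hL0 ?_
      simp only [trunc_self]
      exact if_neg hnot
    have h2 := hr z _ (fun p hp => hl.2 _ (hL p hp).1) (fun p hp => hz l hl.1 _ (hL p hp).1 p.2) h1
    have h3 : hits (fun y => rowsApply u₀ (pt y)) ys = 1 := by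
      rw [hits_eq_one_iff]
      refine convexHull_mono (Set.image_mono ?_) h2
      rintro _ ⟨p, hp, rfl⟩
      exact (hL p hp).2
    rw [h3]
    exact one_ne_zero
  refine corrected_eq_zero S.sublist_mem (fun ys hys => slant_nil_left _ (by omega))
    (RowEquivariant.slant_relation hgen) hk (R := R) (fun l hl => hl.1)
    (fun l hl l' hs => ⟨S.sublist_mem l hl.1 l' hs, fun u hu => hl.2 u (hs.subset hu)⟩)
    (by positivity) hlarge (fun l hl _ => ?_) (fun l hl js h1 h2 => ?_) us ⟨hus, hball⟩ hlen x
  · refine le_trans ?_ hw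
    exact_mod_cast cnt_mono fun ys _ h => hhit l hl ys h
  · have h3 : cnt js (F l) ≤ js.length * (D * n ^ (js.length - 1)) :=
      (cnt_mono fun ys _ h => hhit l hl ys h).trans
        (cnt_hits_le _ D (hpt.ncard_rowsApply_le hu₀) js (by simp; omega))
    have h4 : cnt js (F l) ≤ k * D * n ^ (js.length - 1) := by
      rw [mul_assoc]
      exact h3.trans (Nat.mul_le_mul_right _ (by omega))
    exact_mod_cast h4

/-- For families in general position some orthogonal matrix is heavy for all of them. -/
lemma exists_heavy_of_generalPosition (hk : 1 ≤ k) {N : ℕ} (hD : D = N + k) {ε : ℝ}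
    (nn : Fin N → ℕ) (hlarge : ∀ i, (k * D : ℝ) * (k + 2) < nn i * ε)
    (Y : ∀ i, Fin (k + 1) × Fin (nn i) → Fin D → ℝ) (hY : ∀ i, GeneralPosition (Y i)) :
    ∃ u ∈ orthRows k D, ∀ i,
      (2 * k / ((Nat.factorial (k + 1) : ℝ) * (k + 1)) - ε) * (nn i) ^ (k + 1) ≤
        (weight u (Y i) : ℝ) := by
  by_contra! hbad
  have hne : ∀ i, NeZero (nn i) := fun i => ⟨fun h0 => by
    have h1 := hlarge i
    have h2 : (0 : ℝ) ≤ (k * D : ℝ) * (k + 2) := by positivity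
    simp only [h0, Nat.cast_zero, zero_mul] at h1
    linarith⟩
  obtain ⟨δ₀, hδ₀, hcover⟩ := exists_uniform_radius isCompact_unitRows
    (Q := fun (u₀ : Fin k → Fin D → ℝ) r =>
      (∃ a b, a < b ∧ ∀ u v, dist u u₀ < r → dist v u₀ < r →
        0 < (u a ⬝ᵥ u b) * (v a ⬝ᵥ v b)) ∨
      (u₀ ∈ orthRows k D ∧ ∃ i, (weight u₀ (Y i) : ℝ) <
        (2 * k / ((Nat.factorial (k + 1) : ℝ) * (k + 1)) - ε) * (nn i) ^ (k + 1) ∧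
        Robust (Y i) u₀ r)) (by
    intro u₀ hu₀
    by_cases ho : u₀ ∈ orthRows k D
    · obtain ⟨i, hi⟩ := hbad u₀ ho
      obtain ⟨r, hr, hrob⟩ := exists_robust (Y i) u₀
      exact ⟨r, hr, Or.inr ⟨ho, i, hi, hrob⟩⟩
    · have : ∃ a b, a < b ∧ u₀ a ⬝ᵥ u₀ b ≠ 0 := by
        by_contra! H
        refine ho ⟨hu₀, fun a b hab => ?_⟩
        rcases hab.lt_or_gt with h | h
        · exact H a b h
        · rw [dotProduct_comm]; exact H b a h
      obtain ⟨a, b, hab, hne⟩ := this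
      have hc : Continuous fun u : Fin k → Fin D → ℝ => (u a ⬝ᵥ u b) * (u₀ a ⬝ᵥ u₀ b) := by
        simp only [dotProduct]
        fun_prop
      have hpos : 0 < (u₀ a ⬝ᵥ u₀ b) * (u₀ a ⬝ᵥ u₀ b) := mul_self_pos.2 hne
      obtain ⟨r, hr, hball⟩ := Metric.eventually_nhds_iff.1
        (hc.continuousAt.eventually (lt_mem_nhds hpos))
      refine ⟨r, hr, Or.inl ⟨a, b, hab, fun u v hu hv => ?_⟩⟩
      have h1 := mul_pos (hball hu) (hball hv)
      rw [show (u a ⬝ᵥ u b) * (u₀ a ⬝ᵥ u₀ b) * ((v a ⬝ᵥ v b) * (u₀ a ⬝ᵥ u₀ b)) =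
        (u a ⬝ᵥ u b) * (v a ⬝ᵥ v b) * ((u₀ a ⬝ᵥ u₀ b) * (u₀ a ⬝ᵥ u₀ b)) by ring] at h1
      exact (mul_pos_iff_of_pos_right hpos).1 h1)
  have hδ : 0 < min δ₀ (1 / (D + 1)) := lt_min hδ₀ (by positivity)
  obtain ⟨S, U, hSg, hStop, hUfin, hUunit, -, hSK⟩ := exists_system (k := k) (D := D)
    (fun j => N + (j : ℕ)) (fun j => by have := j.2; omega) hδ
  have hz := fun i => exists_equivariant_generic (Y i) hUfin hUunit hδ₀
  choose z hzeq hzdist hzgen using hz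
  have hKU : ∀ us ∈ S.K, ∀ u ∈ us, u ∈ U := fun us hus => by
    rw [hSK] at hus
    exact hus.1
  have hKδ : ∀ us ∈ S.K, ∀ u ∈ us, ∀ v ∈ us, dist u v < min δ₀ (1 / (D + 1)) := fun us hus => by
    rw [hSK] at hus
    exact hus.2
  have hgen : ∀ i, ∀ us ∈ S.K, GenericOn (z i) {p | p.1 ∈ us} := by
    intro i us hus
    refine hzgen i _ (fun p hp => hKU us hus _ hp) fun p hp p' hp' => ?_
    have h1 := (hKδ us hus _ hp _ hp').trans_le (min_le_right _ _)
    rw [lt_div_iff₀ (by positivity)] at h1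
    nlinarith [dist_nonneg (x := p.1) (y := p'.1)]
  let x : ∀ i, Fin (k + 1) × Fin (nn i) := fun i => (0, ⟨0, Nat.pos_of_ne_zero (hne i).out⟩)
  refine S.no_avoiding hk
    (fun i us => corrected (slant (hits fun p => trunc k (z i p))) k us [x i])
    (fun i => nonempty_euler hSg (hzeq i) (hgen i) (x i)) signCochain
    (fun a b hab => signPair_signCochain hSg (fun l hl u hu => hUunit (hKU l hl u hu)) hab) hStop ?_
  intro l hl hl0
  obtain ⟨u, hul⟩ := List.exists_mem_of_ne_nil l hl0
  obtain ⟨u₀, -, r, hδr, hQ, hsub⟩ := hcover u (hUunit (hKU l hl u hul))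
  have hball : ∀ v ∈ l, dist v u₀ < r := fun v hv =>
    hsub ((hKδ l hl v hv u hul).trans_le (min_le_left _ _))
  rcases hQ with ⟨a, b, hab, hpos⟩ | ⟨ho, i, hi, hrob⟩
  · exact Or.inr ⟨a, b, hab, fun l' hs hlen => cobd_signCochain_eq_zero hlen fun v hv w hw =>
      hpos v w (hball v (hs.subset hv)) (hball w (hs.subset hw))⟩
  · exact Or.inl ⟨i, fun l' hs hlen =>
      corrected_eq_zero_of_robust hk (hY i) (hlarge i) ho hi.le hrob
      (fun us hus v hv y => (hzdist i v (hKU us hus v hv) y).trans_le hδr) (hgen i)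
      (S.sublist_mem l hl l' hs) (fun v hv => hball v (hs.subset hv)) hlen _⟩

end Heavy

/-! ### Arbitrary families -/

section Limit

variable {k D : ℕ}

lemma exists_generalPosition {C : Type*} [Finite C] {n : ℕ} (pt : C × Fin n → Fin D → ℝ) {η : ℝ}
    (hη : 0 < η) : ∃ pt' : C × Fin n → Fin D → ℝ, (∀ y, dist (pt' y) (pt y) < η) ∧
      GeneralPosition pt' := by
  obtain ⟨w, hw, hgen⟩ := exists_generic pt hη
  refine ⟨w, hw, fun f hf c => ?_⟩
  by_contra! hcard
  obtain ⟨T, hT, hTcard⟩ := Set.exists_subset_card_eq hcard.le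
  have hfin : T.Finite := Set.toFinite T
  let T' : Finset (C × Fin n) := hfin.toFinset.map ⟨Prod.mk c, Prod.mk_right_injective c⟩
  have hT'card : T'.card = D := by
    rw [Finset.card_map, ← Set.ncard_eq_toFinset_card T hfin, hTcard]
  have hind := hgen (fun _ _ => 1) (fun _ _ => one_ne_zero) D le_rfl T' hT'card.le
  have e : (fun x => trunc D (signScale (fun _ => 1) (w x))) = w := by
    funext x a
    simp [trunc_self, signScale_apply]
  rw [e] at hind
  have hspan : Submodule.span ℝ (Set.range fun x : T' => w x) = ⊤ :=
    LinearIndependent.span_eq_top_of_card_eq_finrank' hind (by simp [hT'card])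
  have hker : Submodule.span ℝ (Set.range fun x : T' => w x) ≤
      LinearMap.ker (dotProductBilin ℝ ℝ f) := by
    rw [Submodule.span_le]
    rintro _ ⟨⟨x, hx⟩, rfl⟩
    obtain ⟨y, hy, rfl⟩ := Finset.mem_map.1 hx
    exact hT (hfin.mem_toFinset.1 hy)
  rw [hspan] at hker
  exact hf (dotProduct_self_eq_zero.1 (hker (Submodule.mem_top (x := f))))

lemma dist_rowsApply_le {u : Fin k → Fin D → ℝ} (hu : u ∈ unitRows k D) (y y' : Fin D → ℝ) :
    dist (rowsApply u y) (rowsApply u y') ≤ dist y y' := by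
  refine (dist_pi_le_iff dist_nonneg).2 fun j => ?_
  rw [Real.dist_eq, rowsApply, rowsApply, ← dotProduct_sub]
  calc |u j ⬝ᵥ (y - y')| ≤ ∑ a, |u j a * (y - y') a| := Finset.abs_sum_le_sum_abs _ _
    _ ≤ ∑ a, |u j a| * dist y y' := by
        refine Finset.sum_le_sum fun a _ => ?_
        rw [abs_mul]
        exact mul_le_mul_of_nonneg_left (dist_le_pi_dist y y' a) (abs_nonneg _)
    _ = dist y y' := by rw [← Finset.sum_mul, hu j, one_mul]

lemma isCompact_orthRows : IsCompact (orthRows k D) := by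
  have h : IsClosed {u : Fin k → Fin D → ℝ | ∀ a b, a ≠ b → u a ⬝ᵥ u b = 0} := by
    simp only [Set.ofPred_forall]
    refine isClosed_iInter fun a => isClosed_iInter fun b => isClosed_iInter fun _ =>
      isClosed_eq ?_ continuous_const
    simp only [dotProduct]
    fun_prop
  exact isCompact_unitRows.inter_right h

/-- Some orthogonal matrix is heavy for all families. -/
lemma exists_heavy (hk : 1 ≤ k) {N : ℕ} (hD : D = N + k) {ε : ℝ}
    (nn : Fin N → ℕ) (hlarge : ∀ i, (k * D : ℝ) * (k + 2) < nn i * ε)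
    (Y : ∀ i, Fin (k + 1) × Fin (nn i) → Fin D → ℝ) :
    ∃ u ∈ orthRows k D, ∀ i,
      (2 * k / ((Nat.factorial (k + 1) : ℝ) * (k + 1)) - ε) * (nn i) ^ (k + 1) ≤
        (weight u (Y i) : ℝ) := by
  by_contra! hbad
  obtain ⟨δ, hδ, hcover⟩ := exists_uniform_radius isCompact_orthRows
    (Q := fun (u₀ : Fin k → Fin D → ℝ) r => ∃ i, (weight u₀ (Y i) : ℝ) <
        (2 * k / ((Nat.factorial (k + 1) : ℝ) * (k + 1)) - ε) * (nn i) ^ (k + 1) ∧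
        Robust (Y i) u₀ r) (by
    intro u₀ hu₀
    obtain ⟨i, hi⟩ := hbad u₀ hu₀
    obtain ⟨r, hr, hrob⟩ := exists_robust (Y i) u₀
    exact ⟨r, hr, i, hi, hrob⟩)
  have hgp := fun i => exists_generalPosition (Y i) hδ
  choose Y' hdist hgp using hgp
  obtain ⟨u, hu, hheavy⟩ := exists_heavy_of_generalPosition hk hD nn hlarge Y' hgp
  obtain ⟨u₀, -, r, hδr, ⟨i, hi, hrob⟩, hsub⟩ := hcover u hu
  refine absurd ((hheavy i).trans ?_) (not_le.2 hi)
  refine Nat.cast_le.2 (cnt_mono fun ys _ h => ?_)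
  have h1 : (0 : Fin k → ℝ) ∈ convexHull ℝ ((fun y => rowsApply u (Y' i y)) '' {y | y ∈ ys}) := by
    by_contra hnot
    exact h (if_neg hnot)
  have h2 := hrob (fun p => rowsApply u (Y' i p.2)) ((fun y => (u, y)) '' {y | y ∈ ys})
    (by rintro _ ⟨y, _, rfl⟩; exact hsub (Metric.mem_ball_self hδ))
    (by
      rintro _ ⟨y, _, rfl⟩
      exact ((dist_rowsApply_le hu.1 _ _).trans_lt (hdist i y)).trans_le hδr)
    (by rwa [Set.image_image])
  rw [Set.image_image, Set.image_image] at h2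
  rw [hits_eq_one_iff.2 h2]
  exact one_ne_zero

end Limit

/-! ### Counting tuples -/

section Tuples

open Classical in
lemma cnt_ofFn {C : Type*} {n p : ℕ} (c : Fin p → C) (f : List (C × Fin n) → ZMod 2) :
    cnt (List.ofFn c) f =
      ∑ g : Fin p → Fin n, if f (List.ofFn fun a => (c a, g a)) = 0 then 0 else 1 := by
  induction p generalizing f with
  | zero => simp [cnt]
  | succ p ih =>
    rw [List.ofFn_succ, cnt, ← (Fin.consEquiv fun _ => Fin n).sum_comp, Fintype.sum_prod_type]
    refine Finset.sum_congr rfl fun x _ => ?_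
    rw [ih]
    refine Finset.sum_congr rfl fun g _ => ?_
    simp [List.ofFn_succ, Fin.consEquiv]

lemma weight_eq_ncard {k D n : ℕ} (u : Fin k → Fin D → ℝ) (pt : Fin (k + 1) × Fin n → Fin D → ℝ) :
    weight u pt = {g : Fin (k + 1) → Fin n |
      0 ∈ convexHull ℝ (Set.range fun c => rowsApply u (pt (c, g c)))}.ncard := by
  classical
  have h : colorsFrom k 0 = List.ofFn fun c : Fin (k + 1) => c := by
    exact (List.drop_zero (l := List.finRange (k + 1))).trans (List.ofFn_id (k + 1)).symm
  rw [weight, h, cnt_ofFn, Set.ncard_eq_toFinset_card', Set.toFinset_ofPred, Finset.card_filter]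
  refine Finset.sum_congr rfl fun g _ => ?_
  have e : (fun y => rowsApply u (pt y)) '' {y | y ∈ List.ofFn fun c : Fin (k + 1) => (c, g c)} =
      Set.range fun c => rowsApply u (pt (c, g c)) := by
    ext v
    simp only [Set.mem_image, Set.mem_ofPred_eq, List.mem_ofFn, Set.mem_range, exists_exists_eq_and]
  rw [hits, e]
  split_ifs <;> simp_all

end Tuples

/-! ### From matrices to flats -/

section Flats

variable {k d : ℕ}

/-- The affine map whose coordinates are given by the rows of a matrix, the first column being the
constant term. -/
noncomputable def affineRows (u : Fin k → Fin (d + 1) → ℝ) :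
    EuclideanSpace ℝ (Fin d) →ᵃ[ℝ] (Fin k → ℝ) where
  toFun y := rowsApply u (Fin.cons 1 fun a => y a)
  linear :=
    { toFun := fun y => rowsApply u (Fin.cons 0 fun a => y a)
      map_add' := fun y y' => by
        funext j; simp [rowsApply, dotProduct, Fin.sum_univ_succ, mul_add, Finset.sum_add_distrib]
      map_smul' := fun c y => by
        funext j; simp [rowsApply, dotProduct, Fin.sum_univ_succ, Finset.mul_sum, mul_left_comm] }
  map_vadd' y v := by
    funext j
    simp [rowsApply, dotProduct, Fin.sum_univ_succ, mul_add, Finset.sum_add_distrib]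
    ring

lemma affineRows_apply (u : Fin k → Fin (d + 1) → ℝ) (y : EuclideanSpace ℝ (Fin d)) :
    affineRows u y = rowsApply u (Fin.cons 1 fun a => y a) := rfl

lemma range_affineRows_linear {u : Fin k → Fin (d + 1) → ℝ} (hu : u ∈ orthRows k (d + 1))
    {y₀ : EuclideanSpace ℝ (Fin d)} (hy₀ : affineRows u y₀ = 0) :
    LinearMap.range (affineRows u).linear = ⊤ := by
  by_contra hne
  obtain ⟨f, hf, hle⟩ := Submodule.exists_le_ker_of_lt_top _ (lt_top_iff_ne_top.2 hne)
  obtain ⟨g, hg, hfg⟩ := exists_dual_of_mem_orthRows hu hf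
  have h1 : ∀ v : EuclideanSpace ℝ (Fin d), ∑ a, g (Fin.succ a) * v a = 0 := by
    intro v
    have : f ((affineRows u).linear v) = 0 := hle ⟨v, rfl⟩
    change f (rowsApply u (Fin.cons 0 fun a => v a)) = 0 at this
    rw [hfg] at this
    simpa [dotProduct, Fin.sum_univ_succ] using this
  have h2 : g 0 = 0 := by
    have : f (affineRows u y₀) = 0 := by rw [hy₀, map_zero]
    rw [affineRows_apply, hfg] at this
    simpa [dotProduct, Fin.sum_univ_succ, h1 y₀] using this
  refine hg (funext fun a => ?_)
  refine Fin.cases h2 (fun a => ?_) a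
  simpa using h1 (EuclideanSpace.single a 1)

/-- The flat on which an affine map with orthogonal rows vanishes. -/
lemma exists_flat {m : ℕ} (hd : d = m + k) {u : Fin k → Fin (d + 1) → ℝ}
    (hu : u ∈ orthRows k (d + 1)) {y₀ : EuclideanSpace ℝ (Fin d)} (hy₀ : affineRows u y₀ = 0) :
    ∃ L : AffineSubspace ℝ (EuclideanSpace ℝ (Fin d)),
      (L : Set (EuclideanSpace ℝ (Fin d))).Nonempty ∧ Module.finrank ℝ L.direction = m ∧
      ∀ y, y ∈ L ↔ affineRows u y = 0 := by
  refine ⟨AffineSubspace.mk' y₀ (LinearMap.ker (affineRows u).linear),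
    AffineSubspace.mk'_nonempty _ _, ?_, fun y => ?_⟩
  · rw [AffineSubspace.direction_mk']
    have h := LinearMap.finrank_range_add_finrank_ker (affineRows u).linear
    rw [range_affineRows_linear hu hy₀, finrank_top] at h
    simp only [Module.finrank_fintype_fun_eq_card, Fintype.card_fin, finrank_euclideanSpace] at h
    omega
  · rw [AffineSubspace.mem_mk', LinearMap.mem_ker, AffineMap.linearMap_vsub, hy₀]
    simp

/-- The transversal theorem for `d = m + k`. -/
theorem exists_heavy_flat (d m k : ℕ) (hd : d = m + k) (hk : 1 ≤ k) (ε : ℝ) (hε : 0 < ε) :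
    ∃ N₀ : ℕ, ∀ nn : Fin (m + 1) → ℕ, (∀ i, N₀ ≤ nn i) →
      ∀ P : Fin (m + 1) → Fin (k + 1) → Finset (EuclideanSpace ℝ (Fin d)),
        (∀ i j, (P i j).card = nn i) →
        ∃ L : AffineSubspace ℝ (EuclideanSpace ℝ (Fin d)),
          (L : Set (EuclideanSpace ℝ (Fin d))).Nonempty ∧ Module.finrank ℝ L.direction = m ∧
          ∀ i : Fin (m + 1),
            ((2 * (k : ℝ)) / ((Nat.factorial (k + 1) : ℝ) * ((k : ℝ) + 1)) - ε) *
                (nn i : ℝ) ^ (k + 1) ≤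
              (({t : Fin (k + 1) → EuclideanSpace ℝ (Fin d) | (∀ j, t j ∈ P i j) ∧
                  (convexHull ℝ (Set.range t) ∩
                    (L : Set (EuclideanSpace ℝ (Fin d)))).Nonempty}).ncard : ℝ) := by
  set c : ℝ := (2 * (k : ℝ)) / ((Nat.factorial (k + 1) : ℝ) * ((k : ℝ) + 1)) with hc
  have hc0 : 0 < c := by
    have : (0 : ℝ) < k := by exact_mod_cast hk
    positivity
  have hε' : 0 < min ε (c / 2) := lt_min hε (half_pos hc0)
  obtain ⟨N₀, hN₀⟩ := exists_nat_gt ((k * (d + 1 : ℕ) : ℝ) * (k + 2) / min ε (c / 2))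
  refine ⟨N₀, fun nn hnn P hP => ?_⟩
  have hlarge : ∀ i, (k * (d + 1 : ℕ) : ℝ) * (k + 2) < nn i * min ε (c / 2) := fun i => by
    rw [← div_lt_iff₀ hε']
    exact hN₀.trans_le (by exact_mod_cast hnn i)
  let pts : ∀ i (j : Fin (k + 1)), Fin (nn i) → EuclideanSpace ℝ (Fin d) := fun i j x =>
    ((P i j).equivFinOfCardEq (hP i j)).symm x
  have hpts : ∀ i j, Function.Injective (pts i j) := fun i j =>
    Subtype.val_injective.comp (Equiv.injective _)
  obtain ⟨u, hu, hheavy⟩ := exists_heavy hk (N := m + 1) (D := d + 1) (by omega) nn hlarge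
    fun i y => Fin.cons 1 fun a => pts i y.1 y.2 a
  have hhull : ∀ t : Fin (k + 1) → EuclideanSpace ℝ (Fin d),
      0 ∈ convexHull ℝ (Set.range fun j => affineRows u (t j)) →
        ∃ y ∈ convexHull ℝ (Set.range t), affineRows u y = 0 := by
    intro t ht
    rwa [show (fun j => affineRows u (t j)) = affineRows u ∘ t from rfl, Set.range_comp,
      ← AffineMap.image_convexHull] at ht
  simp only [weight_eq_ncard] at hheavy
  obtain ⟨y₀, hy₀⟩ : ∃ y, affineRows u y = 0 := by
    have hn0 : 0 < (nn 0 : ℝ) := by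
      have h1 : (0 : ℝ) ≤ (k * (d + 1 : ℕ) : ℝ) * (k + 2) := by positivity
      exact pos_of_mul_pos_left (h1.trans_lt (hlarge 0)) hε'.le
    have hpos : 0 < (c - min ε (c / 2)) * (nn 0 : ℝ) ^ (k + 1) :=
      mul_pos (by linarith [min_le_right ε (c / 2)]) (by positivity)
    have h2 := hpos.trans_le (hheavy 0)
    obtain ⟨g, hg⟩ := Set.nonempty_of_ncard_ne_zero (Nat.cast_pos.1 h2).ne'
    obtain ⟨y, -, hy⟩ := hhull (fun j => pts 0 j (g j)) hg
    exact ⟨y, hy⟩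
  obtain ⟨L, hLne, hLdim, hL⟩ := exists_flat hd hu hy₀
  refine ⟨L, hLne, hLdim, fun i => ?_⟩
  calc (c - ε) * (nn i : ℝ) ^ (k + 1) ≤ (c - min ε (c / 2)) * (nn i : ℝ) ^ (k + 1) := by
        gcongr
        exact min_le_left _ _
    _ ≤ _ := hheavy i
    _ ≤ _ := by
        refine Nat.cast_le.2 (Set.ncard_le_ncard_of_injOn (fun g j => pts i j (g j)) ?_ ?_ ?_)
        · intro g hg
          obtain ⟨y, hy, hy0⟩ := hhull (fun j => pts i j (g j)) hg
          exact ⟨fun j => Subtype.property _, y, hy, (hL y).2 hy0⟩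
        · intro g _ g' _ h
          exact funext fun j => hpts i j (congrFun h j)
        · exact (Set.Finite.pi' fun j => (P i j).finite_toSet).subset fun t ht => ht.1

end Flats

end HeavyFlat

/-- **Colorful transversal version of the heavily covered point theorem.**
For every `d ≥ 1`, every `m` with `0 ≤ m ≤ d-1`, and every `ε > 0` there is `N₀` such
that: for any finite point sets `P₀, …, P_m` in `ℝ^d`, where each `P_i` has cardinality
`(d-m+1)·n_i` with `n_i ≥ N₀` and is partitioned into `d-m+1` color classes of size
`n_i` each, there is an `m`-dimensional affine subspace `L` of `ℝ^d` such that for every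
`i`, at least `(2(d-m)/((d-m+1)!(d-m+1)) - ε) · n_i^(d-m+1)` of the rainbow
`(d-m+1)`-tuples of points of `P_i` (one point from each color class) have convex hull
meeting `L`. -/
theorem colorful_transversal_heavily_covered (d m : ℕ) (hd : 1 ≤ d) (hm : m ≤ d - 1)
    (ε : ℝ) (hε : 0 < ε) :
    ∃ N₀ : ℕ, ∀ nn : Fin (m + 1) → ℕ, (∀ i, N₀ ≤ nn i) →
      ∀ P : Fin (m + 1) → Fin (d - m + 1) → Finset (EuclideanSpace ℝ (Fin d)),
        (∀ i j, (P i j).card = nn i) →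
        (∀ i, ∀ j k : Fin (d - m + 1), j ≠ k → Disjoint (P i j) (P i k)) →
        ∃ L : AffineSubspace ℝ (EuclideanSpace ℝ (Fin d)),
          (L : Set (EuclideanSpace ℝ (Fin d))).Nonempty ∧
          Module.finrank ℝ L.direction = m ∧
          ∀ i : Fin (m + 1),
            ((2 * ((d - m : ℕ) : ℝ)) /
                ((Nat.factorial (d - m + 1) : ℝ) * (((d - m : ℕ) : ℝ) + 1)) - ε) *
                (nn i : ℝ) ^ (d - m + 1) ≤
              (({t : Fin (d - m + 1) → EuclideanSpace ℝ (Fin d) |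
                  (∀ j, t j ∈ P i j) ∧
                  (convexHull ℝ (Set.range t) ∩
                    (L : Set (EuclideanSpace ℝ (Fin d)))).Nonempty}).ncard : ℝ) := by
  obtain ⟨N₀, hN₀⟩ := HeavyFlat.exists_heavy_flat d m (d - m) (by omega) (by omega) ε hε
  exact ⟨N₀, fun nn hnn P hP _ => hN₀ nn hnn P hP⟩
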